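/- arXiv:1901.03980 — 3 statements merged into one kernel-verified Lean document; each statement's English description precedes it below -/
import Mathlib

section
/- Let G be a dicyclic group of order 4m, where m ≥ 2 (so D(G) = 3m). Then for every k ∈ ℕ, k·D(G) + 2 ≤ ρ_{2k+1}(G) ≤ ⌊(2k+1)·D(G)/2⌋ - 1. -/
/-- A multiset over a group is a *product-one sequence* if its terms can be
ordered so that their product is `1`. -/
def IsProductOne {G : Type*} [Group G] (S : Multiset G) : Prop :=
  ∃ l : List G, (l : Multiset G) = S ∧ l.prod = 1

/-- A product-one sequence is *minimal* (an atom of `B(G)`) if it is non-trivial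
and cannot be written as a concatenation of two non-trivial product-one
sequences. -/
def IsMinimalProductOne {G : Type*} [Group G] (S : Multiset G) : Prop :=
  S ≠ 0 ∧ IsProductOne S ∧
    ∀ T₁ T₂ : Multiset G, T₁ ≠ 0 → T₂ ≠ 0 → IsProductOne T₁ → IsProductOne T₂ →
      S ≠ T₁ + T₂

/-- The large Davenport constant `D(G)`: the maximal length of a minimal
product-one sequence over `G`. -/
noncomputable def DavenportLarge (G : Type*) [Group G] : ℕ :=
  sSup {m | ∃ S : Multiset G, IsMinimalProductOne S ∧ Multiset.card S = m}

/-- `k ∈ L(a)`: the product-one sequence `a` is a concatenation of `k` minimal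
product-one sequences. -/
def HasLength {G : Type*} [Group G] (a : Multiset G) (k : ℕ) : Prop :=
  ∃ f : Fin k → Multiset G, (∀ i, IsMinimalProductOne (f i)) ∧ (∑ i, f i) = a

/-- `U_k(G)`: the union of all sets of lengths `L(a)` with `k ∈ L(a)`. -/
def UnionLengths (G : Type*) [Group G] (k : ℕ) : Set ℕ :=
  {m | ∃ a : Multiset G, IsProductOne a ∧ HasLength a k ∧ HasLength a m}

/-- `ρ_k(G) = sup U_k(G)`. -/
noncomputable def rhoK (G : Type*) [Group G] (k : ℕ) : ℕ :=
  sSup (UnionLengths G k)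

/-- `λ_k(G) = min U_k(G)`. -/
noncomputable def lambdaK (G : Type*) [Group G] (k : ℕ) : ℕ :=
  sInf (UnionLengths G k)


namespace DicyclicRho

open QuaternionGroup

/-- The sequence with rotation exponents `R` and reflection-type exponents `T`. -/
def ct {m : ℕ} (R T : Multiset (ZMod (2 * m))) : Multiset (QuaternionGroup m) :=
  R.map a + T.map xa

/-- The rotation exponent of an element, if it is a rotation. -/
def getA {m : ℕ} : QuaternionGroup m → Option (ZMod (2 * m))
  | a i => some i
  | xa _ => none

/-- The exponent of an element outside the cyclic subgroup. -/
def getX {m : ℕ} : QuaternionGroup m → Option (ZMod (2 * m))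
  | a _ => none
  | xa i => some i

theorem ct_add {m : ℕ} (R T R' T' : Multiset (ZMod (2 * m))) :
    ct (R + R') (T + T') = ct R T + ct R' T' := by
  simp only [ct, Multiset.map_add]; abel

theorem card_ct {m : ℕ} (R T : Multiset (ZMod (2 * m))) :
    Multiset.card (ct R T) = Multiset.card R + Multiset.card T := by
  simp [ct]

theorem filterMap_getA {m : ℕ} (R T : Multiset (ZMod (2 * m))) :
    (ct R T).filterMap getA = R := by
  unfold ct
  induction R using Multiset.induction with
  | empty =>
    induction T using Multiset.induction with
    | empty => simp
    | cons x T ih =>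
      rw [Multiset.map_zero, zero_add] at ih ⊢
      rw [Multiset.map_cons, Multiset.filterMap_cons_none _ _ rfl, ih]
  | cons x R ih => simpa [getA, Multiset.filterMap_cons] using ih

theorem filterMap_getX {m : ℕ} (R T : Multiset (ZMod (2 * m))) :
    (ct R T).filterMap getX = T := by
  unfold ct
  induction R using Multiset.induction with
  | empty =>
    induction T using Multiset.induction with
    | empty => simp
    | cons x T ih => simpa [getX, Multiset.filterMap_cons] using ih
  | cons x R ih =>
    rw [Multiset.map_cons, Multiset.cons_add, Multiset.filterMap_cons_none _ _ rfl, ih]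

theorem ct_inj {m : ℕ} {R T R' T' : Multiset (ZMod (2 * m))} (h : ct R T = ct R' T') :
    R = R' ∧ T = T' := by
  constructor
  · rw [← filterMap_getA R T, h, filterMap_getA]
  · rw [← filterMap_getX R T, h, filterMap_getX]

theorem exists_ct {m : ℕ} (S : Multiset (QuaternionGroup m)) :
    ∃ R T, S = ct R T := by
  induction S using Multiset.induction with
  | empty => exact ⟨0, 0, rfl⟩
  | cons g S ih =>
    obtain ⟨R, T, rfl⟩ := ih
    cases g with
    | a i => exact ⟨i ::ₘ R, T, by simp [ct]⟩
    | xa i => exact ⟨R, i ::ₘ T, by simp [ct]⟩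

theorem two_m {m : ℕ} : (2 : ZMod (2 * m)) * (m : ZMod (2 * m)) = 0 := by
  have := ZMod.natCast_self (2 * m)
  push_cast at this
  exact this

theorem neg_m {m : ℕ} : -(m : ZMod (2 * m)) = m := by
  have := @two_m m
  linear_combination -this

theorem list_form {m : ℕ} (l : List (QuaternionGroup m)) :
    ∃ R1 R2 X1 X2 : Multiset (ZMod (2 * m)),
      (l : Multiset (QuaternionGroup m)) = ct (R1 + R2) (X1 + X2) ∧
      ((Multiset.card X1 = Multiset.card X2 ∧
        l.prod = a (R1.sum - R2.sum + X1.sum - X2.sum + ((Multiset.card X2 : ℕ) : ZMod (2 * m)) * (m : ZMod (2 * m)))) ∨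
       (Multiset.card X1 = Multiset.card X2 + 1 ∧
        l.prod = xa (R1.sum - R2.sum + X1.sum - X2.sum + ((Multiset.card X2 : ℕ) : ZMod (2 * m)) * (m : ZMod (2 * m))))) := by
  induction l with
  | nil => exact ⟨0, 0, 0, 0, by simp [ct], Or.inl ⟨rfl, by simp⟩⟩
  | cons g l ih =>
    obtain ⟨R1, R2, X1, X2, hl, h⟩ := ih
    rw [← Multiset.cons_coe, hl, List.prod_cons]
    cases g with
    | a r =>
      rcases h with ⟨hc, hp⟩ | ⟨hc, hp⟩
      · refine ⟨r ::ₘ R1, R2, X1, X2, by simp [ct], Or.inl ⟨hc, ?_⟩⟩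
        rw [hp, a_mul_a]; congr 1; simp; ring
      · refine ⟨R1, r ::ₘ R2, X1, X2, by simp [ct], Or.inr ⟨hc, ?_⟩⟩
        rw [hp, a_mul_xa]; congr 1; simp; ring
    | xa r =>
      rcases h with ⟨hc, hp⟩ | ⟨hc, hp⟩
      · refine ⟨R1, R2, r ::ₘ X1, X2, by simp [ct], Or.inr ⟨by simp [hc], ?_⟩⟩
        rw [hp, xa_mul_a]; congr 1; simp; ring
      · refine ⟨R1, R2, X1, r ::ₘ X2, by simp [ct], Or.inl ⟨by simp [hc], ?_⟩⟩
        rw [hp, xa_mul_xa]; congr 1; simp; ring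

theorem po_form {m : ℕ} {R T : Multiset (ZMod (2 * m))} (h : IsProductOne (ct R T)) :
    ∃ R1 R2 X1 X2 : Multiset (ZMod (2 * m)), R = R1 + R2 ∧ T = X1 + X2 ∧
      Multiset.card X1 = Multiset.card X2 ∧
      R1.sum - R2.sum + X1.sum - X2.sum + ((Multiset.card X2 : ℕ) : ZMod (2 * m)) * (m : ZMod (2 * m)) = 0 := by
  obtain ⟨l, hl, hp⟩ := h
  obtain ⟨R1, R2, X1, X2, hl', h⟩ := list_form l
  obtain ⟨h1, h2⟩ := ct_inj (hl.symm.trans hl')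
  refine ⟨R1, R2, X1, X2, h1, h2, ?_⟩
  rcases h with ⟨hc, hp'⟩ | ⟨hc, hp'⟩
  · refine ⟨hc, ?_⟩
    rw [hp, one_def] at hp'
    exact (QuaternionGroup.a.inj hp').symm
  · rw [hp, one_def] at hp'
    cases hp'

theorem prod_map_a {m : ℕ} (l : List (ZMod (2 * m))) :
    (l.map (a : ZMod (2 * m) → QuaternionGroup m)).prod = a l.sum := by
  induction l with
  | nil => simp
  | cons x l ih => simp [ih]

theorem po_rot {m : ℕ} {R : Multiset (ZMod (2 * m))} (h : R.sum = 0) :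
    IsProductOne (ct R 0) := by
  induction R using Quotient.inductionOn with
  | _ l =>
    refine ⟨l.map a, by simp [ct], ?_⟩
    rw [prod_map_a]
    simp at h
    simp [h]

theorem rot_of_po {m : ℕ} {R : Multiset (ZMod (2 * m))} (h : IsProductOne (ct R 0)) :
    R.sum = 0 := by
  obtain ⟨l, hl, hp⟩ := h
  have hmap : ∃ l' : List (ZMod (2 * m)), l = l'.map a := by
    have : ∀ g ∈ l, ∃ i, g = a i := by
      intro g hg
      have : g ∈ ct R 0 := by rw [← hl]; simpa using hg
      simp [ct] at this
      obtain ⟨i, _, rfl⟩ := this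
      exact ⟨i, rfl⟩
    clear hl hp
    induction l with
    | nil => exact ⟨[], rfl⟩
    | cons g l ih =>
      obtain ⟨l', rfl⟩ := ih (fun g hg => this g (by simp [hg]))
      obtain ⟨i, rfl⟩ := this g (by simp)
      exact ⟨i :: l', rfl⟩
  obtain ⟨l', rfl⟩ := hmap
  rw [prod_map_a, one_def] at hp
  have h1 : ct (l' : Multiset (ZMod (2 * m))) 0 = ct R 0 := by rw [← hl]; simp [ct]
  rw [← (ct_inj h1).1]
  simpa using QuaternionGroup.a.inj hp

theorem pairs_word {m : ℕ} (n : ℕ) : ∀ X1 X2 : Multiset (ZMod (2 * m)),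
    Multiset.card X1 = n → Multiset.card X2 = n →
    ∃ l : List (QuaternionGroup m), (l : Multiset (QuaternionGroup m)) = ct 0 (X1 + X2) ∧
      l.prod = a (X1.sum - X2.sum + (n : ZMod (2 * m)) * (m : ZMod (2 * m))) := by
  induction n with
  | zero =>
    intro X1 X2 h1 h2
    rw [Multiset.card_eq_zero] at h1 h2
    subst h1 h2
    exact ⟨[], by simp [ct], by simp⟩
  | succ n ih =>
    intro X1 X2 h1 h2
    obtain ⟨x, hx⟩ := Multiset.exists_mem_of_ne_zero
      (show X1 ≠ 0 by rintro rfl; simp at h1)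
    obtain ⟨X1, rfl⟩ := Multiset.exists_cons_of_mem hx
    obtain ⟨y, hy⟩ := Multiset.exists_mem_of_ne_zero
      (show X2 ≠ 0 by rintro rfl; simp at h2)
    obtain ⟨X2, rfl⟩ := Multiset.exists_cons_of_mem hy
    obtain ⟨l, hl, hp⟩ := ih X1 X2 (by simpa using h1) (by simpa using h2)
    refine ⟨xa y :: xa x :: l, ?_, ?_⟩
    · rw [← Multiset.cons_coe, ← Multiset.cons_coe, hl]
      simp [ct, Multiset.cons_swap]
    · rw [List.prod_cons, List.prod_cons, hp, ← mul_assoc, xa_mul_xa, a_mul_a]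
      congr 1; simp; ring

theorem po_of_form {m : ℕ} {R1 R2 X1 X2 : Multiset (ZMod (2 * m))}
    (hc : Multiset.card X1 = Multiset.card X2) (h0 : X2 ≠ 0)
    (h : R1.sum - R2.sum + X1.sum - X2.sum + ((Multiset.card X2 : ℕ) : ZMod (2 * m)) * (m : ZMod (2 * m)) = 0) :
    IsProductOne (ct (R1 + R2) (X1 + X2)) := by
  obtain ⟨y, hy⟩ := Multiset.exists_mem_of_ne_zero h0
  obtain ⟨X2, rfl⟩ := Multiset.exists_cons_of_mem hy
  have : X1 ≠ 0 := by
    rintro rfl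
    simp at hc
  obtain ⟨x, hx⟩ := Multiset.exists_mem_of_ne_zero this
  obtain ⟨X1, rfl⟩ := Multiset.exists_cons_of_mem hx
  obtain ⟨l, hl, hp⟩ := pairs_word (Multiset.card X2) X1 X2 (by simpa using hc) rfl
  induction R1 using Quotient.inductionOn with
  | _ l1 =>
  induction R2 using Quotient.inductionOn with
  | _ l2 =>
    refine ⟨l1.map a ++ (xa y :: (l2.map a ++ (xa x :: l))), ?_, ?_⟩
    · rw [← Multiset.coe_add, ← Multiset.cons_coe, ← Multiset.coe_add, ← Multiset.cons_coe, hl]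
      simp only [ct, Multiset.quot_mk_to_coe, Multiset.map_add, Multiset.map_coe,
        Multiset.map_cons, Multiset.map_zero, ← Multiset.singleton_add, Multiset.map_singleton]
      abel
    · rw [List.prod_append, List.prod_cons, List.prod_append, List.prod_cons, prod_map_a,
        prod_map_a, hp, one_def]
      simp only [a_mul_xa, xa_mul_xa, a_mul_a, xa_mul_a]
      congr 1
      simp at h
      linear_combination h

end DicyclicRho
namespace DicyclicRho

section Generic

variable {ι Z : Type*} [AddCommGroup Z] [DecidableEq Z]

/-- The set of subsequence sums of `I` with respect to the weight `f`. -/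
def ys (f : ι → Z) (I : Multiset ι) : Finset Z :=
  (I.powerset.map (fun A => (A.map f).sum)).toFinset

theorem mem_ys {f : ι → Z} {I : Multiset ι} {s : Z} :
    s ∈ ys f I ↔ ∃ A ≤ I, (A.map f).sum = s := by
  simp [ys]

theorem zero_mem_ys (f : ι → Z) (I : Multiset ι) : (0 : Z) ∈ ys f I :=
  mem_ys.2 ⟨0, by simp, by simp⟩

theorem ys_mono (f : ι → Z) {V W : Multiset ι} (h : V ≤ W) : ys f V ⊆ ys f W := by
  intro s hs
  obtain ⟨A, hA, rfl⟩ := mem_ys.1 hs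
  exact mem_ys.2 ⟨A, hA.trans h, rfl⟩

theorem mem_ys_cons {f : ι → Z} {I : Multiset ι} {x : ι} {s : Z} :
    s ∈ ys f (x ::ₘ I) ↔ s ∈ ys f I ∨ s - f x ∈ ys f I := by
  classical
  constructor
  · intro h
    obtain ⟨A, hA, rfl⟩ := mem_ys.1 h
    by_cases hx : x ∈ A
    · obtain ⟨B, rfl⟩ := Multiset.exists_cons_of_mem hx
      right
      exact mem_ys.2 ⟨B, (Multiset.cons_le_cons_iff x).1 hA, by simp⟩
    · left
      exact mem_ys.2 ⟨A, (Multiset.le_cons_of_notMem hx).1 hA, rfl⟩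
  · rintro (h | h)
    · exact ys_mono f (Multiset.le_cons_self I x) h
    · obtain ⟨A, hA, h⟩ := mem_ys.1 h
      exact mem_ys.2 ⟨x ::ₘ A, (Multiset.cons_le_cons_iff x).2 hA, by simp [h]⟩

theorem mem_ys_add {f : ι → Z} {I J : Multiset ι} {s t : Z} (hs : s ∈ ys f I) (ht : t ∈ ys f J) :
    s + t ∈ ys f (I + J) := by
  obtain ⟨A, hA, rfl⟩ := mem_ys.1 hs
  obtain ⟨B, hB, rfl⟩ := mem_ys.1 ht
  exact mem_ys.2 ⟨A + B, add_le_add hA hB, by simp⟩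

theorem ys_cons_congr {f : ι → Z} {I J : Multiset ι} (h : ys f I = ys f J) (x : ι) :
    ys f (x ::ₘ I) = ys f (x ::ₘ J) := by
  ext s
  rw [mem_ys_cons, mem_ys_cons, h]

theorem ys_add_congr {f : ι → Z} {I J : Multiset ι} (h : ys f I = ys f J) (K : Multiset ι) :
    ys f (I + K) = ys f (J + K) := by
  induction K using Multiset.induction with
  | empty => simpa using h
  | cons x K ih =>
    rw [Multiset.add_cons, Multiset.add_cons]
    exact ys_cons_congr ih x

theorem greedy (f : ι → Z) (V0 D : Multiset ι) :
    ∃ V, V0 ≤ V ∧ V ≤ V0 + D ∧ ys f V = ys f (V0 + D) ∧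
      Multiset.card V + (ys f V0).card ≤ (ys f V).card + Multiset.card V0 := by
  induction D using Multiset.induction with
  | empty => exact ⟨V0, le_rfl, by simp, by simp, by omega⟩
  | cons x D ih =>
    obtain ⟨V, h1, h2, h3, h4⟩ := ih
    rw [Multiset.add_cons]
    have h5 := ys_cons_congr h3 x
    by_cases h : ys f (x ::ₘ V) = ys f V
    · exact ⟨V, h1, h2.trans (Multiset.le_cons_self _ _), by rw [← h5, h], h4⟩
    · refine ⟨x ::ₘ V, h1.trans (Multiset.le_cons_self _ _), (Multiset.cons_le_cons_iff x).2 h2,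
        h5, ?_⟩
      have : (ys f V).card < (ys f (x ::ₘ V)).card :=
        Finset.card_lt_card ((ys_mono f (Multiset.le_cons_self _ _)).ssubset_of_ne (Ne.symm h))
      simp only [Multiset.card_cons]
      omega

theorem shift_sub {Y : Finset Z} {d : Z} (h : ∀ s ∈ Y, s + d ∈ Y) : ∀ s ∈ Y, s - d ∈ Y := by
  have h1 : Y.image (fun s => s + d) ⊆ Y := by
    intro s hs
    obtain ⟨t, ht, rfl⟩ := Finset.mem_image.1 hs
    exact h t ht
  have h2 : Y.image (fun s => s + d) = Y :=
    Finset.eq_of_subset_of_card_le h1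
      (by rw [Finset.card_image_of_injective _ (add_left_injective d)])
  intro s hs
  rw [← h2] at hs
  obtain ⟨t, ht, rfl⟩ := Finset.mem_image.1 hs
  simpa using ht

theorem stab_add {f : ι → Z} {V A : Multiset ι} (h : ys f V = ys f (V + A)) :
    ∀ s ∈ ys f V, s + (A.map f).sum ∈ ys f V := by
  intro s hs
  rw [h]
  exact mem_ys_add hs (mem_ys.2 ⟨A, le_rfl, rfl⟩)

theorem stab_sub {f : ι → Z} {V A : Multiset ι} (h : ys f V = ys f (V + A)) :
    ∀ s ∈ ys f V, s - (A.map f).sum ∈ ys f V :=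
  shift_sub (stab_add h)

theorem ys_between {f : ι → Z} {V U W : Multiset ι} (h : ys f V = ys f W) (h1 : V ≤ U)
    (h2 : U ≤ W) : ys f V = ys f U := by
  apply (ys_mono f h1).antisymm
  rw [h]
  exact ys_mono f h2

end Generic

section Items

variable {m : ℕ}

/-- Items: rotations, and pairs of elements outside the cyclic subgroup. -/
abbrev Item (m : ℕ) := ZMod (2 * m) ⊕ (ZMod (2 * m) × ZMod (2 * m))

/-- The value of an item. -/
def val : Item m → ZMod (2 * m)
  | Sum.inl r => r
  | Sum.inr p => p.1 - p.2 + (m : ZMod (2 * m))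

/-- The sequence underlying a multiset of items. -/
def cont (I : Multiset (Item m)) : Multiset (QuaternionGroup m) :=
  I.bind fun i => Sum.elim (fun r => {QuaternionGroup.a r})
    (fun p => {QuaternionGroup.xa p.1, QuaternionGroup.xa p.2}) i

/-- Items from rotations and pairs. -/
def it (R : Multiset (ZMod (2 * m))) (P : Multiset (ZMod (2 * m) × ZMod (2 * m))) :
    Multiset (Item m) := R.map Sum.inl + P.map Sum.inr

theorem it_add (R R' : Multiset (ZMod (2 * m))) (P P' : Multiset (ZMod (2 * m) × ZMod (2 * m))) :
    it (R + R') (P + P') = it R P + it R' P' := by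
  simp only [it, Multiset.map_add]; abel

theorem card_it (R : Multiset (ZMod (2 * m))) (P : Multiset (ZMod (2 * m) × ZMod (2 * m))) :
    Multiset.card (it R P) = Multiset.card R + Multiset.card P := by simp [it]

theorem exists_it (I : Multiset (Item m)) : ∃ R P, I = it R P := by
  induction I using Multiset.induction with
  | empty => exact ⟨0, 0, rfl⟩
  | cons x I ih =>
    obtain ⟨R, P, rfl⟩ := ih
    cases x with
    | inl r => exact ⟨r ::ₘ R, P, by simp [it]⟩
    | inr p => exact ⟨R, p ::ₘ P, by simp [it]⟩

theorem cont_add (I J : Multiset (Item m)) : cont (I + J) = cont I + cont J := by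
  simp [cont]

theorem cont_it (R : Multiset (ZMod (2 * m))) (P : Multiset (ZMod (2 * m) × ZMod (2 * m))) :
    cont (it R P) = ct R (P.map Prod.fst + P.map Prod.snd) := by
  unfold it
  rw [cont_add]
  have h1 : cont (R.map Sum.inl : Multiset (Item m)) = R.map QuaternionGroup.a := by
    simp [cont, Multiset.bind_map, Multiset.bind_singleton]
  have h2 : cont (P.map Sum.inr : Multiset (Item m)) =
      (P.map Prod.fst + P.map Prod.snd).map QuaternionGroup.xa := by
    induction P using Multiset.induction with
    | empty => simp [cont]
    | cons p P ih =>
      rw [Multiset.map_cons, ← Multiset.singleton_add, cont_add, ih]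
      simp [cont]
      exact Multiset.cons_swap _ _ _
  rw [h1, h2, ct]

theorem cont_ne_zero {I : Multiset (Item m)} (h : I ≠ 0) : cont I ≠ 0 := by
  obtain ⟨R, P, rfl⟩ := exists_it I
  rw [cont_it]
  intro h0
  apply h
  have := congrArg Multiset.card h0
  rw [card_ct] at this
  simp at this
  rw [this.1, this.2]
  rfl

/-- The sum of the values of items. -/
def sv (I : Multiset (Item m)) : ZMod (2 * m) := (I.map val).sum

theorem sv_add (I J : Multiset (Item m)) : sv (I + J) = sv I + sv J := by simp [sv]

theorem sv_it (R : Multiset (ZMod (2 * m))) (P : Multiset (ZMod (2 * m) × ZMod (2 * m))) :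
    sv (it R P) = R.sum + (P.map Prod.fst).sum - (P.map Prod.snd).sum +
      ((Multiset.card P : ℕ) : ZMod (2 * m)) * (m : ZMod (2 * m)) := by
  unfold it
  rw [sv_add]
  have h1 : sv (R.map Sum.inl : Multiset (Item m)) = R.sum := by
    simp [sv, Function.comp_def, val]
  have h2 : sv (P.map Sum.inr : Multiset (Item m)) = (P.map Prod.fst).sum - (P.map Prod.snd).sum +
      ((Multiset.card P : ℕ) : ZMod (2 * m)) * (m : ZMod (2 * m)) := by
    induction P using Multiset.induction with
    | empty => simp [sv]
    | cons p P ih =>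
      rw [Multiset.map_cons, ← Multiset.singleton_add, sv_add, ih]
      simp [sv, val]
      ring
  rw [h1, h2]; ring

/-- The multiset of items contains a pair. -/
def HasPair (I : Multiset (Item m)) : Prop := ∃ p, Sum.inr p ∈ I

theorem hasPair_it {R : Multiset (ZMod (2 * m))} {P : Multiset (ZMod (2 * m) × ZMod (2 * m))} :
    HasPair (it R P) ↔ P ≠ 0 := by
  constructor
  · rintro ⟨p, hp⟩ rfl
    simp [it] at hp
  · intro h
    obtain ⟨p, hp⟩ := Multiset.exists_mem_of_ne_zero h
    exact ⟨p, by simpa [it] using hp⟩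

theorem HasPair.mono {I J : Multiset (Item m)} (h : HasPair I) (hIJ : I ≤ J) : HasPair J :=
  h.imp fun _ hp => Multiset.mem_of_le hIJ hp

theorem cont_po {I1 I2 : Multiset (Item m)} (hp : HasPair (I1 + I2)) (h : sv I1 = sv I2) :
    IsProductOne (cont (I1 + I2)) := by
  obtain ⟨R1, P1, rfl⟩ := exists_it I1
  obtain ⟨R2, P2, rfl⟩ := exists_it I2
  rw [← it_add] at hp ⊢
  rw [hasPair_it] at hp
  rw [cont_it]
  have e : (P1 + P2).map Prod.fst + (P1 + P2).map Prod.snd =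
      (P1.map Prod.fst + P2.map Prod.snd) + (P1.map Prod.snd + P2.map Prod.fst) := by
    simp only [Multiset.map_add]; abel
  rw [e]
  apply po_of_form
  · simp
  · intro h0
    apply hp
    have := congrArg Multiset.card h0
    simp at this
    simp [this]
  · rw [sv_it, sv_it] at h
    simp
    linear_combination h + ((Multiset.card P2 : ℕ) : ZMod (2 * m)) * (@two_m m)

theorem cont_po0 {I : Multiset (Item m)} (hp : ¬ HasPair I) (h : sv I = 0) :
    IsProductOne (cont I) := by
  obtain ⟨R, P, rfl⟩ := exists_it I
  rw [hasPair_it, not_not] at hp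
  subst hp
  rw [cont_it]
  rw [sv_it] at h
  simpa using po_rot (by simpa using h)

/-- doubled value -/
def dval (i : Item m) : ZMod (2 * m) := 2 * val i

theorem sum_dval (I : Multiset (Item m)) : (I.map dval).sum = 2 * sv I := by
  simp only [sv]
  rw [← Multiset.sum_map_mul_left]
  rfl

theorem cont_po_of_mem {W : Multiset (Item m)} (hp : HasPair W) (h : sv W ∈ ys dval W) :
    IsProductOne (cont W) := by
  obtain ⟨A, hA, h⟩ := mem_ys.1 h
  rw [sum_dval] at h
  obtain ⟨B, rfl⟩ := Multiset.le_iff_exists_add.1 hA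
  apply cont_po hp
  rw [sv_add] at h
  linear_combination h

theorem zip_exists {α β : Type*} (n : ℕ) : ∀ (X1 : Multiset α) (X2 : Multiset β),
    Multiset.card X1 = n → Multiset.card X2 = n →
    ∃ P : Multiset (α × β), P.map Prod.fst = X1 ∧ P.map Prod.snd = X2 := by
  induction n with
  | zero =>
    intro X1 X2 h1 h2
    rw [Multiset.card_eq_zero] at h1 h2
    subst h1 h2
    exact ⟨0, by simp⟩
  | succ n ih =>
    intro X1 X2 h1 h2
    obtain ⟨x, hx⟩ := Multiset.exists_mem_of_ne_zero
      (show X1 ≠ 0 by rintro rfl; simp at h1)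
    obtain ⟨X1, rfl⟩ := Multiset.exists_cons_of_mem hx
    obtain ⟨y, hy⟩ := Multiset.exists_mem_of_ne_zero
      (show X2 ≠ 0 by rintro rfl; simp at h2)
    obtain ⟨X2, rfl⟩ := Multiset.exists_cons_of_mem hy
    obtain ⟨P, h3, h4⟩ := ih X1 X2 (by simpa using h1) (by simpa using h2)
    exact ⟨(x, y) ::ₘ P, by simp [h3], by simp [h4]⟩

theorem pairs_of_po {R T : Multiset (ZMod (2 * m))} (h : IsProductOne (ct R T)) (hT : T ≠ 0) :
    ∃ P, P ≠ 0 ∧ P.map Prod.fst + P.map Prod.snd = T ∧ cont (it R P) = ct R T ∧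
      sv (it R P) ∈ ys dval (it R P) := by
  obtain ⟨R1, R2, X1, X2, rfl, rfl, hc, h⟩ := po_form h
  obtain ⟨P, h1, h2⟩ := zip_exists _ X1 X2 hc rfl
  have hP : P ≠ 0 := by
    rintro rfl
    simp at h1 h2
    rw [← h1, ← h2] at hT
    simp at hT
  refine ⟨P, hP, by rw [h1, h2], by rw [cont_it, h1, h2], ?_⟩
  refine mem_ys.2 ⟨it R2 0, ?_, ?_⟩
  · rw [Multiset.le_iff_exists_add]
    exact ⟨it R1 P, by rw [← it_add, zero_add, add_comm]⟩
  · rw [sum_dval, sv_it, sv_it, h1, h2]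
    have : Multiset.card P = Multiset.card X2 := by rw [← h2]; simp
    rw [this]
    simp
    linear_combination -h

/-- No nontrivial relation among the items. -/
def NoRel (J : Multiset (Item m)) : Prop :=
  ∀ A B, A + B ≤ J → A + B ≠ 0 → sv A = sv B → (HasPair (A + B) ∨ B = 0) → False

theorem NoRel.mono {I J : Multiset (Item m)} (h : NoRel J) (hIJ : I ≤ J) : NoRel I :=
  fun A B h1 h2 h3 h4 => h A B (h1.trans hIJ) h2 h3 h4

theorem lemmaK {V J : Multiset (Item m)} (hS : IsMinimalProductOne (cont (V + J)))
    (hW : sv (V + J) ∈ ys dval (V + J)) (hX : ys dval V = ys dval (V + J)) (hV : HasPair V) :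
    NoRel J := by
  intro A B h1 h2 h3 h4
  obtain ⟨C, rfl⟩ := Multiset.le_iff_exists_add.1 h1
  have hQ : IsProductOne (cont (A + B)) := by
    by_cases hp : HasPair (A + B)
    · exact cont_po hp h3
    · rcases h4 with h4 | rfl
      · exact absurd h4 hp
      · rw [add_zero] at hp ⊢
        exact cont_po0 hp (by rw [h3]; simp [sv])
  have hR : IsProductOne (cont (V + C)) := by
    apply cont_po_of_mem (hV.mono (by simp))
    apply ys_mono dval (show V ≤ V + C by simp)
    have h5 : ys dval V = ys dval (V + A) := by
      apply ys_between hX (by simp)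
      rw [add_assoc A B C, ← add_assoc V]
      exact le_self_add
    have h6 := stab_sub h5 (sv (V + (A + B + C))) (by rw [hX]; exact hW)
    convert h6 using 1
    rw [sum_dval]
    simp only [sv_add]
    rw [← h3]
    ring
  refine hS.2.2 _ _ (cont_ne_zero h2) (cont_ne_zero (I := V + C) ?_) hQ hR ?_
  · obtain ⟨p, hp⟩ := hV
    intro h0
    simp at h0
    rw [h0.1] at hp
    simp at hp
  · rw [← cont_add]; congr 1; abel

theorem count_pair {I : Multiset (Item m)} {p : ZMod (2 * m) × ZMod (2 * m)}
    (h : NoRel (Sum.inr p ::ₘ I)) :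
    2 * (ys val I).card ≤ (ys val (Sum.inr p ::ₘ I)).card := by
  classical
  have hd : Disjoint (ys val I) ((ys val I).image (fun s => s + val (Sum.inr p : Item m))) := by
    rw [Finset.disjoint_left]
    intro s hs hs'
    obtain ⟨t, ht, hst⟩ := Finset.mem_image.1 hs'
    obtain ⟨A, hA, hA'⟩ := mem_ys.1 hs
    obtain ⟨B, hB, hB'⟩ := mem_ys.1 ht
    have hA2 : A - A ∩ B + A ∩ B = A := tsub_add_cancel_of_le (Multiset.inter_le_left)
    have hB2 : B - A ∩ B + A ∩ B = B := tsub_add_cancel_of_le (Multiset.inter_le_right)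
    have e1 : sv (A - A ∩ B) + sv (A ∩ B) = s := by rw [← sv_add, hA2]; exact hA'
    have e2 : sv (B - A ∩ B) + sv (A ∩ B) = t := by rw [← sv_add, hB2]; exact hB'
    refine h (A - A ∩ B) (Sum.inr p ::ₘ (B - A ∩ B)) ?_ ?_ ?_ ?_
    · rw [Multiset.add_cons, Multiset.cons_le_cons_iff, Multiset.le_iff_count]
      intro x
      have h1 := Multiset.le_iff_count.1 hA x
      have h2 := Multiset.le_iff_count.1 hB x
      simp only [Multiset.count_add, Multiset.count_sub, Multiset.count_inter]
      omega
    · simp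
    · rw [← Multiset.singleton_add, sv_add]
      have : sv ({Sum.inr p} : Multiset (Item m)) = val (Sum.inr p : Item m) := by simp [sv]
      rw [this]
      linear_combination e1 - e2 - hst
    · left
      exact ⟨p, by simp⟩
  have hsub : (ys val I) ∪ ((ys val I).image (fun s => s + val (Sum.inr p : Item m))) ⊆
      ys val (Sum.inr p ::ₘ I) := by
    intro s hs
    rcases Finset.mem_union.1 hs with hs | hs
    · exact mem_ys_cons.2 (Or.inl hs)
    · obtain ⟨t, ht, rfl⟩ := Finset.mem_image.1 hs
      exact mem_ys_cons.2 (Or.inr (by simpa using ht))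
  have := Finset.card_le_card hsub
  rw [Finset.card_union_of_disjoint hd, Finset.card_image_of_injective _ (add_left_injective _)]
    at this
  omega

theorem count_rot {I : Multiset (Item m)} {r : Item m} (h : NoRel (r ::ₘ I)) :
    (ys val I).card + 1 ≤ (ys val (r ::ₘ I)).card := by
  apply Finset.card_lt_card
  apply (ys_mono val (Multiset.le_cons_self _ _)).ssubset_of_ne
  intro he
  have h1 : ∀ s ∈ ys val I, s + val r ∈ ys val I := by
    intro s hs
    rw [he]
    exact mem_ys_cons.2 (Or.inr (by simpa using hs))
  have h2 := shift_sub h1 0 (zero_mem_ys _ _)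
  obtain ⟨A, hA, hA'⟩ := mem_ys.1 h2
  refine h (r ::ₘ A) 0 ?_ (by simp) ?_ (Or.inr rfl)
  · simpa using hA
  · rw [← Multiset.singleton_add, sv_add]
    change sv _ + (A.map val).sum = _
    rw [hA']; simp [sv]

theorem count_it {R : Multiset (ZMod (2 * m))} {P : Multiset (ZMod (2 * m) × ZMod (2 * m))}
    (h : NoRel (it R P)) :
    (Multiset.card R + 1) * 2 ^ Multiset.card P ≤ (ys val (it R P)).card := by
  induction P using Multiset.induction with
  | empty =>
    induction R using Multiset.induction with
    | empty =>
      simp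
      exact ⟨0, zero_mem_ys _ _⟩
    | cons r R ih =>
      have e : it (r ::ₘ R) 0 = Sum.inl r ::ₘ it R 0 := by simp [it]
      rw [e] at h ⊢
      have h1 := count_rot h
      have h2 := ih (h.mono (Multiset.le_cons_self _ _))
      simp at h2 ⊢
      omega
  | cons p P ih =>
    have e : it R (p ::ₘ P) = Sum.inr p ::ₘ it R P := by simp [it]
    rw [e] at h ⊢
    have h1 := count_pair h
    have h2 := ih (h.mono (Multiset.le_cons_self _ _))
    rw [Multiset.card_cons, pow_succ]
    nlinarith

/-- The even residues. -/
def evens (m : ℕ) [NeZero m] : Finset (ZMod (2 * m)) :=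
  Finset.univ.image (fun z => 2 * z)

theorem card_evens [NeZero m] : (evens m).card ≤ m := by
  have hsub : evens m ⊆ (Finset.range m).image (fun i : ℕ => 2 * (i : ZMod (2 * m))) := by
    intro s hs
    obtain ⟨z, -, rfl⟩ := Finset.mem_image.1 hs
    refine Finset.mem_image.2 ⟨z.val % m, ?_, ?_⟩
    · simp [Nat.mod_lt _ (Nat.pos_of_ne_zero (NeZero.ne m))]
    · have h1 : (((z.val % m + m * (z.val / m) : ℕ)) : ZMod (2 * m)) = z := by
        rw [Nat.mod_add_div, ZMod.natCast_zmod_val]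
      push_cast at h1
      linear_combination 2 * h1 - ((z.val / m : ℕ) : ZMod (2 * m)) * (@two_m m)
  calc _ ≤ _ := Finset.card_le_card hsub
    _ ≤ _ := Finset.card_image_le
    _ = m := by simp

theorem ys_dval_sub [NeZero m] (I : Multiset (Item m)) : ys dval I ⊆ evens m := by
  intro s hs
  obtain ⟨A, -, rfl⟩ := mem_ys.1 hs
  rw [sum_dval]
  exact Finset.mem_image.2 ⟨_, Finset.mem_univ _, rfl⟩

theorem card_ys_le [NeZero m] (I : Multiset (Item m)) : (ys val I).card ≤ 2 * m := by
  calc _ ≤ _ := Finset.card_le_univ _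
    _ = 2 * m := ZMod.card _

end Items

end DicyclicRho
namespace DicyclicRho

section Bound

variable {m : ℕ}

theorem it_le_it {R R' : Multiset (ZMod (2 * m))} {P P' : Multiset (ZMod (2 * m) × ZMod (2 * m))}
    (h : it R' P' ≤ it R P) : R' ≤ R ∧ P' ≤ P := by
  classical
  have c1 : ∀ (R : Multiset (ZMod (2 * m))) (P : Multiset (ZMod (2 * m) × ZMod (2 * m))) r,
      Multiset.count (Sum.inl r : Item m) (it R P) = Multiset.count r R := by
    intro R P r
    rw [it, Multiset.count_add, Multiset.count_map_eq_count' _ _ Sum.inl_injective,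
      Multiset.count_eq_zero_of_notMem (s := P.map Sum.inr) (by simp), add_zero]
  have c2 : ∀ (R : Multiset (ZMod (2 * m))) (P : Multiset (ZMod (2 * m) × ZMod (2 * m))) p,
      Multiset.count (Sum.inr p : Item m) (it R P) = Multiset.count p P := by
    intro R P r
    rw [it, Multiset.count_add, Multiset.count_map_eq_count' _ _ Sum.inr_injective,
      Multiset.count_eq_zero_of_notMem (s := R.map Sum.inl) (by simp), zero_add]
  rw [Multiset.le_iff_count] at h
  constructor
  · rw [Multiset.le_iff_count]
    intro r
    have := h (Sum.inl r)
    rwa [c1, c1] at this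
  · rw [Multiset.le_iff_count]
    intro r
    have := h (Sum.inr r)
    rwa [c2, c2] at this

theorem it_mono {R R' : Multiset (ZMod (2 * m))} {P P' : Multiset (ZMod (2 * m) × ZMod (2 * m))}
    (h : R' ≤ R) (h' : P' ≤ P) : it R' P' ≤ it R P := by
  obtain ⟨C, rfl⟩ := Multiset.le_iff_exists_add.1 h
  obtain ⟨D, rfl⟩ := Multiset.le_iff_exists_add.1 h'
  rw [it_add]; exact le_self_add

theorem ys_zero {ι Z : Type*} [AddCommGroup Z] [DecidableEq Z] (f : ι → Z) :
    (ys f 0).card = 1 := by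
  simp [ys]

theorem exists_diff [NeZero m] {Y : Finset (ZMod (2 * m))} (h : m < Y.card) (z : ZMod (2 * m)) :
    ∃ y1 ∈ Y, ∃ y2 ∈ Y, y1 - y2 = z := by
  by_contra hc
  push Not at hc
  have hd : Disjoint Y (Y.image (fun s => s + z)) := by
    rw [Finset.disjoint_left]
    intro s hs hs'
    obtain ⟨t, ht, rfl⟩ := Finset.mem_image.1 hs'
    exact hc _ hs t ht (by ring)
  have h1 := Finset.card_union_of_disjoint hd
  rw [Finset.card_image_of_injective _ (add_left_injective _)] at h1
  have h2 := Finset.card_le_univ (Y ∪ Y.image (fun s => s + z))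
  rw [ZMod.card] at h2
  omega

theorem eight_lemma : ∀ e1 e2 e3 : ZMod 8,
    ({0, e1, e2, e3, e1 + e2, e1 + e3, e2 + e3, e1 + e2 + e3} : Finset (ZMod 8)).card = 8 →
    (({0, 2 * e1, 2 * e2, 2 * e1 + 2 * e2} : Finset (ZMod 8)) = {0, 2, 4, 6} ∨
     ({0, 2 * e1, 2 * e3, 2 * e1 + 2 * e3} : Finset (ZMod 8)) = {0, 2, 4, 6} ∨
     ({0, 2 * e2, 2 * e3, 2 * e2 + 2 * e3} : Finset (ZMod 8)) = {0, 2, 4, 6}) := by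
  decide +kernel

theorem evens4 : evens 4 = {0, 2, 4, 6} := by
  decide +kernel

theorem pow_ge (j : ℕ) (h : 4 ≤ j) : 4 * j ≤ 2 ^ j := by
  induction j, h using Nat.le_induction with
  | base => norm_num
  | succ j hj ih => rw [pow_succ]; omega

theorem arithA {m q j : ℕ} (hm : 3 ≤ m) (hq : 1 ≤ q) (h : q * 2 ^ j ≤ 2 * m) :
    q + 2 * j ≤ 2 * m ∧ (q + 2 * j = 2 * m → j = 0) := by
  rcases lt_or_ge j 4 with h4 | h4
  · interval_cases j <;> norm_num at h ⊢ <;> omega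
  · have h1 := pow_ge j h4
    have h2 : q * (4 * j) ≤ 2 * m := (Nat.mul_le_mul_left q h1).trans h
    have h3 : q + 2 * j ≤ m + 1 := by nlinarith
    constructor <;> intros <;> omega

theorem arithB {m q j : ℕ} (hm : 3 ≤ m) (hq : 1 ≤ q) (hqm : q ≤ m) (h : q * 2 ^ j ≤ 2 * m) :
    q + 2 * j ≤ m + 2 ∨ (m = 4 ∧ j = 3 ∧ q = 1) := by
  rcases lt_or_ge j 4 with h4 | h4
  · interval_cases j <;> norm_num at h ⊢ <;> omega
  · have h1 := pow_ge j h4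
    have h2 : q * (4 * j) ≤ 2 * m := (Nat.mul_le_mul_left q h1).trans h
    have h3 : q + 2 * j ≤ m + 1 := by nlinarith
    left; omega

theorem exc_aux {P' : Multiset (ZMod (2 * 4) × ZMod (2 * 4))} {p q : ZMod (2 * 4) × ZMod (2 * 4)}
    (hP' : Multiset.card P' = 4)
    (hS : IsMinimalProductOne (cont (it 0 (p ::ₘ q ::ₘ P') : Multiset (Item 4))))
    (hW : sv (it 0 (p ::ₘ q ::ₘ P') : Multiset (Item 4)) ∈ ys dval (it 0 (p ::ₘ q ::ₘ P')))
    (h : ({0, 2 * val (Sum.inr p : Item 4), 2 * val (Sum.inr q : Item 4),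
      2 * val (Sum.inr p : Item 4) + 2 * val (Sum.inr q : Item 4)} : Finset (ZMod (2 * 4))) =
      evens 4) : False := by
  have e : (it 0 (p ::ₘ q ::ₘ P') : Multiset (Item 4)) = it 0 {p, q} + it 0 P' := by
    rw [← it_add]; simp
  rw [e] at hS hW
  have hev : evens 4 ⊆ ys dval (it 0 {p, q} : Multiset (Item 4)) := by
    have e2 : (it 0 {p, q} : Multiset (Item 4)) = Sum.inr p ::ₘ Sum.inr q ::ₘ 0 := by
      simp [it]
    rw [← h, e2]
    intro s hs
    simp only [Finset.mem_insert, Finset.mem_singleton] at hs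
    rw [mem_ys_cons, mem_ys_cons, mem_ys_cons]
    have h0 := zero_mem_ys (dval : Item 4 → _) 0
    rcases hs with rfl | rfl | rfl | rfl
    · left; left; exact h0
    · right; left; simpa [dval] using h0
    · left; right; simpa [dval] using h0
    · right; right; simpa [dval] using h0
  have hX : ys dval (it 0 {p, q} : Multiset (Item 4)) = ys dval (it 0 {p, q} + it 0 P') :=
    (ys_mono _ le_self_add).antisymm ((ys_dval_sub _).trans hev)
  have hK := count_it (lemmaK hS hW hX (hasPair_it.2 (by simp)))
  have := card_ys_le (it 0 P' : Multiset (Item 4))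
  rw [hP'] at hK
  simp at hK
  omega

theorem exc {P : Multiset (ZMod (2 * 4) × ZMod (2 * 4))} {J VP : Multiset _}
    (hP : P = VP + J) (hJ : Multiset.card J = 3) (hVP : Multiset.card VP = 3)
    (hS : IsMinimalProductOne (cont (it 0 P : Multiset (Item 4))))
    (hW : sv (it 0 P : Multiset (Item 4)) ∈ ys dval (it 0 P))
    (hN : NoRel (it 0 J : Multiset (Item 4))) : False := by
  obtain ⟨p1, p2, p3, rfl⟩ := Multiset.card_eq_three.1 hJ
  have h1 : 8 ≤ (ys val (it 0 {p1, p2, p3} : Multiset (Item 4))).card := by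
    have := count_it hN
    rw [hJ] at this
    exact le_trans (by norm_num) this
  have e2 : (it 0 {p1, p2, p3} : Multiset (Item 4)) =
      Sum.inr p1 ::ₘ Sum.inr p2 ::ₘ Sum.inr p3 ::ₘ 0 := by simp [it]
  have hz : ∀ s, s ∈ ys (val : Item 4 → _) 0 → s = 0 := by
    intro s hs
    obtain ⟨A, hA, rfl⟩ := mem_ys.1 hs
    simp at hA
    simp [hA]
  set e1 := val (Sum.inr p1 : Item 4)
  set e2' := val (Sum.inr p2 : Item 4)
  set e3 := val (Sum.inr p3 : Item 4)
  have hsub : ys val (it 0 {p1, p2, p3} : Multiset (Item 4)) ⊆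
      {0, e1, e2', e3, e1 + e2', e1 + e3, e2' + e3, e1 + e2' + e3} := by
    intro s hs
    rw [e2, mem_ys_cons, mem_ys_cons, mem_ys_cons, mem_ys_cons, mem_ys_cons, mem_ys_cons,
      mem_ys_cons] at hs
    simp only [Finset.mem_insert, Finset.mem_singleton]
    rcases hs with ((h | h) | (h | h)) | ((h | h) | (h | h)) <;> replace h := hz _ h
    · simp [h]
    · have : s = e3 := by linear_combination h
      simp [this]
    · have : s = e2' := by linear_combination h
      simp [this]
    · have : s = e2' + e3 := by linear_combination h
      simp [this]
    · have : s = e1 := by linear_combination h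
      simp [this]
    · have : s = e1 + e3 := by linear_combination h
      simp [this]
    · have : s = e1 + e2' := by linear_combination h
      simp [this]
    · have : s = e1 + e2' + e3 := by linear_combination h
      simp [this]
  have hc := Finset.card_le_card hsub
  have hc2 := Finset.card_le_univ
    ({0, e1, e2', e3, e1 + e2', e1 + e3, e2' + e3, e1 + e2' + e3} : Finset (ZMod (2 * 4)))
  rw [ZMod.card] at hc2
  have h8 := eight_lemma e1 e2' e3 (by
    change ({0, e1, e2', e3, e1 + e2', e1 + e3, e2' + e3, e1 + e2' + e3} :
      Finset (ZMod (2 * 4))).card = 8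
    omega)
  have P1 : P = p1 ::ₘ p2 ::ₘ (p3 ::ₘ VP) := by
    rw [hP]; simp [← Multiset.singleton_add]; abel
  have P2 : P = p1 ::ₘ p3 ::ₘ (p2 ::ₘ VP) := by
    rw [hP]; simp [← Multiset.singleton_add]; abel
  have P3 : P = p2 ::ₘ p3 ::ₘ (p1 ::ₘ VP) := by
    rw [hP]; simp [← Multiset.singleton_add]; abel
  rcases h8 with h | h | h
  · rw [P1] at hS hW
    exact exc_aux (by simp [hVP]) hS hW (h.trans evens4.symm)
  · rw [P2] at hS hW
    exact exc_aux (by simp [hVP]) hS hW (h.trans evens4.symm)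
  · rw [P3] at hS hW
    exact exc_aux (by simp [hVP]) hS hW (h.trans evens4.symm)

/-- Zero-sum-free rotations. -/
theorem rot_atom_card [NeZero m] {R : Multiset (ZMod (2 * m))}
    (h : IsMinimalProductOne (ct R 0)) : Multiset.card R ≤ 2 * m := by
  have hR : R ≠ 0 := by
    rintro rfl
    exact h.1 (by simp [ct])
  have hs := rot_of_po h.2.1
  obtain ⟨r, hr⟩ := Multiset.exists_mem_of_ne_zero hR
  obtain ⟨R', rfl⟩ := Multiset.exists_cons_of_mem hr
  have hN : NoRel (it R' 0) := by
    intro A B h1 h2 h3 h4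
    obtain ⟨RA, PA, rfl⟩ := exists_it A
    obtain ⟨RB, PB, rfl⟩ := exists_it B
    rw [← it_add] at h1 h2 h4
    obtain ⟨h5, h6⟩ := it_le_it h1
    have h7 : PA + PB = 0 := by simpa using h6
    rw [hasPair_it] at h4
    have h4 := h4.resolve_left (by simp [h7])
    have h7' := add_eq_zero.1 h7
    have h8 : RB = 0 := by
      have := congrArg Multiset.card h4
      rw [card_it] at this
      simp at this
      exact this.1
    obtain ⟨rfl, rfl⟩ := h7'
    subst h8
    rw [add_zero] at h5 h2
    have h9 : RA.sum = 0 := by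
      rw [sv_it, sv_it] at h3
      simpa using h3
    obtain ⟨C, rfl⟩ := Multiset.le_iff_exists_add.1 h5
    have h10 : (r ::ₘ C).sum = 0 := by
      simp [h9] at hs
      simpa using hs
    refine h.2.2 (ct RA 0) (ct (r ::ₘ C) 0) ?_ ?_ (po_rot h9) (po_rot h10) ?_
    · intro h0
      apply h2
      have := congrArg Multiset.card h0
      rw [card_ct] at this
      simp at this
      simp [this, it]
    · intro h0
      have := congrArg Multiset.card h0
      rw [card_ct] at this
      simp at this
    · rw [← ct_add]; simp
  have h1 := count_it hN
  have h2 := card_ys_le (it R' 0)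
  simp at h1 ⊢
  omega

theorem F1 (hm : 3 ≤ m) {R T : Multiset (ZMod (2 * m))} (hS : IsMinimalProductOne (ct R T)) :
    Multiset.card R + Multiset.card T ≤ 3 * m ∧
    (Multiset.card R + Multiset.card T = 3 * m → ∃ VR RD p,
      R = VR + RD ∧ T = {p.1, p.2} ∧ cont (it R {p}) = ct R T ∧
      sv (it R {p}) ∈ ys dval (it R {p}) ∧
      Multiset.card VR + 1 = m ∧ Multiset.card RD + 1 = 2 * m ∧ NoRel (it RD 0)) := by
  have : NeZero m := ⟨by omega⟩
  classical
  by_cases hT : T = 0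
  · subst hT
    have := rot_atom_card hS
    simp only [Multiset.card_zero, add_zero]
    constructor
    · omega
    · intro h; omega
  obtain ⟨P, hP, hPT, hcont, hW⟩ := pairs_of_po hS.2.1 hT
  have hcT : Multiset.card T = 2 * Multiset.card P := by
    rw [← hPT]; simp; ring
  rw [← hcont] at hS
  obtain ⟨V, -, hV2, hV3, hV4⟩ := greedy dval 0 (it R 0)
  rw [zero_add] at hV2 hV3
  obtain ⟨VR, VP0, rfl⟩ := exists_it V
  obtain ⟨hVR, hVP0⟩ := it_le_it hV2
  have : VP0 = 0 := by simpa using hVP0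
  subst this
  rw [ys_zero, card_it] at hV4
  simp at hV4
  obtain ⟨RD, rfl⟩ := Multiset.le_iff_exists_add.1 hVR
  have hle := (Finset.card_le_card (ys_dval_sub (it VR 0))).trans card_evens
  by_cases hA : ys dval (it VR 0) = evens m
  · -- case A
    obtain ⟨p, hp⟩ := Multiset.exists_mem_of_ne_zero hP
    obtain ⟨P', rfl⟩ := Multiset.exists_cons_of_mem hp
    have e : it (VR + RD) (p ::ₘ P') = it VR {p} + it RD P' := by rw [← it_add]; simp
    have hX : ys dval (it VR {p}) = ys dval (it VR {p} + it RD P') := by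
      apply (ys_mono _ le_self_add).antisymm
      apply (ys_dval_sub _).trans
      rw [← hA]
      exact ys_mono _ (it_mono le_rfl (by simp))
    have hS' := hS
    have hW' := hW
    rw [e] at hS' hW'
    have hN := lemmaK hS' hW' hX (hasPair_it.2 (by simp))
    have hc := (count_it hN).trans (card_ys_le _)
    obtain ⟨h1, h2⟩ := arithA hm (by omega) hc
    simp only [Multiset.card_cons] at hcT
    constructor
    · simp; omega
    · intro heq
      simp only [Multiset.card_add] at heq
      have hj := h2 (by omega)
      rw [Multiset.card_eq_zero] at hj
      subst hj
      simp only [Multiset.card_zero] at *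
      refine ⟨VR, RD, p, rfl, ?_, hcont, hW, by omega, by omega, hN⟩
      rw [← hPT]; rfl
  · -- case B
    have hlt : (ys dval (it VR 0)).card < m := by
      apply lt_of_lt_of_le _ (card_evens (m := m))
      exact Finset.card_lt_card ((ys_dval_sub _).ssubset_of_ne hA)
    have hWX : ys dval (it VR P) = ys dval (it (VR + RD) P) := by
      have e1 : it VR P = it VR 0 + it 0 P := by rw [← it_add]; simp
      have e2 : it (VR + RD) P = it (VR + RD) 0 + it 0 P := by rw [← it_add]; simp
      rw [e1, e2]
      exact ys_add_congr hV3 _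
    have hVP : ∃ VP, VP ≠ 0 ∧ VP ≤ P ∧ ys dval (it VR VP) = ys dval (it VR P) ∧
        Multiset.card VR + Multiset.card VP + 1 ≤ m := by
      obtain ⟨V, hU1, hU2, hU3, hU4⟩ := greedy dval (it VR 0) (it 0 P)
      rw [← it_add] at hU2 hU3
      simp only [add_zero, zero_add] at hU2 hU3
      obtain ⟨VR', VP, rfl⟩ := exists_it V
      have h1 := (it_le_it hU1).1
      have h2 := (it_le_it hU2)
      have h3 : VR' = VR := le_antisymm h2.1 h1
      subst h3
      have h4 := (Finset.card_le_card (ys_dval_sub (it VR' VP))).trans card_evens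
      rw [card_it, card_it] at hU4
      simp only [Multiset.card_zero] at hU4
      by_cases hVP : VP = 0
      · subst hVP
        obtain ⟨p, hp⟩ := Multiset.exists_mem_of_ne_zero hP
        have hpP : {p} ≤ P := Multiset.singleton_le.2 hp
        refine ⟨{p}, by simp, hpP, ?_, ?_⟩
        · apply (ys_mono _ (it_mono le_rfl hpP)).antisymm
          rw [← hU3]
          exact ys_mono _ (it_mono le_rfl (by simp))
        · simp; omega
      · exact ⟨VP, hVP, h2.2, hU3, by omega⟩
    obtain ⟨VP, hVP0, hVPP, hX, hcard⟩ := hVP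
    obtain ⟨J, rfl⟩ := Multiset.le_iff_exists_add.1 hVPP
    have hS' := hS
    have hW' := hW
    rw [it_add] at hS' hW' hWX
    have hN := lemmaK hS' hW' (hX.trans hWX) (hasPair_it.2 hVP0)
    have hc := (count_it hN).trans (card_ys_le _)
    have hqm : Multiset.card RD + 1 ≤ m := by
      have hN0 : NoRel (it RD 0) := hN.mono (it_mono le_rfl (by simp))
      have hc0 := count_it hN0
      simp only [Multiset.card_zero, pow_zero, mul_one] at hc0
      by_contra hcon
      apply hA
      apply (ys_dval_sub _).antisymm
      intro s hs
      obtain ⟨z, -, rfl⟩ := Finset.mem_image.1 hs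
      obtain ⟨y1, hy1, y2, hy2, rfl⟩ := exists_diff (show m < (ys val (it RD 0)).card by omega) z
      obtain ⟨A, hA1, rfl⟩ := mem_ys.1 hy1
      obtain ⟨B, hB1, rfl⟩ := mem_ys.1 hy2
      have hVRD : it (VR + RD) 0 = it VR 0 + it RD 0 := by rw [← it_add]; simp
      rw [hVRD] at hV3
      have s1 := stab_add (ys_between hV3 le_self_add (add_le_add le_rfl hA1)) 0 (zero_mem_ys _ _)
      have s2 := stab_sub (ys_between hV3 le_self_add (add_le_add le_rfl hB1)) _ s1
      rw [sum_dval, sum_dval] at s2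
      convert s2 using 1
      simp only [sv]; ring
    rw [Multiset.card_add] at hcT
    rcases arithB hm (by omega) hqm hc with h | ⟨rfl, h1, h2⟩
    · constructor
      · simp; omega
      · intro heq; simp at heq; omega
    · by_cases h3 : Multiset.card VR = 0 ∧ Multiset.card VP = 3
      · exfalso
        obtain ⟨h3, h4⟩ := h3
        have h5 : RD = 0 := by rw [← Multiset.card_eq_zero]; omega
        rw [Multiset.card_eq_zero] at h3
        subst h3 h5
        rw [add_zero] at hS hW
        exact exc rfl h1 h4 hS hW hN
      · constructor
        · simp; omega
        · intro heq; simp at heq; omega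

end Bound

end DicyclicRho
namespace DicyclicRho

section Extremal

variable {m : ℕ}

theorem count_many {I : Multiset (Item m)} (K : Multiset (ZMod (2 * m)))
    (h : NoRel (it K 0 + I)) : (ys val I).card + Multiset.card K ≤ (ys val (it K 0 + I)).card := by
  induction K using Multiset.induction with
  | empty => simp [it]
  | cons r K ih =>
    have e : it (r ::ₘ K) 0 + I = Sum.inl r ::ₘ (it K 0 + I) := by simp [it]
    rw [e] at h ⊢
    have h1 := count_rot h
    have h2 := ih (h.mono (Multiset.le_cons_self _ _))
    simp
    omega

theorem noRel_sum {R A : Multiset (ZMod (2 * m))} (h : NoRel (it R 0)) (hA : A ≤ R) (h0 : A ≠ 0) :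
    A.sum ≠ 0 := by
  intro hs
  refine h (it A 0) 0 ?_ ?_ ?_ (Or.inr rfl)
  · rw [add_zero]; exact it_mono hA le_rfl
  · rw [add_zero]
    intro h1
    apply h0
    have := congrArg Multiset.card h1
    rw [card_it] at this
    simpa using this
  · rw [sv_it]; simp [hs, sv]

theorem all_equal [NeZero m] {R : Multiset (ZMod (2 * m))} (h : NoRel (it R 0))
    (hc : Multiset.card R + 1 = 2 * m) {r s : ZMod (2 * m)} (hr : r ∈ R) (hs : s ∈ R) : r = s := by
  classical
  by_contra hne
  obtain ⟨R', rfl⟩ := Multiset.exists_cons_of_mem hr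
  have hs' : s ∈ R' := by
    rcases Multiset.mem_cons.1 hs with h | h
    · exact absurd h.symm hne
    · exact h
  obtain ⟨K, rfl⟩ := Multiset.exists_cons_of_mem hs'
  have e : it (r ::ₘ s ::ₘ K) 0 = it K 0 + it {r, s} 0 := by
    rw [← it_add]; congr 1
    simp [← Multiset.singleton_add]; abel
  have hr0 : r ≠ 0 := by
    have := noRel_sum h (A := {r}) (by simp) (by simp)
    simpa using this
  have hs0 : s ≠ 0 := by
    have := noRel_sum h (A := {s}) (by simp) (by simp)
    simpa using this
  have hrs0 : r + s ≠ 0 := by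
    have := noRel_sum h (A := {r, s}) (by
      rw [show (r ::ₘ s ::ₘ K) = {r, s} + K by simp]; exact le_self_add) (by simp)
    simpa using this
  rw [e] at h
  have h1 := count_many K h
  have h2 := card_ys_le (it K 0 + it {r, s} 0)
  have h3 : ({0, r, s, r + s} : Finset (ZMod (2 * m))) ⊆ ys val (it {r, s} 0) := by
    have e2 : (it {r, s} 0 : Multiset (Item m)) = Sum.inl r ::ₘ Sum.inl s ::ₘ 0 := by
      simp [it]
    rw [e2]
    intro t ht
    simp only [Finset.mem_insert, Finset.mem_singleton] at ht
    rw [mem_ys_cons, mem_ys_cons, mem_ys_cons]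
    have h0 := zero_mem_ys (val : Item m → _) 0
    rcases ht with rfl | rfl | rfl | rfl
    · left; left; exact h0
    · right; left; simpa [val] using h0
    · left; right; simpa [val] using h0
    · right; right; simpa [val] using h0
  have h4 : ({0, r, s, r + s} : Finset (ZMod (2 * m))).card = 4 := by
    rw [Finset.card_insert_of_notMem, Finset.card_insert_of_notMem, Finset.card_insert_of_notMem,
      Finset.card_singleton]
    · simp [hr0]
    · simp [hne, hs0]
    · simp [hr0.symm, hs0.symm, hrs0.symm]
  have h5 := Finset.card_le_card h3
  simp at hc
  omega

theorem eq_zero_or_m [NeZero m] {z : ZMod (2 * m)} (h : 2 * z = 0) :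
    z = 0 ∨ z = (m : ZMod (2 * m)) := by
  have h1 : ((2 * z.val : ℕ) : ZMod (2 * m)) = 0 := by
    push_cast; rw [ZMod.natCast_zmod_val]; exact h
  rw [ZMod.natCast_eq_zero_iff] at h1
  have h2 : m ∣ z.val := Nat.dvd_of_mul_dvd_mul_left two_pos h1
  have h3 := ZMod.val_lt z
  obtain ⟨c, hc⟩ := h2
  have h4 : c < 2 := by
    by_contra h5
    have : m * 2 ≤ m * c := Nat.mul_le_mul_left m (by omega)
    omega
  have h6 := ZMod.natCast_zmod_val z
  interval_cases c
  · left; rw [← h6, hc]; simp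
  · right; rw [← h6, hc]; simp

theorem mul_inj_aux [NeZero m] {g : ZMod (2 * m)}
    (h : ∀ k : ℕ, 0 < k → k < 2 * m → (k : ZMod (2 * m)) * g ≠ 0) {k l : ℕ}
    (hk : k < 2 * m) (hl : l < 2 * m) (e : (k : ZMod (2 * m)) * g = (l : ZMod (2 * m)) * g) :
    k = l := by
  have key : ∀ {k l : ℕ}, k < l → l < 2 * m →
      (k : ZMod (2 * m)) * g = (l : ZMod (2 * m)) * g → False := by
    intro k l hkl hl e
    refine h (l - k) (by omega) (by omega) ?_
    rw [Nat.cast_sub hkl.le]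
    linear_combination -e
  rcases lt_trichotomy k l with h1 | h1 | h1
  · exact (key h1 hl e).elim
  · exact h1
  · exact (key h1 hk e.symm).elim

theorem F2 (hm : 3 ≤ m) {R T : Multiset (ZMod (2 * m))} (hS : IsMinimalProductOne (ct R T))
    (hc : Multiset.card R + Multiset.card T = 3 * m) :
    ∃ g x : ZMod (2 * m), R = Multiset.replicate (3 * m - 2) g ∧ T = {x, x} ∧ 2 * g ≠ 0 := by
  classical
  have : NeZero m := ⟨by omega⟩
  obtain ⟨VR, RD, p, hR, hT, hcont, hW, hVR, hRD, hN⟩ := (F1 hm hS).2 hc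
  obtain ⟨g, hg⟩ := Multiset.exists_mem_of_ne_zero (show RD ≠ 0 by rintro rfl; simp at hRD; omega)
  have hRDg : RD = Multiset.replicate (2 * m - 1) g := by
    rw [Multiset.eq_replicate]
    exact ⟨by omega, fun b hb => all_equal hN hRD hb hg⟩
  have hk : ∀ k : ℕ, 0 < k → k < 2 * m → (k : ZMod (2 * m)) * g ≠ 0 := by
    intro k hk0 hk1
    have := noRel_sum hN (A := Multiset.replicate k g)
      (by rw [hRDg]; exact Multiset.replicate_mono g (by omega))
      (by intro h0; have := congrArg Multiset.card h0; simp at this; omega)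
    simpa using this
  have hcR : Multiset.card R = 3 * m - 2 := by
    rw [hT] at hc; simp at hc; omega
  have hev : evens m ⊆ ys dval (it (Multiset.replicate (m - 1) g) {p}) := by
    have h1 : (Finset.range m).image (fun k : ℕ => 2 * ((k : ZMod (2 * m)) * g)) ⊆ evens m := by
      intro s hs
      obtain ⟨k, -, rfl⟩ := Finset.mem_image.1 hs
      exact Finset.mem_image.2 ⟨_, Finset.mem_univ _, rfl⟩
    have h2 : ((Finset.range m).image (fun k : ℕ => 2 * ((k : ZMod (2 * m)) * g))).card = m := by
      rw [Finset.card_image_of_injOn, Finset.card_range]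
      intro k hk1 l hl1 e
      simp at hk1 hl1 e
      have := mul_inj_aux hk (k := 2 * k) (l := 2 * l) (by omega) (by omega)
        (by push_cast; linear_combination e)
      omega
    have h3 := Finset.eq_of_subset_of_card_le h1 (by rw [h2]; exact card_evens)
    rw [← h3]
    intro s hs
    obtain ⟨k, hk1, rfl⟩ := Finset.mem_image.1 hs
    simp at hk1
    refine mem_ys.2 ⟨it (Multiset.replicate k g) 0,
      it_mono (Multiset.replicate_mono g (by omega)) (by simp), ?_⟩
    rw [sum_dval, sv_it]; simp
  obtain ⟨R2, hR2⟩ : ∃ R2, R = Multiset.replicate (m - 1) g + R2 := by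
    rw [← Multiset.le_iff_exists_add, hR, hRDg]
    exact (Multiset.replicate_mono g (show m - 1 ≤ 2 * m - 1 by omega)).trans (by simp)
  have hRg : R = Multiset.replicate (3 * m - 2) g := by
    have e : it R {p} = it (Multiset.replicate (m - 1) g) {p} + it R2 0 := by
      rw [← it_add, hR2]; simp
    have hS' := hS
    have hW' := hW
    rw [← hcont, e] at hS'
    rw [e] at hW'
    have hX : ys dval (it (Multiset.replicate (m - 1) g) {p}) =
        ys dval (it (Multiset.replicate (m - 1) g) {p} + it R2 0) :=
      (ys_mono _ le_self_add).antisymm ((ys_dval_sub _).trans hev)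
    have hN2 := lemmaK hS' hW' hX (hasPair_it.2 (by simp))
    have hcR2 : Multiset.card R2 + 1 = 2 * m := by
      rw [hR2] at hcR; simp at hcR; omega
    have hgR2 : g ∈ R2 := by
      have h1 : 2 * m - 1 ≤ Multiset.count g R := by
        rw [hR, hRDg]; simp
      rw [hR2] at h1
      simp at h1
      rw [← Multiset.one_le_count_iff_mem]
      omega
    have hR2g : R2 = Multiset.replicate (2 * m - 1) g := by
      rw [Multiset.eq_replicate]
      exact ⟨by omega, fun b hb => all_equal hN2 hcR2 hb hgR2⟩
    rw [hR2, hR2g, ← Multiset.replicate_add]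
    congr 1; omega
  have h2g : 2 * g ≠ 0 := by simpa using hk 2 (by omega) (by omega)
  -- surjectivity of multiples of g
  have hsurj : ∀ z : ZMod (2 * m), ∃ c < 2 * m, (c : ZMod (2 * m)) * g = z := by
    have h1 : ((Finset.range (2 * m)).image (fun k : ℕ => (k : ZMod (2 * m)) * g)) =
        Finset.univ := by
      apply Finset.eq_univ_of_card
      rw [Finset.card_image_of_injOn, Finset.card_range, ZMod.card]
      intro k hk1 l hl1 e
      simp at hk1 hl1
      exact mul_inj_aux hk hk1 hl1 e
    intro z
    have := Finset.mem_univ z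
    rw [← h1] at this
    simpa using this
  have hmg : (m : ZMod (2 * m)) * g = (m : ZMod (2 * m)) :=
    (eq_zero_or_m (z := (m : ZMod (2 * m)) * g) (by
      rw [← mul_assoc, two_m, zero_mul])).resolve_left (hk m (by omega) (by omega))
  have h2mg : ((2 * m : ℕ) : ZMod (2 * m)) * g = 0 := by rw [ZMod.natCast_self, zero_mul]
  obtain ⟨c, hc2, hce⟩ := hsurj (val (Sum.inr p : Item m))
  have hpar : c % 2 = m % 2 := by
    obtain ⟨A, -, hA⟩ := mem_ys.1 hW
    rw [sum_dval] at hA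
    obtain ⟨d, hd, hde⟩ := hsurj (sv A)
    have hsv : sv (it R {p}) = ((3 * m - 2 : ℕ) : ZMod (2 * m)) * g + (c : ZMod (2 * m)) * g := by
      rw [hce, hRg, sv_it]; simp [val]; ring
    rw [hsv, ← hde] at hA
    have h3 : ((2 * d : ℕ) : ZMod (2 * m)) * g = ((3 * m - 2 + c : ℕ) : ZMod (2 * m)) * g := by
      push_cast; linear_combination hA
    have red : ∀ n : ℕ, (n : ZMod (2 * m)) * g = ((n % (2 * m) : ℕ) : ZMod (2 * m)) * g := by
      intro n; rw [ZMod.natCast_mod]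
    rw [red, red (3 * m - 2 + c)] at h3
    have h4 := mul_inj_aux hk (Nat.mod_lt _ (by omega)) (Nat.mod_lt _ (by omega)) h3
    have h5 := Nat.mod_mod_of_dvd (2 * d) (show 2 ∣ 2 * m from ⟨m, rfl⟩)
    have h6 := Nat.mod_mod_of_dvd (3 * m - 2 + c) (show 2 ∣ 2 * m from ⟨m, rfl⟩)
    rw [h4] at h5
    omega
  have hcm : c = m := by
    by_contra hne
    have hrest : sv (it (Multiset.replicate (m - 2) g) {p}) ∈
        ys dval (it (Multiset.replicate (m - 2) g) {p}) := by
      have hsv : sv (it (Multiset.replicate (m - 2) g) {p}) =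
          ((m - 2 : ℕ) : ZMod (2 * m)) * g + (c : ZMod (2 * m)) * g := by
        rw [hce, sv_it]; simp [val]; ring
      rw [hsv]
      rcases lt_or_gt_of_ne hne with h | h
      · obtain ⟨k, hk1⟩ : ∃ k, m - 2 + c = 2 * k := ⟨(m - 2 + c) / 2, by omega⟩
        refine mem_ys.2 ⟨it (Multiset.replicate k g) 0,
          it_mono (Multiset.replicate_mono g (by omega)) (by simp), ?_⟩
        rw [sum_dval, sv_it]
        have := congrArg (fun n : ℕ => (n : ZMod (2 * m)) * g) hk1
        simp only [Nat.cast_add, Nat.cast_mul, Nat.cast_ofNat] at this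
        simp
        linear_combination -this
      · obtain ⟨k, hk1⟩ : ∃ k, m - 2 + 2 * m = 2 * k + c := ⟨(3 * m - 2 - c) / 2, by omega⟩
        refine mem_ys.2 ⟨it (Multiset.replicate k g) {p},
          it_mono (Multiset.replicate_mono g (by omega)) le_rfl, ?_⟩
        have hsv2 : sv (it (Multiset.replicate k g) {p}) =
            (k : ZMod (2 * m)) * g + (c : ZMod (2 * m)) * g := by
          rw [hce, sv_it]; simp [val]; ring
        rw [sum_dval, hsv2]
        have := congrArg (fun n : ℕ => (n : ZMod (2 * m)) * g) hk1
        simp only [Nat.cast_add, Nat.cast_mul, Nat.cast_ofNat] at this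
        push_cast at h2mg
        linear_combination -this + h2mg
    have hPO := cont_po_of_mem (hasPair_it.2 (by simp)) hrest
    have hPO2 : IsProductOne (ct (Multiset.replicate (2 * m) g) 0) := by
      apply po_rot
      simp
    refine hS.2.2 _ _ ?_ ?_ hPO2 hPO ?_
    · intro h0
      have := congrArg Multiset.card h0
      rw [card_ct] at this
      simp at this
      omega
    · exact cont_ne_zero (by
        intro h0
        have := congrArg Multiset.card h0
        rw [card_it] at this
        simp at this)
    · rw [← hcont, cont_it, cont_it, ← ct_add, hRg, ← Multiset.replicate_add, zero_add]
      congr 2; omega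
  refine ⟨g, p.1, hRg, ?_, h2g⟩
  have hp : p.1 = p.2 := by
    rw [hcm, hmg] at hce
    simp only [val] at hce
    linear_combination -hce
  rw [hT, ← hp]

end Extremal

end DicyclicRho
namespace DicyclicRho

open QuaternionGroup

section QuaternionEight

/-- The quaternion group of order eight. -/
abbrev Q8 := QuaternionGroup 2

/-- The central involution. -/
def z8 : Q8 := a 2

theorem z8_comm : ∀ x : Q8, z8 * x = x * z8 := by decide +kernel

theorem z8_sq : z8 * z8 = 1 := by decide +kernel

theorem q8_swap : ∀ x y : Q8, x * y = y * x ∨ x * y = z8 * (y * x) := by decide +kernel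

theorem perm_z8 {l1 l2 : List Q8} (h : l1.Perm l2) :
    l1.prod = l2.prod ∨ l1.prod = z8 * l2.prod := by
  induction h with
  | nil => left; rfl
  | cons x _ ih =>
    rcases ih with ih | ih
    · left; simp [ih]
    · right; simp only [List.prod_cons, ih]; rw [← mul_assoc, ← z8_comm, mul_assoc]
  | swap x y l =>
    simp only [List.prod_cons, ← mul_assoc]
    rcases q8_swap y x with h | h
    · left; rw [h]
    · right; rw [h]; simp only [mul_assoc]
  | trans _ _ ih1 ih2 =>
    rcases ih1 with h1 | h1 <;> rcases ih2 with h2 | h2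
    · left; rw [h1, h2]
    · right; rw [h1, h2]
    · right; rw [h1, h2]
    · left; rw [h1, h2, ← mul_assoc, z8_sq, one_mul]

theorem rest_nc {Q C : Multiset Q8} (hS : IsProductOne (Q + C)) (hQ : IsProductOne Q)
    {u v : Q8} (huv : u * v ≠ v * u) (hC : ∃ C', C = u ::ₘ v ::ₘ C') : IsProductOne C := by
  obtain ⟨C', rfl⟩ := hC
  obtain ⟨lS, hlS, hpS⟩ := hS
  obtain ⟨lQ, rfl, hpQ⟩ := hQ
  induction C' using Quotient.inductionOn with
  | _ lC =>
  have hperm : lS.Perm (lQ ++ (u :: v :: lC)) := by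
    rw [← Multiset.coe_eq_coe, hlS]
    simp
  have h1 := perm_z8 hperm
  rw [hpS, List.prod_append, hpQ, one_mul, List.prod_cons, List.prod_cons] at h1
  rcases h1 with h1 | h1
  · exact ⟨u :: v :: lC, by simp, by simp [← h1]⟩
  · refine ⟨v :: u :: lC, by simpa using List.Perm.swap _ _ _, ?_⟩
    rw [List.prod_cons, List.prod_cons, h1]
    have h2 := (q8_swap v u).resolve_left (Ne.symm huv)
    rw [← mul_assoc, h2]
    simp only [mul_assoc]

theorem rest_comm {Q C : Multiset Q8} (hS : IsProductOne (Q + C)) (hQ : IsProductOne Q)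
    (hc : ∀ u ∈ Q + C, ∀ v ∈ Q + C, u * v = v * u) : IsProductOne C := by
  obtain ⟨lS, hlS, hpS⟩ := hS
  obtain ⟨lQ, rfl, hpQ⟩ := hQ
  induction C using Quotient.inductionOn with
  | _ lC =>
  have hperm : lS.Perm (lQ ++ lC) := by
    rw [← Multiset.coe_eq_coe, hlS]
    simp
  have h1 := hperm.prod_eq' (by
    rw [← hlS] at hc
    apply List.pairwise_of_forall_mem_list
    intro x hx y hy
    exact hc x (by simpa using hx) y (by simpa using hy))
  rw [hpS, List.prod_append, hpQ, one_mul] at h1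
  exact ⟨lC, by simp, h1.symm⟩

/-- Product-one-free sequences. -/
def PF (S : Multiset Q8) : Prop := ∀ Q ≤ S, Q ≠ 0 → ¬ IsProductOne Q

theorem PF.mono {S T : Multiset Q8} (h : PF T) (hST : S ≤ T) : PF S :=
  fun Q hQ => h Q (hQ.trans hST)

/-- index lists of subsequences used below -/
def idx : List (List (Fin 4)) :=
  [[0], [1], [2], [3], [0, 1], [0, 2], [0, 3], [1, 2], [1, 3], [2, 3], [0, 1, 2], [1, 0, 2],
   [0, 1, 3], [1, 0, 3], [0, 2, 3], [2, 0, 3], [1, 2, 3], [2, 1, 3], [0, 1, 2, 3], [0, 1, 3, 2],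
   [0, 2, 1, 3], [0, 2, 3, 1], [0, 3, 1, 2], [0, 3, 2, 1]]

theorem four_decide : ∀ w x y t : Q8, (∀ l ∈ idx, (l.map ![w, x, y, t]).prod ≠ 1) →
    (w = x ∧ x = y ∧ w * t ≠ t * w) ∨ (w = x ∧ x = t ∧ w * y ≠ y * w) ∨
    (w = y ∧ y = t ∧ w * x ≠ x * w) ∨ (x = y ∧ y = t ∧ x * w ≠ w * x) := by
  decide +kernel

theorem four_pf {w x y t : Q8} (h : PF {w, x, y, t}) :
    (w = x ∧ x = y ∧ w * t ≠ t * w) ∨ (w = x ∧ x = t ∧ w * y ≠ y * w) ∨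
    (w = y ∧ y = t ∧ w * x ≠ x * w) ∨ (x = y ∧ y = t ∧ x * w ≠ w * x) := by
  have key : ∀ l : List (Fin 4), l.Nodup → l ≠ [] → (l.map ![w, x, y, t]).prod ≠ 1 := by
    intro l hl h0 h1
    refine h ((l : Multiset (Fin 4)).map ![w, x, y, t]) ?_ ?_ ⟨l.map ![w, x, y, t], by simp, h1⟩
    · have e : ({w, x, y, t} : Multiset Q8) =
          (([0, 1, 2, 3] : List (Fin 4)) : Multiset (Fin 4)).map ![w, x, y, t] := by
        rfl
      rw [e]
      apply Multiset.map_le_map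
      rw [Multiset.le_iff_subset (by simpa using hl)]
      intro i _
      fin_cases i <;> simp
    · simpa using h0
  apply four_decide w x y t
  intro l hl
  have hidx : ∀ l ∈ idx, l.Nodup ∧ l ≠ [] := by decide
  exact key l (hidx l hl).1 (hidx l hl).2

theorem q8_inv : ∀ g h v : Q8, g * h ≠ h * g → h * v = z8 → v = h := by decide +kernel

theorem q8_pow : ∀ g h : Q8, g * h ≠ h * g → g * (g * (g * g)) = 1 := by decide +kernel

theorem po_replicate {g h : Q8} (hgh : g * h ≠ h * g) : IsProductOne ({g, g, g, g} : Multiset Q8) :=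
  ⟨[g, g, g, g], rfl, by simpa using q8_pow g h hgh⟩

theorem pf_rest {u v : Q8} {S : Multiset Q8} (hS : IsMinimalProductOne (u ::ₘ v ::ₘ S))
    (huv : u * v ≠ v * u) : PF S := by
  intro Q hQ h0 hpo
  obtain ⟨C, rfl⟩ := Multiset.le_iff_exists_add.1 hQ
  have e : u ::ₘ v ::ₘ (Q + C) = Q + (u ::ₘ v ::ₘ C) := by
    simp [← Multiset.singleton_add]; abel
  rw [e] at hS
  exact hS.2.2 _ _ h0 (by simp) hpo (rest_nc hS.2.1 hpo huv ⟨C, rfl⟩) rfl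

theorem exists_four {S : Multiset Q8} (h : 4 ≤ Multiset.card S) :
    ∃ w x y t S', S = {w, x, y, t} + S' := by
  induction S using Quotient.inductionOn with
  | _ l =>
    match l, h with
    | w :: x :: y :: t :: l, _ =>
      exact ⟨w, x, y, t, (l : Multiset Q8), by simp⟩

theorem pf_final {g h v : Q8} (hgh : g * h ≠ h * g)
    (hS : IsMinimalProductOne ({g, g, g, g, h, v} : Multiset Q8)) : v = h := by
  obtain ⟨l, hl, hp⟩ := hS.2.1
  have hperm : l.Perm [g, g, g, g, h, v] := by
    rw [← Multiset.coe_eq_coe, hl]; rfl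
  have h1 := perm_z8 hperm
  have h2 : [g, g, g, g, h, v].prod = h * v := by
    have := q8_pow g h hgh
    simp only [List.prod_cons, List.prod_nil, mul_one]
    calc g * (g * (g * (g * (h * v)))) = g * (g * (g * g)) * (h * v) := by
          simp only [mul_assoc]
      _ = _ := by rw [this, one_mul]
  rw [hp, h2] at h1
  rcases h1 with h1 | h1
  · exfalso
    refine hS.2.2 {g, g, g, g} {h, v} (by simp) (by simp) (po_replicate hgh)
      ⟨[h, v], rfl, by simp [← h1]⟩ ?_
    rfl
  · apply q8_inv g h v hgh
    calc h * v = z8 * (z8 * (h * v)) := by rw [← mul_assoc, z8_sq, one_mul]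
      _ = z8 := by rw [← h1, mul_one]

theorem q8_struct {S : Multiset Q8} (hS : IsMinimalProductOne S) (hc : 6 ≤ Multiset.card S) :
    ∃ g h : Q8, g * h ≠ h * g ∧ S = {g, g, g, g, h, h} := by
  by_cases hcomm : ∀ u ∈ S, ∀ v ∈ S, u * v = v * u
  · exfalso
    obtain ⟨w, x, y, t, S', rfl⟩ := exists_four (show 4 ≤ Multiset.card S by omega)
    by_cases hpf : PF {w, x, y, t}
    · rcases four_pf hpf with h | h | h | h
      · exact h.2.2 (hcomm _ (by simp) _ (by simp))
      · exact h.2.2 (hcomm _ (by simp) _ (by simp))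
      · exact h.2.2 (hcomm _ (by simp) _ (by simp))
      · exact h.2.2 (hcomm _ (by simp) _ (by simp))
    · unfold PF at hpf
      push Not at hpf
      obtain ⟨Q, hQ, h0, hpo⟩ := hpf
      have hcQ := Multiset.card_le_card hQ
      obtain ⟨C, hC⟩ := Multiset.le_iff_exists_add.1 hQ
      rw [hC, add_assoc] at hS hcomm hc
      refine hS.2.2 Q (C + S') h0 ?_ hpo (rest_comm hS.2.1 hpo hcomm) rfl
      intro h0
      rw [h0] at hc
      simp at hc hcQ
      omega
  · push Not at hcomm
    obtain ⟨u, hu, v, hv, huv⟩ := hcomm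
    obtain ⟨S1, rfl⟩ := Multiset.exists_cons_of_mem hu
    have hv' : v ∈ S1 := by
      rcases Multiset.mem_cons.1 hv with h | h
      · subst h; exact absurd rfl huv
      · exact h
    obtain ⟨S2, rfl⟩ := Multiset.exists_cons_of_mem hv'
    have hpf := pf_rest hS huv
    simp at hc
    obtain ⟨w, x, y, t, S', rfl⟩ := exists_four (show 4 ≤ Multiset.card S2 by omega)
    have hstd : ∃ g h, g * h ≠ h * g ∧ ({w, x, y, t} : Multiset Q8) = {g, g, g, h} := by
      rcases four_pf (hpf.mono le_self_add) with ⟨rfl, rfl, h⟩ | ⟨rfl, rfl, h⟩ | ⟨rfl, rfl, h⟩ |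
        ⟨rfl, rfl, h⟩
      · exact ⟨_, _, h, rfl⟩
      · exact ⟨_, _, h, by simp [← Multiset.singleton_add]; abel⟩
      · exact ⟨_, _, h, by simp [← Multiset.singleton_add]; abel⟩
      · exact ⟨_, _, h, by simp [← Multiset.singleton_add]; abel⟩
    obtain ⟨g, h, hgh, he⟩ := hstd
    rw [he] at hpf hS
    have hS' : S' = 0 := by
      by_contra h0
      obtain ⟨s, hs⟩ := Multiset.exists_mem_of_ne_zero h0
      obtain ⟨S'', rfl⟩ := Multiset.exists_cons_of_mem hs
      have e1 : ({g, g, g, h} + s ::ₘ S'' : Multiset Q8) = {g, g, g, s} + h ::ₘ S'' := by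
        simp [← Multiset.singleton_add]; abel
      have e2 : ({g, g, g, h} + s ::ₘ S'' : Multiset Q8) = {g, g, h, s} + g ::ₘ S'' := by
        simp [← Multiset.singleton_add]; abel
      have f1 := four_pf ((e1 ▸ hpf).mono le_self_add)
      have f2 := four_pf ((e2 ▸ hpf).mono le_self_add)
      have hgs : g * s ≠ s * g := by
        rcases f1 with h | h | h | h
        · exact h.2.2
        · exact absurd rfl h.2.2
        · exact absurd rfl h.2.2
        · exact absurd rfl h.2.2
      rcases f2 with ⟨-, rfl, -⟩ | ⟨-, rfl, -⟩ | ⟨rfl, -, -⟩ | ⟨rfl, -, -⟩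
      · exact hgh rfl
      · exact hgs rfl
      · exact hgh rfl
      · exact hgh rfl
    subst hS'
    rw [add_zero] at hS hpf
    have e3 : (u ::ₘ v ::ₘ {g, g, g, h} : Multiset Q8) = g ::ₘ h ::ₘ {u, v, g, g} := by
      simp [← Multiset.singleton_add]; abel
    have hpf2 := pf_rest (e3 ▸ hS) hgh
    have huvg : u = g ∨ v = g := by
      rcases four_pf hpf2 with ⟨-, h, -⟩ | ⟨-, h, -⟩ | ⟨h, -, -⟩ | ⟨h, -, -⟩
      · exact Or.inr h
      · exact Or.inr h
      · exact Or.inl h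
      · exact Or.inr h
    refine ⟨g, h, hgh, ?_⟩
    rw [add_zero, he]
    rcases huvg with rfl | rfl
    · have e4 : (u ::ₘ v ::ₘ {u, u, u, h} : Multiset Q8) = {u, u, u, u, h, v} := by
        simp [← Multiset.singleton_add]; abel
      rw [e4] at hS
      rw [e4, pf_final hgh hS]
    · have e4 : (u ::ₘ v ::ₘ {v, v, v, h} : Multiset Q8) = {v, v, v, v, h, u} := by
        simp [← Multiset.singleton_add]; abel
      rw [e4] at hS
      rw [e4, pf_final hgh hS]

end QuaternionEight

end DicyclicRho
namespace DicyclicRho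

open QuaternionGroup

section Transfer

variable {G H : Type*} [Group G] [Group H]

theorem hasLength_iff {a : Multiset G} {k : ℕ} : HasLength a k ↔
    ∃ L : Multiset (Multiset G), (∀ A ∈ L, IsMinimalProductOne A) ∧ L.sum = a ∧
      Multiset.card L = k := by
  constructor
  · rintro ⟨f, hf, rfl⟩
    refine ⟨Finset.univ.val.map f, ?_, rfl, by simp⟩
    intro A hA
    simp at hA
    obtain ⟨i, rfl⟩ := hA
    exact hf i
  · rintro ⟨L, hL, rfl, rfl⟩
    induction L using Quotient.inductionOn with
    | _ l =>
      refine ⟨fun i : Fin l.length => l.get i, fun i => hL _ (List.get_mem l i), ?_⟩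
      have := List.sum_ofFn (f := fun i => l.get i)
      rw [List.ofFn_get] at this
      exact this.symm

theorem isProductOne_add {S T : Multiset G} (hS : IsProductOne S) (hT : IsProductOne T) :
    IsProductOne (S + T) := by
  obtain ⟨l, rfl, hl⟩ := hS
  obtain ⟨l', rfl, hl'⟩ := hT
  exact ⟨l ++ l', by simp, by simp [hl, hl']⟩

theorem isProductOne_sum (L : Multiset (Multiset G)) (h : ∀ A ∈ L, IsMinimalProductOne A) :
    IsProductOne L.sum := by
  induction L using Multiset.induction with
  | empty => exact ⟨[], rfl, rfl⟩
  | cons A L ih =>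
    rw [Multiset.sum_cons]
    exact isProductOne_add (h A (by simp)).2.1 (ih fun B hB => h B (by simp [hB]))

theorem po_map (e : G ≃* H) {S : Multiset G} (h : IsProductOne S) : IsProductOne (S.map e) := by
  obtain ⟨l, rfl, hl⟩ := h
  exact ⟨l.map e, by simp, by rw [← map_list_prod, hl, map_one]⟩

theorem min_map (e : G ≃* H) {S : Multiset G} (h : IsMinimalProductOne S) :
    IsMinimalProductOne (S.map e) := by
  refine ⟨by simpa using h.1, po_map e h.2.1, ?_⟩
  intro T1 T2 h1 h2 p1 p2 he
  refine h.2.2 (T1.map e.symm) (T2.map e.symm) (by simpa using h1) (by simpa using h2)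
    (po_map e.symm p1) (po_map e.symm p2) ?_
  rw [← Multiset.map_add, ← he, Multiset.map_map]
  simp

theorem hasLength_map (e : G ≃* H) {S : Multiset G} {k : ℕ} (h : HasLength S k) :
    HasLength (S.map e) k := by
  obtain ⟨f, hf, rfl⟩ := h
  refine ⟨fun i => (f i).map e, fun i => min_map e (hf i), ?_⟩
  exact (map_sum (Multiset.mapAddMonoidHom e) f Finset.univ).symm

theorem unionLengths_sub (e : G ≃* H) (k : ℕ) : UnionLengths G k ⊆ UnionLengths H k := by
  rintro n ⟨a, h1, h2, h3⟩
  exact ⟨a.map e, po_map e h1, hasLength_map e h2, hasLength_map e h3⟩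

theorem rhoK_congr (e : G ≃* H) (k : ℕ) : rhoK G k = rhoK H k := by
  unfold rhoK
  rw [(unionLengths_sub e k).antisymm (unionLengths_sub e.symm k)]

theorem davenport_congr (e : G ≃* H) : DavenportLarge G = DavenportLarge H := by
  unfold DavenportLarge
  congr 1
  ext n
  constructor
  · rintro ⟨S, h, rfl⟩
    exact ⟨S.map e, min_map e h, by simp⟩
  · rintro ⟨S, h, rfl⟩
    exact ⟨S.map e.symm, min_map e.symm h, by simp⟩

theorem po_singleton {g : G} (h : IsProductOne ({g} : Multiset G)) : g = 1 := by
  obtain ⟨l, hl, hp⟩ := h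
  rw [Multiset.coe_eq_singleton] at hl
  subst hl
  simpa using hp

theorem pair_atom {g : G} (h : g ≠ 1) : IsMinimalProductOne ({g} + {g⁻¹} : Multiset G) := by
  refine ⟨by simp, ⟨[g, g⁻¹], rfl, by simp⟩, ?_⟩
  intro T1 T2 h1 h2 p1 p2 he
  have hc := congrArg Multiset.card he
  have c1 := Multiset.card_pos.2 h1
  have c2 := Multiset.card_pos.2 h2
  simp at hc
  obtain ⟨t, rfl⟩ := Multiset.card_eq_one.1 (show Multiset.card T1 = 1 by omega)
  have ht := po_singleton p1
  have : t ∈ ({g} + {g⁻¹} : Multiset G) := by rw [he]; simp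
  simp at this
  rcases this with h3 | h3
  · exact h (h3 ▸ ht)
  · rw [ht] at h3
    exact h (by simpa using h3.symm)

end Transfer

section Lower

variable {m : ℕ}

theorem po_card {R T : Multiset (ZMod (2 * m))} (h : IsProductOne (ct R T)) :
    ∃ n, Multiset.card T = 2 * n := by
  obtain ⟨R1, R2, X1, X2, rfl, rfl, hc, h⟩ := po_form h
  exact ⟨Multiset.card X2, by simp [hc]; ring⟩

theorem long_aux [NeZero m] (hm : 2 ≤ m) {g x : ZMod (2 * m)}
    (hk : ∀ k : ℕ, 0 < k → k < 2 * m → (k : ZMod (2 * m)) * g ≠ 0)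
    {R1 R2 : Multiset (ZMod (2 * m))} (hR : Multiset.replicate (3 * m - 2) g = R1 + R2)
    (h1 : R1 ≠ 0) (p1 : IsProductOne (ct R1 0)) (p2 : IsProductOne (ct R2 {x, x})) : False := by
  have hmg : (m : ZMod (2 * m)) * g = (m : ZMod (2 * m)) :=
    (eq_zero_or_m (z := (m : ZMod (2 * m)) * g) (by
      rw [← mul_assoc, two_m, zero_mul])).resolve_left (hk m (by omega) (by omega))
  have hrep : ∀ A, A ≤ Multiset.replicate (3 * m - 2) g →
      A = Multiset.replicate (Multiset.card A) g := by
    intro A hA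
    rw [Multiset.eq_replicate]
    exact ⟨rfl, fun b hb => Multiset.eq_of_mem_replicate (Multiset.mem_of_le hA hb)⟩
  have hR1 := hrep R1 (by rw [hR]; exact le_self_add)
  have hs := rot_of_po p1
  have hc := congrArg Multiset.card hR
  have c1 := Multiset.card_pos.2 h1
  simp at hc
  have hcard1 : Multiset.card R1 = 2 * m := by
    rw [hR1] at hs
    simp at hs
    have h2 : ((Multiset.card R1 % (2 * m) : ℕ) : ZMod (2 * m)) * g = 0 := by
      rw [ZMod.natCast_mod]; exact hs
    have h3 : Multiset.card R1 % (2 * m) = 0 := by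
      by_contra h0
      exact hk _ (by omega) (Nat.mod_lt _ (by omega)) h2
    obtain ⟨c, hc'⟩ := Nat.dvd_of_mod_eq_zero h3
    have : c < 2 := by
      by_contra h5
      have : 2 * m * 2 ≤ 2 * m * c := Nat.mul_le_mul_left _ (by omega)
      omega
    interval_cases c
    · omega
    · omega
  obtain ⟨Ra, Rb, X1, X2, hRab, hX, hcX, hsum⟩ := po_form p2
  have hcX2 := congrArg Multiset.card hX
  simp at hcX2
  obtain ⟨x1, rfl⟩ := Multiset.card_eq_one.1 (show Multiset.card X1 = 1 by omega)
  obtain ⟨x2, rfl⟩ := Multiset.card_eq_one.1 (show Multiset.card X2 = 1 by omega)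
  have hx1 : x1 = x := by
    have : x1 ∈ ({x, x} : Multiset (ZMod (2 * m))) := by rw [hX]; simp
    simpa using this
  have hx2 : x2 = x := by
    have : x2 ∈ ({x, x} : Multiset (ZMod (2 * m))) := by rw [hX]; simp
    simpa using this
  have hRa := hrep Ra (by rw [hR, hRab]; exact le_self_add.trans le_add_self)
  have hRb := hrep Rb (by rw [hR, hRab]; exact le_add_self.trans le_add_self)
  have hcab : Multiset.card R2 = Multiset.card Ra + Multiset.card Rb := by rw [hRab]; simp
  rw [hRa, hRb, hx1, hx2] at hsum
  simp at hsum
  have hk' := hk (Multiset.card Ra + m - Multiset.card Rb) (by omega) (by omega)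
  rw [Nat.cast_sub (by omega)] at hk'
  apply hk'
  push_cast
  linear_combination hsum + hmg

theorem long_atom (hm : 2 ≤ m) {g x : ZMod (2 * m)}
    (hk : ∀ k : ℕ, 0 < k → k < 2 * m → (k : ZMod (2 * m)) * g ≠ 0) :
    IsMinimalProductOne (ct (Multiset.replicate (3 * m - 2) g) {x, x}) := by
  have : NeZero m := ⟨by omega⟩
  have hmg : (m : ZMod (2 * m)) * g = (m : ZMod (2 * m)) :=
    (eq_zero_or_m (z := (m : ZMod (2 * m)) * g) (by
      rw [← mul_assoc, two_m, zero_mul])).resolve_left (hk m (by omega) (by omega))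
  refine ⟨?_, ?_, ?_⟩
  · intro h
    have := congrArg Multiset.card h
    rw [card_ct] at this
    simp at this
  · have e : Multiset.replicate (3 * m - 2) g =
        Multiset.replicate (2 * m - 1) g + Multiset.replicate (m - 1) g := by
      rw [← Multiset.replicate_add]; congr 1; omega
    rw [e]
    apply po_of_form (X1 := {x}) (X2 := {x}) rfl (by simp)
    have h1 : 2 * m - 1 = (m - 1) + m := by omega
    rw [h1]
    simp
    linear_combination hmg + (@two_m m)
  · intro S1 S2 h1 h2 p1 p2 he
    obtain ⟨R1, T1, rfl⟩ := exists_ct S1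
    obtain ⟨R2, T2, rfl⟩ := exists_ct S2
    rw [← ct_add] at he
    obtain ⟨hR, hT⟩ := ct_inj he
    obtain ⟨n1, hn1⟩ := po_card p1
    obtain ⟨n2, hn2⟩ := po_card p2
    have hc := congrArg Multiset.card hT
    simp at hc
    rcases (show n1 = 0 ∨ n2 = 0 by omega) with h0 | h0
    · have hT1 : T1 = 0 := by rw [← Multiset.card_eq_zero]; omega
      subst hT1
      rw [zero_add] at hT
      subst hT
      refine long_aux hm hk hR ?_ p1 p2
      rintro rfl
      exact h1 (by simp [ct])
    · have hT2 : T2 = 0 := by rw [← Multiset.card_eq_zero]; omega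
      subst hT2
      rw [add_zero] at hT
      subst hT
      refine long_aux hm hk (hR.trans (add_comm _ _)) ?_ p2 p1
      rintro rfl
      exact h2 (by simp [ct])

theorem cast_ne {k : ℕ} (h0 : 0 < k) (h1 : k < 2 * m) : (k : ZMod (2 * m)) ≠ 0 := by
  intro h
  rw [ZMod.natCast_eq_zero_iff] at h
  have := Nat.le_of_dvd h0 h
  omega

theorem four_atom (hm : 2 ≤ m) : IsMinimalProductOne
    (ct 0 {(m : ZMod (2 * m)), (m : ZMod (2 * m)), 1 + (m : ZMod (2 * m)),
      1 + (m : ZMod (2 * m))}) := by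
  have : NeZero m := ⟨by omega⟩
  refine ⟨?_, ?_, ?_⟩
  · intro h
    have := congrArg Multiset.card h
    rw [card_ct] at this
    simp at this
  · have := po_of_form (m := m) (R1 := 0) (R2 := 0)
      (X1 := {(m : ZMod (2 * m)), 1 + (m : ZMod (2 * m))})
      (X2 := {(m : ZMod (2 * m)), 1 + (m : ZMod (2 * m))}) rfl (by simp)
      (by simp; linear_combination (@two_m m))
    have e : ({(m : ZMod (2 * m)), (m : ZMod (2 * m)), 1 + (m : ZMod (2 * m)),
        1 + (m : ZMod (2 * m))} : Multiset (ZMod (2 * m))) =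
        {(m : ZMod (2 * m)), 1 + (m : ZMod (2 * m))} +
          {(m : ZMod (2 * m)), 1 + (m : ZMod (2 * m))} := by
      simp only [Multiset.insert_eq_cons, ← Multiset.singleton_add]
      abel
    rw [e]
    rwa [add_zero] at this
  · intro S1 S2 h1 h2 p1 p2 he
    obtain ⟨R1, T1, rfl⟩ := exists_ct S1
    obtain ⟨R2, T2, rfl⟩ := exists_ct S2
    rw [← ct_add] at he
    obtain ⟨hR, hT⟩ := ct_inj he
    obtain ⟨n1, hn1⟩ := po_card p1
    obtain ⟨n2, hn2⟩ := po_card p2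
    have hc := congrArg Multiset.card hT
    simp at hc
    have hR' := add_eq_zero.1 hR.symm
    obtain ⟨rfl, rfl⟩ := hR'
    have c1 : 0 < Multiset.card T1 := by
      rw [Multiset.card_pos]; rintro rfl; exact h1 (by simp [ct])
    have c2 : 0 < Multiset.card T2 := by
      rw [Multiset.card_pos]; rintro rfl; exact h2 (by simp [ct])
    have hT1 : Multiset.card T1 = 2 := by omega
    obtain ⟨Ra, Rb, X1, X2, hRab, rfl, hcX, hsum⟩ := po_form p1
    rw [Multiset.card_add] at hT1
    obtain ⟨x1, rfl⟩ := Multiset.card_eq_one.1 (show Multiset.card X1 = 1 by omega)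
    obtain ⟨x2, rfl⟩ := Multiset.card_eq_one.1 (show Multiset.card X2 = 1 by omega)
    have hRab' := add_eq_zero.1 hRab.symm
    obtain ⟨rfl, rfl⟩ := hRab'
    have hx1 : x1 ∈ ({x1} + {x2} + T2 : Multiset (ZMod (2 * m))) := by simp
    have hx2 : x2 ∈ ({x1} + {x2} + T2 : Multiset (ZMod (2 * m))) := by simp
    rw [← hT] at hx1 hx2
    simp only [Multiset.insert_eq_cons, Multiset.mem_cons, Multiset.mem_singleton] at hx1 hx2
    simp at hsum
    have m0 : (m : ZMod (2 * m)) ≠ 0 := cast_ne (by omega) (by omega)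
    have m1 : ((m + 1 : ℕ) : ZMod (2 * m)) ≠ 0 := cast_ne (by omega) (by omega)
    have m2 : ((m - 1 : ℕ) : ZMod (2 * m)) ≠ 0 := cast_ne (by omega) (by omega)
    rw [Nat.cast_sub (by omega)] at m2
    push_cast at m1 m2
    rcases hx1 with h | h | h | h <;> rcases hx2 with h' | h' | h' | h' <;> rw [h, h'] at hsum
    all_goals first
      | exact m0 (by linear_combination hsum)
      | exact m1 (by linear_combination hsum)
      | exact m2 (by linear_combination hsum)

theorem ct_pair (n : ℕ) (g x : ZMod (2 * m)) :
    ct (Multiset.replicate n g) {x, x} =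
      n • ({a g} : Multiset (QuaternionGroup m)) + 2 • ({xa x} : Multiset (QuaternionGroup m)) := by
  rw [ct, Multiset.map_replicate, Multiset.nsmul_singleton, Multiset.nsmul_singleton]
  rfl

theorem lower_mem (hm : 2 ≤ m) (k : ℕ) (hk : 1 ≤ k) :
    k * (3 * m) + 2 ∈ UnionLengths (QuaternionGroup m) (2 * k + 1) := by
  have : NeZero m := ⟨by omega⟩
  obtain ⟨k, rfl⟩ : ∃ k', k = k' + 1 := ⟨k - 1, by omega⟩
  have hk1 : ∀ k : ℕ, 0 < k → k < 2 * m → (k : ZMod (2 * m)) * 1 ≠ 0 := by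
    intro k h0 h1; rw [mul_one]; exact cast_ne h0 h1
  have hk2 : ∀ k : ℕ, 0 < k → k < 2 * m → (k : ZMod (2 * m)) * (-1) ≠ 0 := by
    intro k h0 h1; simpa using cast_ne h0 h1
  have A1 := long_atom hm (x := 0) hk1
  have A1' := long_atom hm (x := (m : ZMod (2 * m))) hk2
  have A2 := long_atom hm (x := 1) hk2
  have A3 := four_atom hm
  have e3 : ct 0 {(m : ZMod (2 * m)), (m : ZMod (2 * m)), 1 + (m : ZMod (2 * m)),
      1 + (m : ZMod (2 * m))} =
      2 • ({xa (m : ZMod (2 * m))} : Multiset (QuaternionGroup m)) +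
      2 • ({xa (1 + (m : ZMod (2 * m)))} : Multiset (QuaternionGroup m)) := by
    rw [ct, Multiset.nsmul_singleton, Multiset.nsmul_singleton]
    rfl
  rw [ct_pair] at A1 A1' A2
  rw [e3] at A3
  have n1 : (a 1 : QuaternionGroup m) ≠ 1 := by
    rw [one_def]
    intro h
    have h2 := QuaternionGroup.a.inj h
    exact cast_ne (m := m) (k := 1) (by omega) (by omega) (by simpa using h2)
  have nx : ∀ i, (xa i : QuaternionGroup m) ≠ 1 := by
    intro i h
    rw [one_def] at h
    cases h
  have p1 := pair_atom n1
  have p0 := pair_atom (nx 0)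
  have p2 := pair_atom (nx 1)
  have i1 : (a 1 : QuaternionGroup m)⁻¹ = a (-1) := rfl
  have i0 : (xa 0 : QuaternionGroup m)⁻¹ = xa (m : ZMod (2 * m)) := by
    change xa _ = _; simp
  have i2 : (xa 1 : QuaternionGroup m)⁻¹ = xa (1 + (m : ZMod (2 * m))) := by
    change xa _ = _; rw [add_comm]
  rw [i1] at p1
  rw [i0] at p0
  rw [i2] at p2
  set s1 : Multiset (QuaternionGroup m) := {a 1}
  set s2 : Multiset (QuaternionGroup m) := {a (-1)}
  set t0 : Multiset (QuaternionGroup m) := {xa 0}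
  set tm : Multiset (QuaternionGroup m) := {xa (m : ZMod (2 * m))}
  set t1 : Multiset (QuaternionGroup m) := {xa 1}
  set t1m : Multiset (QuaternionGroup m) := {xa (1 + (m : ZMod (2 * m)))}
  obtain ⟨n, hn⟩ : ∃ n, 3 * m - 2 = n := ⟨_, rfl⟩
  rw [hn] at A1 A1' A2
  set LA : Multiset (Multiset (QuaternionGroup m)) :=
    Multiset.replicate (k + 1) (n • s1 + 2 • t0) + Multiset.replicate k (n • s2 + 2 • tm) +
      Multiset.replicate 1 (n • s2 + 2 • t1) + Multiset.replicate 1 (2 • tm + 2 • t1m) with hLA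
  set LB : Multiset (Multiset (QuaternionGroup m)) :=
    Multiset.replicate (n * (k + 1)) (s1 + s2) + Multiset.replicate (2 * (k + 1)) (t0 + tm) +
      Multiset.replicate 2 (t1 + t1m) with hLB
  have hA : ∀ A ∈ LA, IsMinimalProductOne A := by
    intro A hA
    rw [hLA] at hA
    simp only [Multiset.mem_add] at hA
    rcases hA with ((h | h) | h) | h <;> rw [Multiset.eq_of_mem_replicate h] <;> assumption
  have hB : ∀ A ∈ LB, IsMinimalProductOne A := by
    intro A hA
    rw [hLB] at hA
    simp only [Multiset.mem_add] at hA
    rcases hA with (h | h) | h <;> rw [Multiset.eq_of_mem_replicate h] <;> assumption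
  have hsum : LB.sum = LA.sum := by
    simp only [hLA, hLB, Multiset.sum_add, Multiset.sum_replicate]
    module
  refine ⟨LA.sum, isProductOne_sum _ hA, hasLength_iff.2 ⟨LA, hA, rfl, ?_⟩,
    hasLength_iff.2 ⟨LB, hB, hsum, ?_⟩⟩
  · simp [hLA]; omega
  · simp only [hLB, Multiset.card_add, Multiset.card_replicate]
    have : n + 2 = 3 * m := by omega
    rw [← this]; ring

end Lower

end DicyclicRho

namespace DicyclicRho

open QuaternionGroup

section Counting

theorem sum_zero_all {α : Type*} (g : α → ℕ) (L : Multiset α) (h : (L.map g).sum = 0) :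
    ∀ x ∈ L, g x = 0 := by
  intro x hx
  rw [Multiset.sum_eq_zero_iff] at h
  exact h _ (Multiset.mem_map_of_mem g hx)

theorem sum_one_split {α : Type*} (g : α → ℕ) (L : Multiset α) (h : (L.map g).sum = 1) :
    ∃ x L', L = x ::ₘ L' ∧ g x = 1 ∧ ∀ y ∈ L', g y = 0 := by
  have : ∃ x ∈ L, g x ≠ 0 := by
    by_contra hc
    push Not at hc
    have : (L.map g).sum = 0 := Multiset.sum_eq_zero (by
      intro y hy
      obtain ⟨x, hx, rfl⟩ := Multiset.mem_map.1 hy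
      exact hc x hx)
    omega
  obtain ⟨x, hx, hx0⟩ := this
  obtain ⟨L', rfl⟩ := Multiset.exists_cons_of_mem hx
  rw [Multiset.map_cons, Multiset.sum_cons] at h
  exact ⟨x, L', rfl, by omega, sum_zero_all g L' (by omega)⟩

theorem card_sum {α : Type*} (L : Multiset (Multiset α)) :
    Multiset.card L.sum = (L.map Multiset.card).sum := by
  induction L using Multiset.induction with
  | empty => simp
  | cons A L ih => simp [ih]

theorem count_sum' {α : Type*} [DecidableEq α] (x : α) (L : Multiset (Multiset α)) :
    Multiset.count x L.sum = (L.map (Multiset.count x)).sum := by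
  induction L using Multiset.induction with
  | empty => simp
  | cons A L ih => simp [ih]

/-- The sum of the values of `w` over a sequence. -/
def ws {α Z : Type*} [AddCommMonoid Z] (w : α → Z) (S : Multiset α) : Z := (S.map w).sum

theorem ws_add {α Z : Type*} [AddCommMonoid Z] (w : α → Z) (S T : Multiset α) :
    ws w (S + T) = ws w S + ws w T := by
  simp [ws]

theorem ws_sum_const {α Z : Type*} [AddCommMonoid Z] (w : α → Z) (L : Multiset (Multiset α)) (c : Z)
    (h : ∀ A ∈ L, ws w A = c) : ws w L.sum = Multiset.card L • c := by
  induction L using Multiset.induction with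
  | empty => simp [ws]
  | cons A L ih =>
    rw [Multiset.sum_cons, ws_add, h A (by simp), ih fun B hB => h B (by simp [hB]),
      Multiset.card_cons, succ_nsmul']

theorem ws_sum_zero {α Z : Type*} [AddCommMonoid Z] (w : α → Z) (L : Multiset (Multiset α))
    (h : ∀ A ∈ L, ws w A = 0) : ws w L.sum = 0 := by
  rw [ws_sum_const w L 0 h, smul_zero]

theorem po_two {G : Type*} [Group G] {B : Multiset G} (h : IsProductOne B)
    (hc : Multiset.card B = 2) : ∃ g, B = {g} + {g⁻¹} := by
  obtain ⟨l, rfl, hp⟩ := h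
  simp at hc
  obtain ⟨x, y, rfl⟩ := List.length_eq_two.1 hc
  refine ⟨x, ?_⟩
  simp at hp
  rw [eq_inv_of_mul_eq_one_right hp]
  rfl

theorem ws_pair {G Z : Type*} [Group G] [AddCommGroup Z] {w : G → Z} (hw : ∀ g, w g⁻¹ = - w g)
    {B : Multiset G} (h : IsProductOne B) (hc : Multiset.card B = 2) : ws w B = 0 := by
  obtain ⟨g, rfl⟩ := po_two h hc
  simp [ws, hw]

theorem one_mem_atom {G : Type*} [Group G] {A : Multiset G} (h : IsMinimalProductOne A)
    (h1 : (1 : G) ∈ A) : A = {1} := by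
  obtain ⟨A', rfl⟩ := Multiset.exists_cons_of_mem h1
  by_contra hne
  have hA' : A' ≠ 0 := by rintro rfl; exact hne rfl
  obtain ⟨l, hl, hp⟩ := h.2.1
  have hl1 : (1 : G) ∈ l := by rw [← Multiset.mem_coe, hl]; simp
  obtain ⟨l1, l2, rfl⟩ := List.append_of_mem hl1
  refine h.2.2 {1} A' (by simp) hA' ⟨[1], rfl, by simp⟩ ⟨l1 ++ l2, ?_, ?_⟩ rfl
  · have : (1 : G) ::ₘ ((l1 ++ l2 : List G) : Multiset G) = 1 ::ₘ A' := by
      rw [← hl, Multiset.cons_coe, Multiset.coe_eq_coe]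
      exact List.perm_middle.symm
    exact (Multiset.cons_inj_right _).1 this
  · simpa using hp

/-- The combinatorial reduction: near-extremal pairs of factorizations. -/
theorem reduction {G : Type*} [Group G] [DecidableEq G] {D : ℕ} (hD : 6 ≤ D)
    (hat : ∀ A : Multiset G, IsMinimalProductOne A → Multiset.card A ≤ D)
    {LA LB : Multiset (Multiset G)} (hA : ∀ A ∈ LA, IsMinimalProductOne A)
    (hB : ∀ A ∈ LB, IsMinimalProductOne A) (hs : LA.sum = LB.sum)
    (hr : D * Multiset.card LA ≤ 2 * Multiset.card LB + 1) :
    (1 : G) ∉ LA.sum ∧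
    ((2 * Multiset.card LB = D * Multiset.card LA ∧ (∀ A ∈ LA, Multiset.card A = D) ∧
        ∀ B ∈ LB, Multiset.card B = 2) ∨
     (2 * Multiset.card LB + 1 = D * Multiset.card LA ∧ (∀ A ∈ LA, Multiset.card A = D) ∧
        ∃ B0 L, LB = B0 ::ₘ L ∧ Multiset.card B0 = 3 ∧ ∀ B ∈ L, Multiset.card B = 2) ∨
     (2 * Multiset.card LB + 1 = D * Multiset.card LA ∧ (∀ B ∈ LB, Multiset.card B = 2) ∧
        ∃ A0 L, LA = A0 ::ₘ L ∧ Multiset.card A0 + 1 = D ∧ ∀ A ∈ L, Multiset.card A = D)) := by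
  have key1 : ∀ A : Multiset G, IsMinimalProductOne A → (1 : G) ∈ A →
      Multiset.card A = 1 ∧ Multiset.count 1 A = 1 := by
    intro A hA h1
    rw [one_mem_atom hA h1]; simp
  have hAg : ∀ L : Multiset (Multiset G), (∀ A ∈ L, IsMinimalProductOne A) →
      (L.map (fun A => D - Multiset.card A)).sum + Multiset.card L.sum = D * Multiset.card L ∧
      (D - 1) * Multiset.count 1 L.sum ≤ (L.map (fun A => D - Multiset.card A)).sum := by
    intro L
    induction L using Multiset.induction with
    | empty => simp
    | cons A L ih =>
      intro hL
      obtain ⟨i1, i2⟩ := ih fun B hB => hL B (by simp [hB])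
      have hA := hL A (by simp)
      have := hat A hA
      simp only [Multiset.map_cons, Multiset.sum_cons, Multiset.card_add, Multiset.card_cons,
        Multiset.count_add, mul_add]
      refine ⟨by omega, ?_⟩
      by_cases h1 : (1 : G) ∈ A
      · obtain ⟨k1, k2⟩ := key1 A hA h1
        rw [k1, k2]; omega
      · rw [Multiset.count_eq_zero_of_notMem h1]; omega
  have hBg : ∀ L : Multiset (Multiset G), (∀ A ∈ L, IsMinimalProductOne A) →
      (L.map (fun A => Multiset.card A - 2)).sum + 2 * Multiset.card L ≤
      Multiset.card L.sum + Multiset.count 1 L.sum := by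
    intro L
    induction L using Multiset.induction with
    | empty => simp
    | cons A L ih =>
      intro hL
      have i1 := ih fun B hB => hL B (by simp [hB])
      have hA := hL A (by simp)
      simp only [Multiset.map_cons, Multiset.sum_cons, Multiset.card_add, Multiset.card_cons,
        Multiset.count_add, mul_add]
      have hc : 2 ≤ Multiset.card A + Multiset.count 1 A := by
        by_cases h1 : (1 : G) ∈ A
        · obtain ⟨k1, k2⟩ := key1 A hA h1
          omega
        · have := Multiset.card_pos.2 hA.1
          by_contra hlt
          obtain ⟨t, rfl⟩ := Multiset.card_eq_one.1 (show Multiset.card A = 1 by omega)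
          have := po_singleton hA.2.1
          subst this
          simp at h1
      by_cases h2 : 2 ≤ Multiset.card A
      · omega
      · omega
  obtain ⟨a1, a2⟩ := hAg LA hA
  have b1 := hBg LB hB
  rw [← hs] at b1
  have hcount : Multiset.count (1 : G) LA.sum = 0 := by
    by_contra h0
    obtain ⟨c, hc⟩ := Nat.exists_eq_add_of_lt (show 1 < D by omega)
    have hD1 : D - 1 = (D - 3) + 2 := by omega
    have hD2 : D - 3 = (D - 6) + 3 := by omega
    rw [hD1, hD2] at a2
    have : (D - 6) * Multiset.count (1 : G) LA.sum ≥ 0 := Nat.zero_le _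
    have h5 : 5 * Multiset.count (1 : G) LA.sum ≤ (LA.map (fun A => D - Multiset.card A)).sum := by
      refine le_trans ?_ a2
      exact Nat.mul_le_mul_right _ (by omega)
    omega
  rw [hcount] at b1
  have n1 : (1 : G) ∉ LA.sum := Multiset.count_eq_zero.1 hcount
  have nB : ∀ B ∈ LB, 2 ≤ Multiset.card B := by
    intro B hBm
    have hBa := hB B hBm
    have := Multiset.card_pos.2 hBa.1
    by_contra hlt
    obtain ⟨t, rfl⟩ := Multiset.card_eq_one.1 (show Multiset.card B = 1 by omega)
    have := po_singleton hBa.2.1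
    subst this
    refine n1 ?_
    rw [hs]
    exact Multiset.mem_of_le (Multiset.le_sum_of_mem hBm) (by simp)
  refine ⟨n1, ?_⟩
  have b2 : (LB.map (fun A => Multiset.card A - 2)).sum + 2 * Multiset.card LB =
      Multiset.card LB.sum := by
    clear b1 a1 a2 hr hs hB
    induction LB using Multiset.induction with
    | empty => simp
    | cons A L ih =>
      have := ih fun B hB => nB B (by simp [hB])
      have := nB A (by simp)
      simp only [Multiset.map_cons, Multiset.sum_cons, Multiset.card_add, Multiset.card_cons]
      omega
  rw [← hs] at b2
  rcases Nat.eq_zero_or_pos (LA.map (fun A => D - Multiset.card A)).sum with hA0 | hA0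
  · have hAall : ∀ A ∈ LA, Multiset.card A = D := by
      intro A hAm
      have := sum_zero_all _ _ hA0 A hAm
      have := hat A (hA A hAm)
      omega
    rcases Nat.eq_zero_or_pos (LB.map (fun A => Multiset.card A - 2)).sum with hB0 | hB0
    · left
      refine ⟨by omega, hAall, fun B hBm => ?_⟩
      have := sum_zero_all _ _ hB0 B hBm
      have := nB B hBm
      omega
    · right; left
      refine ⟨by omega, hAall, ?_⟩
      obtain ⟨B0, L, rfl, h1, h2⟩ := sum_one_split (fun A => Multiset.card A - 2) LB (by omega)
      refine ⟨B0, L, rfl, by omega, fun B hBm => ?_⟩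
      have := h2 B hBm
      have := nB B (by simp [hBm])
      omega
  · right; right
    refine ⟨by omega, fun B hBm => ?_, ?_⟩
    · have := sum_zero_all (fun A => Multiset.card A - 2) LB (by omega) B hBm
      have := nB B hBm
      omega
    · obtain ⟨A0, L, rfl, h1, h2⟩ := sum_one_split (fun A => D - Multiset.card A) LA (by omega)
      refine ⟨A0, L, rfl, by omega, fun A hAm => ?_⟩
      have := h2 A hAm
      have := hat A (hA A (by simp [hAm]))
      omega

end Counting

end DicyclicRho

namespace DicyclicRho

open QuaternionGroup

section Functionals

variable {m : ℕ}

/-- Combine functions on the two cosets of the cyclic subgroup. -/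
def wf {Z : Type*} (f g : ZMod (2 * m) → Z) : QuaternionGroup m → Z
  | a i => f i
  | xa i => g i

theorem ws_ct {Z : Type*} [AddCommMonoid Z] (f g : ZMod (2 * m) → Z)
    (R T : Multiset (ZMod (2 * m))) : ws (wf f g) (ct R T) = ws f R + ws g T := by
  simp only [ws, ct, Multiset.map_add, Multiset.map_map, Multiset.sum_add]
  rfl

theorem wf_inv {Z : Type*} [AddCommGroup Z] {f g : ZMod (2 * m) → Z} (hf : ∀ i, f (-i) = - f i)
    (hg : ∀ i, g ((m : ZMod (2 * m)) + i) = - g i) (h : QuaternionGroup m) :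
    wf f g h⁻¹ = - wf f g h := by
  cases h with
  | a i => exact hf i
  | xa i => exact hg i

theorem m_ne [NeZero m] : (m : ZMod (2 * m)) ≠ 0 := by
  have := NeZero.pos m
  exact cast_ne (by omega) (by omega)

theorem m_add_m : (m : ZMod (2 * m)) + m = 0 := by
  rw [← two_mul]; exact two_m

/-- The sign functional on the non-cyclic coset. -/
def gs (i : ZMod (2 * m)) : ZMod 4 := if i.val < m then 1 else -1

theorem gs_shift [NeZero m] (i : ZMod (2 * m)) : gs ((m : ZMod (2 * m)) + i) = - gs i := by
  have hm := NeZero.pos m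
  have : NeZero (2 * m) := ⟨by omega⟩
  have hi := ZMod.val_lt i
  have e : ((m : ZMod (2 * m)) + i).val = (m + i.val) % (2 * m) := by
    rw [ZMod.val_add, ZMod.val_natCast, Nat.mod_eq_of_lt (show m < 2 * m by omega)]
  unfold gs
  rw [e]
  by_cases h : i.val < m
  · rw [Nat.mod_eq_of_lt (by omega)]
    simp [h]
  · have : (m + i.val) % (2 * m) = i.val - m := by
      rw [Nat.mod_eq_sub_mod (by omega), Nat.mod_eq_of_lt (by omega)]
      omega
    rw [this, if_pos (by omega), if_neg h]
    simp

theorem gs_two (i : ZMod (2 * m)) : gs i + gs i = 2 := by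
  unfold gs
  split <;> decide

/-- The functional to `ZMod 2` detecting `x` and `m + x`. -/
def gx (x i : ZMod (2 * m)) : ZMod 2 :=
  (if i = x then 1 else 0) + (if i = (m : ZMod (2 * m)) + x then 1 else 0)

theorem gx_shift (x i : ZMod (2 * m)) : gx x ((m : ZMod (2 * m)) + i) = - gx x i := by
  have h1 : (m : ZMod (2 * m)) + i = x ↔ i = (m : ZMod (2 * m)) + x := by
    constructor
    · rintro rfl; rw [← add_assoc, m_add_m, zero_add]
    · rintro rfl; rw [← add_assoc, m_add_m, zero_add]
  unfold gx
  simp only [h1, add_right_inj]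
  rw [CharTwo.neg_eq, add_comm]

theorem gx_self [NeZero m] (x : ZMod (2 * m)) : gx x x = 1 := by
  unfold gx
  rw [if_pos rfl, if_neg]
  · simp
  · intro h
    exact m_ne (m := m) (by linear_combination -h)

theorem gx_ne {x y : ZMod (2 * m)} (h : gx x y ≠ 0) : y = x ∨ y = (m : ZMod (2 * m)) + x := by
  by_contra hc
  push Not at hc
  exact h (by simp [gx, hc])

/-- The extremal atoms. -/
def Ext (A : Multiset (QuaternionGroup m)) : Prop :=
  ∃ g x : ZMod (2 * m), A = ct (Multiset.replicate (3 * m - 2) g) {x, x} ∧ 2 * g ≠ 0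

theorem ext_of (hm : 3 ≤ m) {A : Multiset (QuaternionGroup m)} (hA : IsMinimalProductOne A)
    (hc : Multiset.card A = 3 * m) : Ext A := by
  obtain ⟨R, T, rfl⟩ := exists_ct A
  rw [card_ct] at hc
  obtain ⟨g, x, rfl, rfl, h⟩ := F2 hm hA hc
  exact ⟨g, x, rfl, h⟩

theorem ext_gs {A : Multiset (QuaternionGroup m)} (h : Ext A) :
    ws (wf (fun _ => 0) gs) A = 2 := by
  obtain ⟨g, x, rfl, h⟩ := h
  rw [ws_ct]
  simp [ws, gs_two]

theorem ext_gx {A : Multiset (QuaternionGroup m)} (h : Ext A) (x : ZMod (2 * m)) :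
    ws (wf (fun _ => 0) (gx x)) A = 0 := by
  obtain ⟨g, y, rfl, h⟩ := h
  rw [ws_ct]
  simp [ws, CharTwo.add_self_eq_zero]

theorem ext_no_m {A : Multiset (QuaternionGroup m)} (h : Ext A) :
    a (m : ZMod (2 * m)) ∉ A := by
  obtain ⟨g, y, rfl, h⟩ := h
  intro hm
  simp only [ct, Multiset.mem_add, Multiset.mem_map] at hm
  rcases hm with ⟨z, hz, hz'⟩ | ⟨z, hz, hz'⟩
  · rw [Multiset.eq_of_mem_replicate hz] at hz'
    have := QuaternionGroup.a.inj hz'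
    exact h (by rw [this]; exact two_m)
  · cases hz'

theorem odd_smul_two {N : ℕ} (h : N % 2 = 1) : N • (2 : ZMod 4) = 2 := by
  obtain ⟨k, rfl⟩ : ∃ k, N = 2 * k + 1 := ⟨N / 2, by omega⟩
  rw [add_smul, mul_comm, mul_smul]
  have : (2 : ℕ) • (2 : ZMod 4) = 0 := by decide
  rw [this]; simp

theorem case00 [NeZero m] {LA LB : Multiset (Multiset (QuaternionGroup m))}
    (hN : Multiset.card LA % 2 = 1)
    (hA : ∀ A ∈ LA, Ext A) (hB : ∀ B ∈ LB, IsProductOne B)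
    (hB2 : ∀ B ∈ LB, Multiset.card B = 2) (hs : LA.sum = LB.sum) : False := by
  have h1 := ws_sum_const (wf (fun _ => 0) gs) LA 2 (fun A h => ext_gs (hA A h))
  have h2 := ws_sum_zero (wf (fun _ => 0) gs) LB
    (fun B h => ws_pair (wf_inv (by simp) gs_shift) (hB B h) (hB2 B h))
  rw [odd_smul_two hN, hs, h2] at h1
  exact absurd h1 (by decide)

theorem mem_msum {α : Type*} {x : α} {L : Multiset (Multiset α)} (h : x ∈ L.sum) :
    ∃ A ∈ L, x ∈ A := by
  induction L using Multiset.induction with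
  | empty => simp at h
  | cons A L ih =>
    rw [Multiset.sum_cons, Multiset.mem_add] at h
    rcases h with h | h
    · exact ⟨A, by simp, h⟩
    · obtain ⟨B, hB, hx⟩ := ih h
      exact ⟨B, by simp [hB], hx⟩

theorem case01 [NeZero m] {LA L : Multiset (Multiset (QuaternionGroup m))}
    {B0 : Multiset (QuaternionGroup m)}
    (hN : Multiset.card LA % 2 = 1)
    (hA : ∀ A ∈ LA, Ext A) (hB0 : IsProductOne B0) (hc0 : Multiset.card B0 = 3)
    (hB : ∀ B ∈ L, IsProductOne B)
    (hB2 : ∀ B ∈ L, Multiset.card B = 2) (hs : LA.sum = B0 + L.sum) : False := by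
  have h1 := ws_sum_const (wf (fun _ => 0) gs) LA 2 (fun A h => ext_gs (hA A h))
  have h2 := ws_sum_zero (wf (fun _ => 0) gs) L
    (fun B h => ws_pair (wf_inv (by simp) gs_shift) (hB B h) (hB2 B h))
  rw [odd_smul_two hN, hs, ws_add, h2, add_zero] at h1
  obtain ⟨R, T, rfl⟩ := exists_ct B0
  obtain ⟨n, hn⟩ := po_card hB0
  rw [card_ct] at hc0
  rw [ws_ct] at h1
  have hR0 : ws (fun _ => (0 : ZMod 4)) R = 0 := by simp [ws]
  rw [hR0, zero_add] at h1
  rcases (show n = 0 ∨ n = 1 by omega) with rfl | rfl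
  · rw [mul_zero, Multiset.card_eq_zero] at hn
    subst hn
    exact absurd h1 (by simp [ws]; decide)
  · obtain ⟨x, y, rfl⟩ := Multiset.card_eq_two.1 hn
    obtain ⟨z, rfl⟩ := Multiset.card_eq_one.1 (show Multiset.card R = 1 by omega)
    have h3 := ws_sum_zero (wf (fun _ => 0) (gx x)) LA (fun A h => ext_gx (hA A h) x)
    have h4 := ws_sum_zero (wf (fun _ => 0) (gx x)) L
      (fun B h => ws_pair (wf_inv (by simp) (gx_shift x)) (hB B h) (hB2 B h))
    rw [hs, ws_add, h4, add_zero, ws_ct] at h3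
    simp only [ws, Multiset.insert_eq_cons, Multiset.map_cons, Multiset.map_singleton,
      Multiset.sum_cons, Multiset.sum_singleton, gx_self, zero_add] at h3 h1
    have h5 : gx x y ≠ 0 := by
      intro h; rw [h] at h3; simp at h3
    rcases gx_ne h5 with rfl | rfl
    · obtain ⟨R1, R2, X1, X2, hR, hX, hc, he⟩ := po_form hB0
      have hc2 := congrArg Multiset.card hX
      simp at hc2
      obtain ⟨x1, rfl⟩ := Multiset.card_eq_one.1 (show Multiset.card X1 = 1 by omega)
      obtain ⟨x2, rfl⟩ := Multiset.card_eq_one.1 (show Multiset.card X2 = 1 by omega)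
      have hx1 : x1 ∈ ({y, y} : Multiset (ZMod (2 * m))) := by rw [hX]; simp
      have hx2 : x2 ∈ ({y, y} : Multiset (ZMod (2 * m))) := by rw [hX]; simp
      simp at hx1 hx2
      subst hx1 hx2
      have hzm : z = (m : ZMod (2 * m)) := by
        have hcR := congrArg Multiset.card hR
        simp at hcR
        rcases (show Multiset.card R1 = 0 ∨ Multiset.card R2 = 0 by omega) with h0 | h0
        · rw [Multiset.card_eq_zero] at h0
          subst h0
          rw [zero_add] at hR
          rw [← hR] at he
          simp at he
          linear_combination -he
        · rw [Multiset.card_eq_zero] at h0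
          subst h0
          rw [add_zero] at hR
          rw [← hR] at he
          simp at he
          linear_combination he - (@two_m m)
      subst hzm
      have hmem : a (m : ZMod (2 * m)) ∈ LA.sum := by
        rw [hs]; simp [ct]
      replace hmem := mem_msum hmem
      obtain ⟨A, hAm, hAa⟩ := hmem
      exact ext_no_m (hA A hAm) hAa
    · rw [gs_shift, add_neg_cancel] at h1
      exact absurd h1 (by decide)

theorem sum_sym [NeZero m] {R : Multiset (ZMod (2 * m))}
    (h : ∀ g : ZMod (2 * m), 2 * g ≠ 0 → R.count g = R.count (-g))
    (hm : ((R.count (m : ZMod (2 * m)) : ℕ) : ZMod 2) = 0) : R.sum = 0 := by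
  have : NeZero (2 * m) := ⟨by have := NeZero.pos m; omega⟩
  rw [Finset.sum_multiset_count_of_subset R Finset.univ (Finset.subset_univ _)]
  refine Finset.sum_involution (fun g _ => -g) ?_ ?_ ?_ ?_
  · intro g _
    by_cases hg : 2 * g = 0
    · have hn : -g = g := by linear_combination -hg
      rw [hn]
      rcases eq_zero_or_m hg with rfl | rfl
      · simp
      · rw [← smul_add, m_add_m, smul_zero]
    · rw [← h g hg]; simp
  · intro g _ hne hg
    have hg2 : 2 * g = 0 := by linear_combination -hg
    rcases eq_zero_or_m hg2 with rfl | rfl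
    · simp at hne
    · rw [ZMod.natCast_eq_zero_iff] at hm
      obtain ⟨c, hc⟩ := hm
      apply hne
      rw [hc, mul_comm 2 c, mul_smul, two_nsmul]
      have h2 : (m : ZMod (2 * m)) + (m : ZMod (2 * m)) = 0 := m_add_m
      exact (congrArg (fun z => c • z) h2).trans (smul_zero c)
  · simp
  · simp

theorem ws_singleton {α Z : Type*} [AddCommMonoid Z] (w : α → Z) (x : α) :
    ws w {x} = w x := by
  simp [ws]

theorem ws_cons {α Z : Type*} [AddCommMonoid Z] (w : α → Z) (x : α) (S : Multiset α) :
    ws w (x ::ₘ S) = w x + ws w S := by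
  simp [ws]

theorem decomp [NeZero m] (n : ℕ) : ∀ T : Multiset (ZMod (2 * m)), Multiset.card T ≤ n →
    (∀ x, ws (gx x) T = 0) →
    ∃ U1 U2, T = U1 + U1 + (U2 + U2.map (fun x => (m : ZMod (2 * m)) + x)) := by
  induction n with
  | zero =>
    intro T h _
    have : T = 0 := by rw [← Multiset.card_eq_zero]; omega
    exact ⟨0, 0, by simp [this]⟩
  | succ n ih =>
    intro T hc hT
    by_cases h0 : T = 0
    · exact ⟨0, 0, by simp [h0]⟩
    obtain ⟨x, hx⟩ := Multiset.exists_mem_of_ne_zero h0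
    obtain ⟨T', rfl⟩ := Multiset.exists_cons_of_mem hx
    have hex : ∃ y ∈ T', gx x y ≠ 0 := by
      by_contra hcon
      push Not at hcon
      have h1 := hT x
      rw [ws_cons, gx_self] at h1
      have : ws (gx x) T' = 0 := Multiset.sum_eq_zero (by
        intro z hz
        obtain ⟨y, hy, rfl⟩ := Multiset.mem_map.1 hz
        exact hcon y hy)
      rw [this] at h1
      simp at h1
    obtain ⟨y, hy, hy0⟩ := hex
    obtain ⟨T'', rfl⟩ := Multiset.exists_cons_of_mem hy
    simp only [Multiset.card_cons] at hc
    simp only [ws_cons] at hT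
    rcases gx_ne hy0 with rfl | rfl
    · obtain ⟨U1, U2, rfl⟩ := ih T'' (by omega) (by
        intro z
        have := hT z
        rwa [← add_assoc, CharTwo.add_self_eq_zero, zero_add] at this)
      refine ⟨y ::ₘ U1, U2, ?_⟩
      simp only [← Multiset.singleton_add]; abel
    · obtain ⟨U1, U2, rfl⟩ := ih T'' (by omega) (by
        intro z
        have := hT z
        rwa [gx_shift, add_neg_cancel_left] at this)
      refine ⟨U1, x ::ₘ U2, ?_⟩
      simp only [← Multiset.singleton_add, Multiset.map_add, Multiset.map_singleton]; abel

theorem sum_shift (U : Multiset (ZMod (2 * m))) :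
    (U.map (fun x => (m : ZMod (2 * m)) + x)).sum =
      ((Multiset.card U : ℕ) : ZMod (2 * m)) * m + U.sum := by
  induction U using Multiset.induction with
  | empty => simp
  | cons x U ih => simp [ih]; ring

theorem po_sym {U1 U2 : Multiset (ZMod (2 * m))} (h : Even (Multiset.card U1))
    (h0 : U1 + U2 ≠ 0) :
    IsProductOne (ct 0 (U1 + U1 + (U2 + U2.map (fun x => (m : ZMod (2 * m)) + x)))) := by
  obtain ⟨c, hc⟩ := h
  have := po_of_form (m := m) (R1 := 0) (R2 := 0) (X1 := U1 + U2)
    (X2 := U1 + U2.map (fun x => (m : ZMod (2 * m)) + x)) (by simp) (by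
      intro h
      apply h0
      rw [← Multiset.card_eq_zero] at h ⊢
      simpa using h) (by
      simp only [Multiset.sum_add, sum_shift, Multiset.card_add, Multiset.card_map, hc]
      push_cast
      simp
      linear_combination (c : ZMod (2 * m)) * (@two_m m))
  have e : U1 + U1 + (U2 + U2.map (fun x => (m : ZMod (2 * m)) + x)) =
      U1 + U2 + (U1 + U2.map (fun x => (m : ZMod (2 * m)) + x)) := by abel
  rw [e]
  rwa [add_zero] at this

theorem even_U1 (hodd : m % 2 = 1) {R U1 U2 : Multiset (ZMod (2 * m))} (hR : R.sum = 0)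
    (h : IsProductOne (ct R (U1 + U1 + (U2 + U2.map (fun x => (m : ZMod (2 * m)) + x))))) :
    Even (Multiset.card U1) := by
  obtain ⟨R1, R2, X1, X2, rfl, hT, hc, he⟩ := po_form h
  have h1 := congrArg Multiset.card hT
  have h2 := congrArg Multiset.sum hT
  simp only [Multiset.card_add, Multiset.card_map, Multiset.sum_add, sum_shift] at h1 h2
  have h3 : Multiset.card X2 = Multiset.card U1 + Multiset.card U2 := by omega
  rw [h3] at he
  rw [Multiset.sum_add] at hR
  push_cast at he
  have h4 : ((Multiset.card U1 * m : ℕ) : ZMod (2 * m)) =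
      2 * (R2.sum + X2.sum - U1.sum - U2.sum) := by
    push_cast
    linear_combination he - hR + h2 - ((Multiset.card U2 : ℕ) : ZMod (2 * m)) * (@two_m m)
  have h5 := congrArg (ZMod.castHom (Dvd.intro m rfl : 2 ∣ 2 * m) (ZMod 2)) h4
  rw [map_natCast, map_mul] at h5
  have h6 : (ZMod.castHom (Dvd.intro m rfl : 2 ∣ 2 * m) (ZMod 2)) 2 = 0 := by
    rw [map_ofNat]; rfl
  rw [h6, zero_mul, ZMod.natCast_eq_zero_iff] at h5
  rcases (Nat.Prime.dvd_mul Nat.prime_two).1 h5 with h7 | h7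
  · exact even_iff_two_dvd.2 h7
  · omega

theorem case10 (hm : 3 ≤ m) (hodd : m % 2 = 1)
    {LB L : Multiset (Multiset (QuaternionGroup m))} {A0 : Multiset (QuaternionGroup m)}
    (hA0 : IsMinimalProductOne A0) (hc0 : Multiset.card A0 + 1 = 3 * m)
    (hA : ∀ A ∈ L, Ext A) (hB : ∀ B ∈ LB, IsProductOne B)
    (hB2 : ∀ B ∈ LB, Multiset.card B = 2) (hs : A0 + L.sum = LB.sum) : False := by
  have : NeZero m := ⟨by omega⟩
  have : NeZero (2 * m) := ⟨by omega⟩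
  -- every odd functional vanishing on the extremal atoms vanishes on `A0`
  have key : ∀ {Z : Type} [AddCommGroup Z] (f g : ZMod (2 * m) → Z), (∀ i, f (-i) = - f i) →
      (∀ i, g ((m : ZMod (2 * m)) + i) = - g i) → (∀ A ∈ L, ws (wf f g) A = 0) →
      ws (wf f g) A0 = 0 := by
    intro Z _ f g hf hg h
    have h1 := ws_sum_zero (wf f g) LB
      (fun B h => ws_pair (wf_inv hf hg) (hB B h) (hB2 B h))
    rw [← hs, ws_add, ws_sum_zero (wf f g) L h, add_zero] at h1
    exact h1
  obtain ⟨R, T, rfl⟩ := exists_ct A0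
  rw [card_ct] at hc0
  obtain ⟨n, hn⟩ := po_card hA0.2.1
  have hT0 : T ≠ 0 := by
    rintro rfl
    have := rot_atom_card hA0
    simp at hc0
    omega
  have hTc := Multiset.card_pos.2 hT0
  -- the rotation part sums to zero
  have hR : R.sum = 0 := by
    apply sum_sym
    · intro g hg
      set f : ZMod (2 * m) → ZMod (3 * m - 2) :=
        fun i => (if i = g then 1 else 0) - (if i = -g then 1 else 0) with hf
      have h1 := key f (fun _ => 0) (by
        intro i
        simp only [hf, neg_eq_iff_eq_neg]
        ring) (by simp) (by
        intro A hAm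
        obtain ⟨g', x, rfl, _⟩ := hA A hAm
        rw [ws_ct]
        simp [ws])
      rw [ws_ct] at h1
      have h2 : ∀ S : Multiset (ZMod (2 * m)),
          ws f S = ((S.count g : ℕ) : ZMod (3 * m - 2)) - ((S.count (-g) : ℕ) : ZMod (3 * m - 2)) := by
        intro S
        induction S using Multiset.induction with
        | empty => simp [ws]
        | cons x S ih =>
          rw [ws_cons, ih, Multiset.count_cons, Multiset.count_cons, hf]
          simp only [eq_comm (a := x)]
          push_cast
          ring
      rw [h2] at h1
      simp [ws] at h1
      rw [sub_eq_zero, ZMod.natCast_eq_natCast_iff'] at h1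
      have c1 := Multiset.count_le_card g R
      have c2 := Multiset.count_le_card (-g) R
      rwa [Nat.mod_eq_of_lt (by omega), Nat.mod_eq_of_lt (by omega)] at h1
    · set f : ZMod (2 * m) → ZMod 2 := fun i => if i = (m : ZMod (2 * m)) then 1 else 0 with hf
      have h1 := key f (fun _ => 0) (by
        intro i
        simp only [hf, neg_eq_iff_eq_neg, neg_m]
        exact (CharTwo.neg_eq _).symm) (by simp) (by
        intro A hAm
        obtain ⟨g', x, rfl, hg'⟩ := hA A hAm
        rw [ws_ct]
        have : g' ≠ (m : ZMod (2 * m)) := by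
          rintro rfl; exact hg' two_m
        simp [ws, hf, this])
      rw [ws_ct] at h1
      have h2 : ∀ S : Multiset (ZMod (2 * m)),
          ws f S = ((S.count (m : ZMod (2 * m)) : ℕ) : ZMod 2) := by
        intro S
        induction S using Multiset.induction with
        | empty => simp [ws]
        | cons x S ih =>
          rw [ws_cons, ih, Multiset.count_cons, hf]
          simp only [eq_comm (a := x)]
          push_cast
          ring
      rw [h2] at h1
      simpa [ws] using h1
  -- the other part is symmetric
  obtain ⟨U1, U2, rfl⟩ := decomp _ T le_rfl (by
    intro x
    have h1 := key (fun _ => 0) (gx x) (by simp) (gx_shift x) (fun A h => ext_gx (hA A h) x)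
    rw [ws_ct] at h1
    simpa [ws] using h1)
  have hev := even_U1 hodd hR hA0.2.1
  by_cases hR0 : R = 0
  · subst hR0
    simp only [Multiset.card_add, Multiset.card_map, Multiset.card_zero] at hc0
    by_cases hU2 : U2 = 0
    · subst hU2
      simp only [Multiset.card_zero] at hc0
      have hU1c : 4 ≤ Multiset.card U1 := by omega
      obtain ⟨x, hx⟩ := Multiset.card_pos_iff_exists_mem.1 (show 0 < Multiset.card U1 by omega)
      obtain ⟨V, rfl⟩ := Multiset.exists_cons_of_mem hx
      simp only [Multiset.card_cons] at hU1c hev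
      obtain ⟨y, hy⟩ := Multiset.card_pos_iff_exists_mem.1 (show 0 < Multiset.card V by omega)
      obtain ⟨V, rfl⟩ := Multiset.exists_cons_of_mem hy
      simp only [Multiset.card_cons] at hU1c hev
      have q1 := po_sym (m := m) (U1 := {x, y}) (U2 := 0) (by simp) (by simp)
      have q2 := po_sym (m := m) (U1 := V) (U2 := 0) (by
        rw [Nat.even_iff] at hev ⊢; omega) (by
        intro h
        rw [add_zero] at h
        rw [h] at hU1c
        simp at hU1c)
      refine hA0.2.2 _ _ ?_ ?_ q1 q2 ?_
      · intro h
        have := congrArg Multiset.card h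
        simp [card_ct] at this
      · intro h
        have := congrArg Multiset.card h
        simp [card_ct] at this
        rw [this] at hU1c
        simp at hU1c
      · rw [← ct_add]
        congr 1
        simp only [Multiset.insert_eq_cons, ← Multiset.singleton_add, Multiset.map_zero]
        abel
    · obtain ⟨x, hx⟩ := Multiset.exists_mem_of_ne_zero hU2
      obtain ⟨V, rfl⟩ := Multiset.exists_cons_of_mem hx
      simp only [Multiset.card_cons] at hc0
      have hne : U1 + V ≠ 0 := by
        intro h
        have := congrArg Multiset.card h
        simp only [Multiset.card_add, Multiset.card_zero] at this
        omega
      have q1 := po_sym (m := m) (U1 := 0) (U2 := {x}) (by simp) (by simp)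
      have q2 := po_sym (m := m) (U1 := U1) (U2 := V) hev hne
      refine hA0.2.2 _ _ ?_ ?_ q1 q2 ?_
      · intro h
        have := congrArg Multiset.card h
        simp [card_ct] at this
      · intro h
        have := congrArg Multiset.card h
        simp only [card_ct, Multiset.card_add, Multiset.card_map, Multiset.card_zero] at this
        omega
      · rw [← ct_add]
        congr 1
        simp only [← Multiset.singleton_add, Multiset.map_add, Multiset.map_singleton]
        abel
  · refine hA0.2.2 (ct R 0) _ ?_ ?_ (po_rot hR) (po_sym (U2 := U2) hev ?_) ?_
    · intro h
      have := congrArg Multiset.card h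
      rw [card_ct] at this
      simp at this
      exact hR0 this
    · intro h
      have := congrArg Multiset.card h
      rw [card_ct] at this
      simp only [Multiset.card_zero] at this
      omega
    · intro h
      have := congrArg Multiset.card h
      simp only [Multiset.card_add, Multiset.card_map, Multiset.card_zero] at this hTc
      omega
    · rw [← ct_add, add_zero, zero_add]

end Functionals

end DicyclicRho

namespace DicyclicRho

open QuaternionGroup

/-- The functional on the quaternion group of order eight. -/
def w8 (g : Q8) : ZMod 4 :=
  if g ∈ [(a 1 : Q8), xa 0, xa 1] then 1 else if g ∈ [(a 3 : Q8), xa 2, xa 3] then -1 else 0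

theorem w8_inv : ∀ g : Q8, w8 g⁻¹ = - w8 g := by decide +kernel

theorem w8_two : ∀ g h : Q8, g * h ≠ h * g →
    w8 g + (w8 g + (w8 g + (w8 g + (w8 h + w8 h)))) = 2 := by
  decide +kernel

theorem case8 {LA LB : Multiset (Multiset Q8)}
    (hN : Multiset.card LA % 2 = 1)
    (hA : ∀ A ∈ LA, IsMinimalProductOne A) (hA6 : ∀ A ∈ LA, Multiset.card A = 6)
    (hB : ∀ B ∈ LB, IsProductOne B)
    (hB2 : ∀ B ∈ LB, Multiset.card B = 2) (hs : LA.sum = LB.sum) : False := by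
  have h1 := ws_sum_const w8 LA 2 (fun A h => by
    obtain ⟨x, y, hxy, rfl⟩ := q8_struct (hA A h) (hA6 A h).ge
    have := w8_two x y hxy
    simpa only [ws, Multiset.insert_eq_cons, Multiset.map_cons, Multiset.map_singleton,
      Multiset.sum_cons, Multiset.sum_singleton] using this)
  have h2 := ws_sum_zero w8 LB (fun B h => ws_pair w8_inv (hB B h) (hB2 B h))
  rw [odd_smul_two hN, hs, h2] at h1
  exact absurd h1 (by decide)

theorem atom_card {m : ℕ} (hm : 2 ≤ m) (S : Multiset (QuaternionGroup m))
    (h : IsMinimalProductOne S) : Multiset.card S ≤ 3 * m := by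
  rcases hm.eq_or_lt with rfl | hm
  · by_contra hc
    obtain ⟨x, y, hxy, rfl⟩ := q8_struct h (by omega)
    simp at hc
  · obtain ⟨R, T, rfl⟩ := exists_ct S
    rw [card_ct]
    exact (F1 hm h).1

theorem upper {m : ℕ} (hm : 2 ≤ m) (k r : ℕ) (hk : 1 ≤ k)
    (hr : r ∈ UnionLengths (QuaternionGroup m) (2 * k + 1)) :
    r ≤ (2 * k + 1) * (3 * m) / 2 - 1 := by
  have : NeZero m := ⟨by omega⟩
  obtain ⟨M, _, hM1, hM2⟩ := hr
  obtain ⟨LA, hA, hAs, hAc⟩ := hasLength_iff.1 hM1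
  obtain ⟨LB, hB, hBs, hBc⟩ := hasLength_iff.1 hM2
  have hs : LA.sum = LB.sum := hAs.trans hBs.symm
  by_contra hcon
  have hD : 3 * m * Multiset.card LA ≤ 2 * Multiset.card LB + 1 := by
    rw [hAc, hBc, mul_comm]; omega
  have hN : Multiset.card LA % 2 = 1 := by omega
  have hred := (reduction (by omega) (atom_card hm) hA hB hs hD).2
  rcases hm.eq_or_lt with rfl | hm3
  · have hp : ∃ c, 3 * 2 * Multiset.card LA = 2 * c := ⟨3 * Multiset.card LA, by ring⟩
    rcases hred with ⟨_, h1, h2⟩ | ⟨h, _⟩ | ⟨h, _⟩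
    · exact case8 hN hA h1 (fun B h => (hB B h).2.1) h2 hs
    · omega
    · omega
  · rcases hred with ⟨_, h1, h2⟩ | ⟨_, h1, B0, L, rfl, h3, h4⟩ | ⟨h, h2, A0, L, rfl, h3, h4⟩
    · exact case00 hN (fun A h => ext_of hm3 (hA A h) (h1 A h)) (fun B h => (hB B h).2.1) h2 hs
    · rw [Multiset.sum_cons] at hs
      exact case01 hN (fun A h => ext_of hm3 (hA A h) (h1 A h)) (hB B0 (by simp)).2.1 h3
        (fun B h => (hB B (by simp [h])).2.1) h4 hs
    · have hodd : m % 2 = 1 := by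
        by_contra he
        obtain ⟨c, hc⟩ : ∃ c, m = 2 * c := ⟨m / 2, by omega⟩
        generalize Multiset.card (A0 ::ₘ L) = u at h
        generalize Multiset.card LB = v at h
        have h5 : 3 * m * u = 2 * (3 * c * u) := by rw [hc]; ring
        omega
      rw [Multiset.sum_cons] at hs
      exact case10 hm3 hodd (hA A0 (by simp)) h3
        (fun A h => ext_of hm3 (hA A (by simp [h])) (h4 A h)) (fun B h => (hB B h).2.1) h2 hs

theorem davenport_eq {m : ℕ} (hm : 2 ≤ m) : DavenportLarge (QuaternionGroup m) = 3 * m := by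
  refine IsGreatest.csSup_eq ⟨?_, ?_⟩
  · refine ⟨_, long_atom hm (g := 1) (x := 0) ?_, ?_⟩
    · intro k h0 h1; rw [mul_one]; exact cast_ne h0 h1
    · rw [card_ct]; simp; omega
  · rintro n ⟨S, hS, rfl⟩
    exact atom_card hm S hS

end DicyclicRho

theorem rho_odd_bounds_dicyclic
    (m : ℕ) (hm : 2 ≤ m)
    (G : Type*) [Group G] (hG : Nonempty (G ≃* QuaternionGroup m))
    (k : ℕ) (hk : 1 ≤ k) :
    k * DavenportLarge G + 2 ≤ rhoK G (2 * k + 1) ∧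
      rhoK G (2 * k + 1) ≤ (2 * k + 1) * DavenportLarge G / 2 - 1 := by
  obtain ⟨e⟩ := hG
  rw [DicyclicRho.davenport_congr e, DicyclicRho.rhoK_congr e, DicyclicRho.davenport_eq hm]
  have hl := DicyclicRho.lower_mem hm k hk
  have hu : ∀ r ∈ UnionLengths (QuaternionGroup m) (2 * k + 1),
      r ≤ (2 * k + 1) * (3 * m) / 2 - 1 := fun r hr => DicyclicRho.upper hm k r hk hr
  exact ⟨le_csSup ⟨_, hu⟩ hl, csSup_le ⟨_, hl⟩ hu⟩
end

section
/- Let G be a group isomorphic to the dihedral group of order 8 or to the quaternion group of order 8 (in both cases D(G) = 6). Then for every k ∈ ℕ, ρ_{2k+1}(G) = k·D(G) + 2 = 6k + 2. -/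
namespace RhoOdd

/-- Multiplication of codes `0..7` by lookup in a hexadecimal table. -/
def tm (T a b : ℕ) : ℕ := (T >>> (4 * (8 * a + b))) % 16

/-- Product of a list of codes. -/
def pr (T : ℕ) : List ℕ → ℕ
  | [] => 0
  | a :: l => tm T a (pr T l)

/-- Some two terms do not commute. -/
def nc (T : ℕ) (l : List ℕ) : Bool :=
  l.any fun a => l.any fun b => !(Nat.beq (tm T a b) (tm T b a))

/-- Product-one test. -/
def po (T : ℕ) (l : List ℕ) : Bool :=
  Nat.beq (pr T l) 0 || (Nat.beq (pr T l) 1 && nc T l)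

/-- Splitting test. -/
def sp (T : ℕ) : List ℕ → List ℕ → List ℕ → Bool
  | [], a, b => !a.isEmpty && (!b.isEmpty && (po T a && po T b))
  | x :: l, a, b => sp T l (x :: a) b || sp T l a (x :: b)

/-- Weight of a code. -/
def wt (W a : ℕ) : ℕ := (W >>> (4 * a)) % 16

/-- Total weight of a list of codes. -/
def ws (W : ℕ) : List ℕ → ℕ
  | [] => 0
  | a :: l => wt W a + ws W l

def P7 (T : ℕ) (l : List ℕ) : Bool := !(po T l) || sp T l [] []

def P6 (T W : ℕ) (l : List ℕ) : Bool :=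
  Nat.beq (ws W l % 4) 2 || (!(po T l) || sp T l [] [])

/-- Enumeration of all multisets of size `n` over `xs`, with fuel. -/
def allL (P : List ℕ → Bool) : ℕ → ℕ → List ℕ → List ℕ → Bool
  | 0, _, _, _ => false
  | _ + 1, 0, _, acc => P acc
  | _ + 1, _ + 1, [], _ => true
  | f + 1, n + 1, x :: xs, acc =>
      allL P f n (x :: xs) (x :: acc) && allL P f (n + 1) xs acc

/-- Test for minimal product-one sequences. -/
def atomB (T : ℕ) (l : List ℕ) : Bool :=
  !l.isEmpty && (po T l && (!(sp T l [] []) && l.all fun a => decide (a < 8)))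

/-- Multiplication table of the dihedral group. -/
def TD : ℕ := 514631494928646303709260478827610743694929142606798109115815419860305064464
/-- Multiplication table of the quaternion group. -/
def TQ : ℕ := 7325826928063462876768197805911758867703320313223450835354269893904490050064
def WD : ℕ := 33685504
def WQ : ℕ := 825307392

theorem cD7 : allL (P7 TD) 15 7 [1,2,3,4,5,6,7] [] = true := by decide +kernel
theorem cQ7 : allL (P7 TQ) 15 7 [1,2,3,4,5,6,7] [] = true := by decide +kernel
theorem cD6 : allL (P6 TD WD) 15 6 [1,2,3,4,5,6,7] [] = true := by decide +kernel
theorem cQ6 : allL (P6 TQ WQ) 15 6 [1,2,3,4,5,6,7] [] = true := by decide +kernel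

theorem allL_sound (P : List ℕ → Bool) (f : ℕ) : ∀ (n : ℕ) (xs acc : List ℕ),
    allL P f n xs acc = true → ∀ S : Multiset ℕ, Multiset.card S = n → (∀ s ∈ S, s ∈ xs) →
      ∃ l : List ℕ, P l = true ∧ (l : Multiset ℕ) = S + (acc : Multiset ℕ) := by
  induction f with
  | zero => intro n xs acc h; simp [allL] at h
  | succ f ih =>
    intro n xs acc h S hS hx
    cases n with
    | zero =>
      rw [Multiset.card_eq_zero] at hS
      subst hS
      exact ⟨acc, by simpa [allL] using h, by simp⟩
    | succ n =>
      cases xs with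
      | nil =>
        have : S = 0 := Multiset.eq_zero_of_forall_notMem (fun a ha => by simpa using hx a ha)
        subst this
        simp at hS
      | cons x xs =>
        simp only [allL, Bool.and_eq_true] at h
        by_cases hm : x ∈ S
        · obtain ⟨S', rfl⟩ := Multiset.exists_cons_of_mem hm
          obtain ⟨l, hl, hl'⟩ := ih n (x :: xs) (x :: acc) h.1 S' (by simpa using hS)
            (fun s hs => hx s (Multiset.mem_cons_of_mem hs))
          refine ⟨l, hl, ?_⟩
          rw [hl', ← Multiset.cons_coe, Multiset.add_cons, Multiset.cons_add]
        · refine ih (n + 1) xs acc h.2 S hS (fun s hs => ?_)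
          rcases List.mem_cons.1 (hx s hs) with rfl | h'
          · exact absurd hs hm
          · exact h'

theorem sp_sound (T : ℕ) (l : List ℕ) : ∀ a b : List ℕ, sp T l a b = true →
    ∃ a' b' : List ℕ, a' ≠ [] ∧ b' ≠ [] ∧ po T a' = true ∧ po T b' = true ∧
      (a' : Multiset ℕ) + b' = (l : Multiset ℕ) + (a + b) := by
  induction l with
  | nil =>
    intro a b h
    simp only [sp, Bool.and_eq_true, Bool.not_eq_true', List.isEmpty_eq_false_iff] at h
    exact ⟨a, b, h.1, h.2.1, h.2.2.1, h.2.2.2, by simp⟩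
  | cons x l ih =>
    intro a b h
    simp only [sp, Bool.or_eq_true] at h
    rcases h with h | h
    · obtain ⟨a', b', h1, h2, h3, h4, h5⟩ := ih _ _ h
      refine ⟨a', b', h1, h2, h3, h4, ?_⟩
      rw [h5, ← Multiset.cons_coe, ← Multiset.cons_coe]
      simp only [Multiset.cons_add, Multiset.add_cons]
    · obtain ⟨a', b', h1, h2, h3, h4, h5⟩ := ih _ _ h
      refine ⟨a', b', h1, h2, h3, h4, ?_⟩
      rw [h5, ← Multiset.cons_coe, ← Multiset.cons_coe]
      simp only [Multiset.cons_add, Multiset.add_cons]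

theorem sp_complete (T : ℕ) (l : List ℕ) : ∀ (a b : List ℕ) (A B : Multiset ℕ),
    (l : Multiset ℕ) = A + B →
    (∀ a' b' : List ℕ, (a' : Multiset ℕ) = A + a → (b' : Multiset ℕ) = B + b →
      a' ≠ [] ∧ b' ≠ [] ∧ po T a' = true ∧ po T b' = true) → sp T l a b = true := by
  induction l with
  | nil =>
    intro a b A B h h'
    have hA : A = 0 ∧ B = 0 := by
      have := congrArg Multiset.card h
      simp only [Multiset.coe_nil, Multiset.card_zero, Multiset.card_add] at this
      constructor <;> rw [← Multiset.card_eq_zero] <;> omega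
    obtain ⟨rfl, rfl⟩ := hA
    obtain ⟨h1, h2, h3, h4⟩ := h' a b (by simp) (by simp)
    simp [sp, h1, h2, h3, h4]
  | cons x l ih =>
    intro a b A B h h'
    have hx : x ∈ A + B := by rw [← h]; simp
    simp only [sp, Bool.or_eq_true]
    rcases Multiset.mem_add.1 hx with hx | hx
    · left
      obtain ⟨A', rfl⟩ := Multiset.exists_cons_of_mem hx
      refine ih (x :: a) b A' B ?_ ?_
      · rw [← Multiset.cons_coe, Multiset.cons_add] at h
        exact (Multiset.cons_inj_right x).1 h
      · intro a' b' h1 h2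
        refine h' a' b' ?_ h2
        rw [h1, ← Multiset.cons_coe, Multiset.cons_add, Multiset.add_cons]
    · right
      obtain ⟨B', rfl⟩ := Multiset.exists_cons_of_mem hx
      refine ih a (x :: b) A B' ?_ ?_
      · rw [← Multiset.cons_coe, Multiset.add_cons] at h
        exact (Multiset.cons_inj_right x).1 h
      · intro a' b' h1 h2
        refine h' a' b' h1 ?_
        rw [h2, ← Multiset.cons_coe, Multiset.cons_add, Multiset.add_cons]

/-- A coding of a group by the numbers `0..7`. -/
structure Coding (G : Type*) [Group G] (T W : ℕ) (c : G → ℕ) (d : ℕ → G) : Prop where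
  dc : ∀ g, d (c g) = g
  lt : ∀ g, c g < 8
  cd : ∀ i < 8, c (d i) = i
  mul : ∀ g h, c (g * h) = tm T (c g) (c h)
  d0 : d 0 = 1
  zz : d 1 * d 1 = 1
  zc : ∀ g, g * d 1 = d 1 * g
  comm : ∀ g h, g * h = h * g ∨ g * h = d 1 * (h * g)
  w0 : wt W 0 = 0
  inv : ∀ g, (wt W (c g) + wt W (c g⁻¹)) % 4 = 0

theorem Coding.transport {G H : Type*} [Group G] [Group H] {T W : ℕ} {c : H → ℕ} {d : ℕ → H}
    (C : Coding H T W c d) (e : G ≃* H) : Coding G T W (fun g => c (e g)) (fun i => e.symm (d i)) where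
  dc g := by simp [C.dc]
  lt g := C.lt _
  cd i hi := by simp [C.cd i hi]
  mul g h := by simp [C.mul]
  d0 := by simp [C.d0]
  zz := by rw [← map_mul, C.zz, map_one]
  zc g := by apply e.injective; simp [C.zc]
  comm g h := by
    rcases C.comm (e g) (e h) with h' | h'
    · left; apply e.injective; simpa using h'
    · right; apply e.injective; simpa using h'
  w0 := C.w0
  inv g := by simpa using C.inv (e g)

def cD : DihedralGroup 4 → ℕ
  | .r i => (12576 >>> (4 * i.val)) % 16
  | .sr i => (25972 >>> (4 * i.val)) % 16

def dD : ℕ → DihedralGroup 4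
  | 0 => .r 0
  | 1 => .r 2
  | 2 => .r 1
  | 3 => .r 3
  | 4 => .sr 0
  | 5 => .sr 2
  | 6 => .sr 3
  | _ => .sr 1

def cQ : QuaternionGroup 2 → ℕ
  | .a i => (12576 >>> (4 * i.val)) % 16
  | .xa i => (25972 >>> (4 * i.val)) % 16

def dQ : ℕ → QuaternionGroup 2
  | 0 => .a 0
  | 1 => .a 2
  | 2 => .a 1
  | 3 => .a 3
  | 4 => .xa 0
  | 5 => .xa 2
  | 6 => .xa 3
  | _ => .xa 1

theorem codingD : Coding (DihedralGroup 4) TD WD cD dD where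
  dc := by decide +kernel
  lt := by decide +kernel
  cd := by decide +kernel
  mul := by decide +kernel
  d0 := by decide +kernel
  zz := by decide +kernel
  zc := by decide +kernel
  comm := by decide +kernel
  w0 := by decide +kernel
  inv := by decide +kernel

theorem codingQ : Coding (QuaternionGroup 2) TQ WQ cQ dQ where
  dc := by decide +kernel
  lt := by decide +kernel
  cd := by decide +kernel
  mul := by decide +kernel
  d0 := by decide +kernel
  zz := by decide +kernel
  zc := by decide +kernel
  comm := by decide +kernel
  w0 := by decide +kernel
  inv := by decide +kernel

section
variable {G : Type*} [Group G] {T W : ℕ} {c : G → ℕ} {d : ℕ → G}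

theorem Coding.inj (C : Coding G T W c d) {g h : G} (e : c g = c h) : g = h := by
  rw [← C.dc g, ← C.dc h, e]

theorem Coding.c_one (C : Coding G T W c d) : c 1 = 0 := by
  rw [← C.d0, C.cd 0 (by norm_num)]

theorem Coding.pr_eq (C : Coding G T W c d) (l : List G) : pr T (l.map c) = c l.prod := by
  induction l with
  | nil => simp [pr, C.c_one]
  | cons a l ih => simp [pr, ih, C.mul]

theorem Coding.perm (C : Coding G T W c d) {l l' : List G} (h : l.Perm l') :
    l.prod = l'.prod ∨ l.prod = d 1 * l'.prod := by
  induction h with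
  | nil => simp
  | cons x _ ih =>
    rcases ih with ih | ih
    · left; simp [ih]
    · right; simp only [List.prod_cons]; rw [ih, ← mul_assoc, C.zc, mul_assoc]
  | swap x y l =>
    simp only [List.prod_cons]
    rcases C.comm y x with h | h
    · left; rw [← mul_assoc, h, mul_assoc]
    · right; rw [← mul_assoc, h]; simp only [mul_assoc]
  | trans _ _ i1 i2 =>
    rcases i1 with h1 | h1 <;> rcases i2 with h2 | h2
    · left; rw [h1, h2]
    · right; rw [h1, h2]
    · right; rw [h1, h2]
    · left; rw [h1, h2, ← mul_assoc, C.zz, one_mul]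

theorem Coding.po_iff (C : Coding G T W c d) (l : List G) :
    po T (l.map c) = true ↔ IsProductOne (l : Multiset G) := by
  have e0 : Nat.beq (pr T (l.map c)) 0 = true ↔ l.prod = 1 := by
    rw [Nat.beq_eq, C.pr_eq, ← C.c_one]
    exact ⟨fun h => C.inj h, fun h => by rw [h]⟩
  have e1 : Nat.beq (pr T (l.map c)) 1 = true ↔ l.prod = d 1 := by
    rw [Nat.beq_eq, C.pr_eq]
    constructor
    · intro h; rw [← h, C.dc]
    · intro h; rw [h, C.cd 1 (by norm_num)]
  have e2 : nc T (l.map c) = true ↔ ∃ a ∈ l, ∃ b ∈ l, a * b ≠ b * a := by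
    simp only [nc, List.any_map, List.any_eq_true, Function.comp, Bool.not_eq_true', ← C.mul]
    refine exists_congr fun a => and_congr_right fun _ => exists_congr fun b =>
      and_congr_right fun _ => ?_
    rw [← Bool.not_eq_true, Nat.beq_eq]
    exact not_congr ⟨fun h => C.inj h, fun h => by rw [h]⟩
  simp only [po, Bool.or_eq_true, Bool.and_eq_true, e0, e1, e2]
  constructor
  · rintro (h | ⟨h, a, ha, b, hb, hab⟩)
    · exact ⟨l, rfl, h⟩
    · have hne : b ≠ a := by rintro rfl; exact hab rfl
      classical
      have p1 : l.Perm (a :: b :: (l.erase a).erase b) :=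
        (List.perm_cons_erase ha).trans
          ((List.perm_cons_erase ((List.mem_erase_of_ne hne).2 hb)).cons a)
      rcases C.perm p1 with h1 | h1
      · refine ⟨b :: a :: (l.erase a).erase b, Multiset.coe_eq_coe.2
          ((List.Perm.swap a b _).trans p1.symm), ?_⟩
        rcases C.comm a b with h2 | h2
        · exact absurd h2 hab
        · rw [h] at h1
          simp only [List.prod_cons, ← mul_assoc] at h1 ⊢
          rw [h2, mul_assoc] at h1
          simpa using h1.symm
      · refine ⟨_, Multiset.coe_eq_coe.2 p1.symm, ?_⟩
        rw [h] at h1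
        simpa using h1.symm
  · rintro ⟨l', h1, h2⟩
    have p := Multiset.coe_eq_coe.1 h1
    by_cases hab : ∃ a ∈ l, ∃ b ∈ l, a * b ≠ b * a
    · rcases C.perm p.symm with h3 | h3
      · left; rw [h3, h2]
      · right; rw [h3, h2]; exact ⟨by simp, hab⟩
    · left
      push Not at hab
      rw [← h2]
      refine List.Perm.prod_eq' p.symm ?_
      exact List.pairwise_of_forall_mem_list (fun a ha b hb => hab a ha b hb)

theorem Coding.po_iff' (C : Coding G T W c d) (l : List ℕ) (S : Multiset G)
    (h : (l : Multiset ℕ) = S.map c) : po T l = true ↔ IsProductOne S := by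
  have h1 : l = (l.map d).map c := by
    rw [List.map_map]
    conv_lhs => rw [← List.map_id l]
    refine List.map_congr_left fun a ha => ?_
    have : a ∈ S.map c := by rw [← h]; simpa using ha
    obtain ⟨g, -, rfl⟩ := Multiset.mem_map.1 this
    simp [C.dc]
  have h2 : ((l.map d : List G) : Multiset G) = S := by
    rw [← Multiset.map_coe, h, Multiset.map_map]
    simp [C.dc]
  rw [h1, C.po_iff, h2]

theorem Coding.map_dc (C : Coding G T W c d) (S : Multiset G) : (S.map c).map d = S := by
  rw [Multiset.map_map]
  simp [C.dc]

theorem Coding.sp_iff (C : Coding G T W c d) (l : List ℕ) (S : Multiset G)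
    (h : (l : Multiset ℕ) = S.map c) : sp T l [] [] = true ↔
      ∃ A B : Multiset G, A ≠ 0 ∧ B ≠ 0 ∧ IsProductOne A ∧ IsProductOne B ∧ S = A + B := by
  constructor
  · intro hs
    obtain ⟨a, b, h1, h2, h3, h4, h5⟩ := sp_sound T l [] [] hs
    simp only [Multiset.coe_nil, add_zero] at h5
    have hS : S = (a : Multiset ℕ).map d + (b : Multiset ℕ).map d := by
      rw [← Multiset.map_add, h5, h, C.map_dc]
    have key : ∀ x : List ℕ, (∀ i ∈ x, i ∈ l) →
        (x : Multiset ℕ) = ((x : Multiset ℕ).map d).map c := by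
      intro x hx
      rw [Multiset.map_map]
      conv_lhs => rw [← Multiset.map_id (x : Multiset ℕ)]
      refine Multiset.map_congr rfl fun i hi => ?_
      have : i ∈ S.map c := by rw [← h]; simpa using hx i (by simpa using hi)
      obtain ⟨g, -, rfl⟩ := Multiset.mem_map.1 this
      simp [C.dc]
    have ka := key a (fun i hi => by
      have : i ∈ (l : Multiset ℕ) := by rw [← h5]; simp [hi]
      simpa using this)
    have kb := key b (fun i hi => by
      have : i ∈ (l : Multiset ℕ) := by rw [← h5]; simp [hi]
      simpa using this)
    exact ⟨_, _, by simpa using h1, by simpa using h2, (C.po_iff' a _ ka).1 h3,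
      (C.po_iff' b _ kb).1 h4, hS⟩
  · rintro ⟨A, B, hA, hB, pA, pB, rfl⟩
    refine sp_complete T l [] [] (A.map c) (B.map c) (by rw [h, Multiset.map_add]) ?_
    intro a b ha hb
    simp only [Multiset.coe_nil, add_zero] at ha hb
    refine ⟨?_, ?_, (C.po_iff' a A ha).2 pA, (C.po_iff' b B hb).2 pB⟩
    · rintro rfl
      exact hA (by simpa using ha.symm)
    · rintro rfl
      exact hB (by simpa using hb.symm)

theorem Coding.min_iff (C : Coding G T W c d) (l : List ℕ) (S : Multiset G)
    (h : (l : Multiset ℕ) = S.map c) :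
    IsMinimalProductOne S ↔ l ≠ [] ∧ po T l = true ∧ ¬ sp T l [] [] = true := by
  rw [C.po_iff' l S h, C.sp_iff l S h, IsMinimalProductOne]
  refine and_congr ?_ (and_congr_right fun _ => ?_)
  · rw [not_iff_not]
    constructor
    · rintro rfl; simpa using h
    · rintro rfl; simpa using h.symm
  · constructor
    · rintro h ⟨A, B, a, b, p, q, e⟩; exact h A B a b p q e
    · intro h A B a b p q e; exact h ⟨A, B, a, b, p, q, e⟩

theorem Coding.min_of_atomB (C : Coding G T W c d) (l : List ℕ) (h : atomB T l = true) :
    IsMinimalProductOne ((l : Multiset ℕ).map d) := by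
  simp only [atomB, Bool.and_eq_true, Bool.not_eq_true', List.isEmpty_eq_false_iff,
    List.all_eq_true, decide_eq_true_eq] at h
  refine (C.min_iff l _ ?_).2 ⟨h.1, h.2.1, by simp [h.2.2.1]⟩
  rw [Multiset.map_map]
  conv_lhs => rw [← Multiset.map_id (l : Multiset ℕ)]
  refine Multiset.map_congr rfl fun i hi => ?_
  simp [C.cd i (h.2.2.2 i (by simpa using hi))]

theorem one_mem_min {S : Multiset G} (h : IsMinimalProductOne S) (h1 : (1 : G) ∈ S) : S = {1} := by
  obtain ⟨R, rfl⟩ := Multiset.exists_cons_of_mem h1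
  by_cases hR : R = 0
  · subst hR; rfl
  exfalso
  obtain ⟨-, ⟨l, hl, hp⟩, hm⟩ := h
  refine hm {1} R (by simp) hR ⟨[1], rfl, by simp⟩ ?_ (by simp)
  have hml : (1 : G) ∈ l := by
    have : (1 : G) ∈ (l : Multiset G) := by rw [hl]; simp
    simpa using this
  obtain ⟨s, t, rfl⟩ := List.append_of_mem hml
  refine ⟨s ++ t, ?_, by simpa using hp⟩
  rw [← Multiset.cons_inj_right 1, ← hl, Multiset.cons_coe, Multiset.coe_eq_coe]
  exact List.perm_middle.symm

theorem merge_min {S : Multiset G} (h : IsMinimalProductOne S) {n : ℕ}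
    (hc : Multiset.card S = n + 2) :
    ∃ S' : Multiset G, IsMinimalProductOne S' ∧ Multiset.card S' = n + 1 := by
  obtain ⟨-, ⟨l, hl, hp⟩, hm⟩ := h
  subst hl
  match l, hc with
  | a :: b :: l, hc =>
  refine ⟨((a * b :: l : List G) : Multiset G), ⟨by simp, ⟨_, rfl, by simpa [mul_assoc] using hp⟩, ?_⟩,
    by simpa using hc⟩
  have key : ∀ A B : Multiset G, B ≠ 0 → IsProductOne A → IsProductOne B → a * b ∈ A →
      ((a * b :: l : List G) : Multiset G) ≠ A + B := by
    rintro A B hB ⟨la, rfl, hA⟩ pB hmem e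
    obtain ⟨s, t, rfl⟩ := List.append_of_mem (by simpa using hmem)
    refine hm ((s ++ a :: b :: t : List G) : Multiset G) B (by simp) hB
      ⟨_, rfl, by simpa [mul_assoc] using hA⟩ pB ?_
    have e2 : ((s ++ a * b :: t : List G) : Multiset G) = (a * b) ::ₘ ((s ++ t : List G) : Multiset G) :=
      Multiset.coe_eq_coe.2 List.perm_middle
    have e3 : ((s ++ a :: b :: t : List G) : Multiset G) = a ::ₘ b ::ₘ ((s ++ t : List G) : Multiset G) :=
      Multiset.coe_eq_coe.2 (List.perm_middle.trans (List.perm_middle.cons a))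
    rw [e2, ← Multiset.cons_coe, Multiset.cons_add, Multiset.cons_inj_right] at e
    rw [e3, ← Multiset.cons_coe, ← Multiset.cons_coe, e, Multiset.cons_add, Multiset.cons_add]
  intro A B hA hB pA pB e
  have hmem : a * b ∈ A + B := by rw [← e]; simp
  rcases Multiset.mem_add.1 hmem with h | h
  · exact key A B hB pA pB h e
  · exact key B A hA pB pA h (by rw [e, add_comm])

theorem Coding.codes_mem (C : Coding G T W c d) {S : Multiset G} (h1 : (1 : G) ∉ S) :
    ∀ s ∈ S.map c, s ∈ [1,2,3,4,5,6,7] := by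
  intro s hs
  obtain ⟨g, hg, rfl⟩ := Multiset.mem_map.1 hs
  have := C.lt g
  have h0 : c g ≠ 0 := by
    intro h
    rw [← C.c_one] at h
    exact h1 (C.inj h ▸ hg)
  simp only [List.mem_cons, List.not_mem_nil, or_false]
  omega

theorem Coding.no7 (C : Coding G T W c d) (h7 : allL (P7 T) 15 7 [1,2,3,4,5,6,7] [] = true)
    {S : Multiset G} (h : IsMinimalProductOne S) : Multiset.card S ≠ 7 := by
  intro hc
  have h1 : (1 : G) ∉ S := by
    intro h1
    rw [one_mem_min h h1] at hc
    simp at hc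
  obtain ⟨l, hl, e⟩ := allL_sound _ _ _ _ _ h7 (S.map c) (by simpa using hc) (C.codes_mem h1)
  have := (C.min_iff l S (by simpa using e)).1 h
  simp [P7, this.2.1, this.2.2] at hl

theorem Coding.le6 (C : Coding G T W c d) (h7 : allL (P7 T) 15 7 [1,2,3,4,5,6,7] [] = true)
    {S : Multiset G} (h : IsMinimalProductOne S) : Multiset.card S ≤ 6 := by
  have : ∀ n : ℕ, ∀ S : Multiset G, IsMinimalProductOne S → Multiset.card S ≠ n + 7 := by
    intro n
    induction n with
    | zero => intro S h; exact C.no7 h7 h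
    | succ n ih =>
      intro S h hc
      obtain ⟨S', h', hc'⟩ := merge_min h (n := n + 6) (by omega)
      exact ih S' h' (by omega)
  by_contra hlt
  exact this (Multiset.card S - 7) S h (by omega)

theorem ws_eq (W : ℕ) (l : List ℕ) : ws W l = ((l : Multiset ℕ).map (wt W)).sum := by
  induction l with
  | nil => simp [ws]
  | cons a l ih => simp [ws, ih]

theorem Coding.w6 (C : Coding G T W c d) (h6 : allL (P6 T W) 15 6 [1,2,3,4,5,6,7] [] = true)
    {S : Multiset G} (h : IsMinimalProductOne S) (hc : Multiset.card S = 6) :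
    ((S.map c).map (wt W)).sum % 4 = 2 := by
  have h1 : (1 : G) ∉ S := by
    intro h1
    rw [one_mem_min h h1] at hc
    simp at hc
  obtain ⟨l, hl, e⟩ := allL_sound _ _ _ _ _ h6 (S.map c) (by simpa using hc) (C.codes_mem h1)
  have := (C.min_iff l S (by simpa using e)).1 h
  simp only [P6, this.2.1, Bool.or_eq_true, Nat.beq_eq, this.2.2, Bool.not_true, or_false,
    Bool.false_eq_true] at hl
  rw [ws_eq, e] at hl
  simpa using hl

theorem hasLength_iff (a : Multiset G) (k : ℕ) : HasLength a k ↔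
    ∃ M : Multiset (Multiset G), Multiset.card M = k ∧ (∀ U ∈ M, IsMinimalProductOne U) ∧
      M.sum = a := by
  constructor
  · rintro ⟨f, h, e⟩
    refine ⟨Finset.univ.val.map f, by simp, ?_, e⟩
    intro U hU
    obtain ⟨i, -, rfl⟩ := Multiset.mem_map.1 hU
    exact h i
  · rintro ⟨M, hk, h, e⟩
    induction M using Quotient.inductionOn with
    | _ l =>
    simp only [Multiset.quot_mk_to_coe, Multiset.coe_card, Multiset.mem_coe,
      Multiset.sum_coe] at hk h e
    subst hk
    refine ⟨fun i => l.get i, fun i => h _ (List.get_mem l i), ?_⟩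
    rw [← e, ← List.sum_ofFn, List.ofFn_get]

theorem hasLength_add {a b : Multiset G} {m n : ℕ} (h : HasLength a m) (h' : HasLength b n) :
    HasLength (a + b) (m + n) := by
  rw [hasLength_iff] at *
  obtain ⟨M, rfl, h1, rfl⟩ := h
  obtain ⟨N, rfl, h2, rfl⟩ := h'
  refine ⟨M + N, by simp, ?_, by simp⟩
  intro U hU
  rcases Multiset.mem_add.1 hU with hU | hU
  · exact h1 U hU
  · exact h2 U hU

theorem isProductOne_of_hasLength {a : Multiset G} {k : ℕ} (h : HasLength a k) :
    IsProductOne a := by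
  rw [hasLength_iff] at h
  obtain ⟨M, -, h, rfl⟩ := h
  induction M using Multiset.induction with
  | empty => exact ⟨[], by simp, by simp⟩
  | cons U M ih =>
    obtain ⟨l, e, p⟩ := ih (fun V hV => h V (Multiset.mem_cons_of_mem hV))
    obtain ⟨l', e', p'⟩ := (h U (Multiset.mem_cons_self U M)).2.1
    exact ⟨l' ++ l, by rw [← Multiset.coe_add, e, e', Multiset.sum_cons], by simp [p, p']⟩

theorem Coding.hasLength_list (C : Coding G T W c d) (L : List (List ℕ))
    (h : L.all (atomB T) = true) :
    HasLength ((L.flatten : Multiset ℕ).map d) L.length := by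
  rw [hasLength_iff]
  refine ⟨((L.map fun l : List ℕ => ((l : Multiset ℕ).map d) : List (Multiset G)) : Multiset (Multiset G)),
    by simp, ?_, ?_⟩
  · intro U hU
    simp only [Multiset.mem_coe, List.mem_map] at hU
    obtain ⟨l, hl, rfl⟩ := hU
    exact C.min_of_atomB l (List.all_eq_true.1 h l hl)
  · clear h
    induction L with
    | nil => simp
    | cons l L ih =>
      simp only [List.map_cons, Multiset.sum_coe, List.sum_cons, List.flatten_cons] at ih ⊢
      rw [ih, ← Multiset.coe_add, Multiset.map_add]

theorem Coding.upper (C : Coding G T W c d)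
    (h7 : allL (P7 T) 15 7 [1,2,3,4,5,6,7] [] = true)
    (h6 : allL (P6 T W) 15 6 [1,2,3,4,5,6,7] [] = true) (k m : ℕ) (a : Multiset G)
    (hk : HasLength a (2 * k + 1)) (hm : HasLength a m) : m ≤ 6 * k + 2 := by
  classical
  rw [hasLength_iff] at hk hm
  obtain ⟨M, hM, aM, rfl⟩ := hk
  obtain ⟨N, rfl, aN, e⟩ := hm
  have u : ∀ M : Multiset (Multiset G), (∀ U ∈ M, IsMinimalProductOne U) →
      Multiset.card M.sum + M.sum.count 1 ≤ 6 * Multiset.card M ∧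
      (Multiset.card M.sum + M.sum.count 1 = 6 * Multiset.card M →
        ((M.sum.map c).map (wt W)).sum % 4 = 2 * Multiset.card M % 4) := by
    intro M h
    induction M using Multiset.induction with
    | empty => simp
    | cons U M ih =>
      obtain ⟨i1, i2⟩ := ih (fun V hV => h V (Multiset.mem_cons_of_mem hV))
      have hU := h U (Multiset.mem_cons_self U M)
      have s : Multiset.card U + U.count 1 ≤ 6 ∧ (Multiset.card U + U.count 1 = 6 →
          ((U.map c).map (wt W)).sum % 4 = 2) := by
        by_cases h1 : (1 : G) ∈ U
        · rw [one_mem_min hU h1]; simp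
        · rw [Multiset.count_eq_zero_of_notMem h1]
          exact ⟨C.le6 h7 hU, fun hc => C.w6 h6 hU (by simpa using hc)⟩
      simp only [Multiset.sum_cons, Multiset.card_add, Multiset.count_add, Multiset.card_cons]
      refine ⟨by omega, fun hh => ?_⟩
      have ea : (((U + M.sum).map c).map (wt W)).sum =
          ((U.map c).map (wt W)).sum + ((M.sum.map c).map (wt W)).sum := by
        rw [Multiset.map_add, Multiset.map_add, Multiset.sum_add]
      rw [ea]
      have := i2 (by omega)
      have := s.2 (by omega)
      omega
  have v : ∀ M : Multiset (Multiset G), (∀ U ∈ M, IsMinimalProductOne U) →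
      2 * Multiset.card M ≤ Multiset.card M.sum + M.sum.count 1 ∧
      (Multiset.card M.sum + M.sum.count 1 = 2 * Multiset.card M →
        ((M.sum.map c).map (wt W)).sum % 4 = 0) := by
    intro M h
    induction M using Multiset.induction with
    | empty => simp
    | cons U M ih =>
      obtain ⟨i1, i2⟩ := ih (fun V hV => h V (Multiset.mem_cons_of_mem hV))
      have hU := h U (Multiset.mem_cons_self U M)
      have s : 2 ≤ Multiset.card U + U.count 1 ∧ (Multiset.card U + U.count 1 = 2 →
          ((U.map c).map (wt W)).sum % 4 = 0) := by
        by_cases h1 : (1 : G) ∈ U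
        · rw [one_mem_min hU h1]
          refine ⟨by simp, fun _ => ?_⟩
          simp [C.c_one, C.w0]
        · rw [Multiset.count_eq_zero_of_notMem h1]
          obtain ⟨h0, ⟨l, rfl, hp⟩, -⟩ := hU
          match l with
          | [] => simp at h0
          | [x] => simp at hp; simp [hp] at h1
          | [x, y] =>
            refine ⟨by simp, fun _ => ?_⟩
            have : y = x⁻¹ := by
              simp only [List.prod_cons, List.prod_nil, mul_one] at hp
              exact (inv_eq_of_mul_eq_one_right hp).symm
            subst this
            simpa using C.inv x
          | x :: y :: z :: l => simp
      simp only [Multiset.sum_cons, Multiset.card_add, Multiset.count_add, Multiset.card_cons]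
      refine ⟨by omega, fun hh => ?_⟩
      have ea : (((U + M.sum).map c).map (wt W)).sum =
          ((U.map c).map (wt W)).sum + ((M.sum.map c).map (wt W)).sum := by
        rw [Multiset.map_add, Multiset.map_add, Multiset.sum_add]
      rw [ea]
      have := i2 (by omega)
      have := s.2 (by omega)
      omega
  obtain ⟨u1, u2⟩ := u M aM
  obtain ⟨v1, v2⟩ := v N aN
  rw [e] at v1 v2
  by_contra hlt
  have := u2 (by omega)
  have := v2 (by omega)
  omega

theorem Coding.main (C : Coding G T W c d)
    (h7 : allL (P7 T) 15 7 [1,2,3,4,5,6,7] [] = true)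
    (h6 : allL (P6 T W) 15 6 [1,2,3,4,5,6,7] [] = true)
    (u : List ℕ) (hu : atomB T u = true) (hu6 : u.length = 6)
    (L2 L6 L3 L8 : List (List ℕ))
    (a2 : L2.all (atomB T) = true) (a6 : L6.all (atomB T) = true)
    (a3 : L3.all (atomB T) = true) (a8 : L8.all (atomB T) = true)
    (l2 : L2.length = 2) (l6 : L6.length = 6) (l3 : L3.length = 3) (l8 : L8.length = 8)
    (p26 : L2.flatten.Perm L6.flatten) (p38 : L3.flatten.Perm L8.flatten)
    (k : ℕ) (hk : 1 ≤ k) :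
    rhoK G (2 * k + 1) = k * DavenportLarge G + 2 ∧ rhoK G (2 * k + 1) = 6 * k + 2 := by
  have hD : DavenportLarge G = 6 := by
    refine IsGreatest.csSup_eq ⟨⟨_, C.min_of_atomB u hu, by simpa using hu6⟩, ?_⟩
    rintro m ⟨S, hS, rfl⟩
    exact C.le6 h7 hS
  have hR : rhoK G (2 * k + 1) = 6 * k + 2 := by
    refine IsGreatest.csSup_eq ⟨?_, ?_⟩
    · have h2 := C.hasLength_list L2 a2
      have h6 := C.hasLength_list L6 a6
      have h3 := C.hasLength_list L3 a3
      have h8 := C.hasLength_list L8 a8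
      rw [Multiset.coe_eq_coe.2 p26, l2] at h2
      rw [Multiset.coe_eq_coe.2 p38, l3] at h3
      rw [l6] at h6
      rw [l8] at h8
      obtain ⟨j, rfl⟩ : ∃ j, k = j + 1 := ⟨k - 1, by omega⟩
      clear hk
      have : ∃ a : Multiset G, HasLength a (2 * (j + 1) + 1) ∧ HasLength a (6 * (j + 1) + 2) := by
        induction j with
        | zero => exact ⟨_, h3, h8⟩
        | succ j ih =>
          obtain ⟨a, x, y⟩ := ih
          have x' := hasLength_add x h2
          have y' := hasLength_add y h6
          rw [show 2 * (j + 1) + 1 + 2 = 2 * (j + 1 + 1) + 1 by ring] at x'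
          rw [show 6 * (j + 1) + 2 + 6 = 6 * (j + 1 + 1) + 2 by ring] at y'
          exact ⟨_, x', y'⟩
      obtain ⟨a, x, y⟩ := this
      exact ⟨a, isProductOne_of_hasLength x, x, y⟩
    · rintro m ⟨a, -, h1, h2⟩
      exact C.upper h7 h6 k m a h1 h2
  exact ⟨by rw [hR, hD, mul_comm], hR⟩

end

end RhoOdd

theorem rho_odd_eq_of_D8_or_Q8
    (G : Type*) [Group G]
    (hG : Nonempty (G ≃* DihedralGroup 4) ∨ Nonempty (G ≃* QuaternionGroup 2))
    (k : ℕ) (hk : 1 ≤ k) :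
    rhoK G (2 * k + 1) = k * DavenportLarge G + 2 ∧
      rhoK G (2 * k + 1) = 6 * k + 2 := by
  rcases hG with ⟨⟨e⟩⟩ | ⟨⟨e⟩⟩
  · exact (RhoOdd.codingD.transport e).main RhoOdd.cD7 RhoOdd.cD6
      [2,2,2,2,4,5] (by decide +kernel) rfl
      [[2,2,2,2,4,5], [3,3,3,3,4,5]]
      [[2,3], [2,3], [2,3], [2,3], [4,4], [5,5]]
      [[2,2,2,2,4,5], [3,3,3,3,6,7], [4,5,6,7]]
      [[2,3], [2,3], [2,3], [2,3], [4,4], [5,5], [6,6], [7,7]]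
      (by decide +kernel) (by decide +kernel) (by decide +kernel) (by decide +kernel)
      rfl rfl rfl rfl (by decide +kernel) (by decide +kernel) k hk
  · exact (RhoOdd.codingQ.transport e).main RhoOdd.cQ7 RhoOdd.cQ6
      [2,2,2,2,4,4] (by decide +kernel) rfl
      [[2,2,2,2,4,4], [3,3,3,3,5,5]]
      [[2,3], [2,3], [2,3], [2,3], [4,5], [4,5]]
      [[2,2,2,2,4,4], [3,3,3,3,6,6], [5,5,7,7]]
      [[2,3], [2,3], [2,3], [2,3], [4,5], [4,5], [6,7], [6,7]]
      (by decide +kernel) (by decide +kernel) (by decide +kernel) (by decide +kernel)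
      rfl rfl rfl rfl (by decide +kernel) (by decide +kernel) k hk
end

section
/- Let G be a finite group with |G| ≥ 3 and let k ∈ ℕ. Then ρ_k(G) ≤ k·D(G)/2 and ρ_{2k}(G) = k·D(G); in particular, the elasticity satisfies ρ(G) = D(G)/2. -/
section Helpers

variable {G : Type*} [Group G]

lemma isProductOne_of_mem_one {S T : Multiset G} (h : IsProductOne S) (hS : S = 1 ::ₘ T) :
    IsProductOne T := by
  obtain ⟨l, hl, hp⟩ := h
  have hm : (1 : G) ∈ l := by
    have : (1 : G) ∈ (l : Multiset G) := by rw [hl, hS]; simp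
    simpa using this
  obtain ⟨a, b, rfl⟩ := List.append_of_mem hm
  refine ⟨a ++ b, ?_, by simpa using hp⟩
  have h2 : (1 : G) ::ₘ ((a ++ b : List G) : Multiset G) = 1 ::ₘ T := by
    rw [← hS, ← hl]
    simp only [Multiset.cons_coe, Multiset.coe_eq_coe]
    exact List.perm_middle.symm
  exact (Multiset.cons_inj_right _).1 h2

lemma isProductOne_single_one : IsProductOne ({1} : Multiset G) := ⟨[1], by simp, by simp⟩

lemma isProductOne_single {g : G} (h : IsProductOne ({g} : Multiset G)) : g = 1 := by
  obtain ⟨l, hl, hp⟩ := h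
  have : l = [g] := by simpa using hl
  subst this
  simpa using hp

lemma atom_one {S : Multiset G} (h : IsMinimalProductOne S) (h1 : (1 : G) ∈ S) : S = {1} := by
  obtain ⟨T, hT⟩ := Multiset.exists_cons_of_mem h1
  have hp := isProductOne_of_mem_one h.2.1 hT
  by_cases h0 : T = 0
  · rw [hT, h0]; rfl
  · exact absurd (by rw [hT, Multiset.singleton_add]) (h.2.2 {1} T (by simp) h0 isProductOne_single_one hp)

lemma atom_pair {g : G} (hg : g ≠ 1) : IsMinimalProductOne ({g, g⁻¹} : Multiset G) := by
  refine ⟨by simp, ⟨[g, g⁻¹], rfl, by simp⟩, ?_⟩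
  intro T₁ T₂ h1 h2 p1 p2 h
  have hc : T₁.card + T₂.card = 2 := by
    rw [← Multiset.card_add, ← h]; simp
  have c1 := Multiset.card_pos.2 h1
  have c2 := Multiset.card_pos.2 h2
  obtain ⟨x, rfl⟩ := Multiset.card_eq_one.1 (show T₁.card = 1 by omega)
  have hx := isProductOne_single p1
  have : x ∈ ({g, g⁻¹} : Multiset G) := by rw [h]; simp
  subst hx
  simp at this
  rcases this with h | h
  · exact hg h.symm
  · exact hg h

lemma isProductOne_inv {S : Multiset G} (h : IsProductOne S) :
    IsProductOne (S.map (fun g => g⁻¹)) := by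
  obtain ⟨l, hl, hp⟩ := h
  refine ⟨(l.map (fun g => g⁻¹)).reverse, ?_, ?_⟩
  · rw [← hl]; simp
  · rw [← List.prod_inv_reverse, hp, inv_one]

lemma atom_inv {S : Multiset G} (h : IsMinimalProductOne S) :
    IsMinimalProductOne (S.map (fun g => g⁻¹)) := by
  refine ⟨by simpa using h.1, isProductOne_inv h.2.1, ?_⟩
  intro T₁ T₂ h1 h2 p1 p2 he
  refine h.2.2 _ _ (by simpa using h1) (by simpa using h2) (isProductOne_inv p1)
    (isProductOne_inv p2) ?_
  rw [← Multiset.map_add, ← he]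
  simp

lemma atom_card_le [Finite G] {S : Multiset G} (h : IsMinimalProductOne S) :
    S.card ≤ Nat.card G := by
  by_contra! hlt
  obtain ⟨l, hl, hp⟩ := h.2.1
  have hlen : l.length = S.card := by rw [← hl]; simp
  have := Fintype.ofFinite G
  obtain ⟨i, j, hij, he⟩ := Fintype.exists_ne_map_eq_of_card_lt
    (fun i : Fin l.length => (l.take i).prod) (by
      rw [Fintype.card_fin, ← Nat.card_eq_fintype_card]; omega)
  wlog hlt' : i < j generalizing i j
  · exact this j i hij.symm he.symm (lt_of_le_of_ne (not_lt.1 hlt') hij.symm)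
  have hij' : (i : ℕ) < j := hlt'
  have hj := j.2
  have e1 : l.take j = l.take i ++ (l.drop i).take (j - i) := by
    rw [← List.take_add]; congr 1; omega
  have e2 : l = l.take i ++ (l.drop i).take (j - i) ++ l.drop j := by
    rw [← e1, List.take_append_drop]
  have hm : ((l.drop i).take (j - i)).prod = 1 := by
    rw [e1, List.prod_append] at he
    simpa using he
  refine h.2.2 (((l.drop i).take (j - i) : List G)) ((l.take i ++ l.drop j : List G)) ?_ ?_
    ⟨_, rfl, hm⟩ ⟨_, rfl, ?_⟩ ?_
  · rw [← Multiset.card_pos]; simp; omega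
  · rw [← Multiset.card_pos]; simp <;> omega
  · rw [List.prod_append, he, ← List.prod_append, List.take_append_drop, hp]
  · rw [← hl]
    conv_lhs => rw [e2]
    simp only [← Multiset.coe_add]
    abel

lemma bdd_atoms [Finite G] :
    BddAbove {m | ∃ S : Multiset G, IsMinimalProductOne S ∧ Multiset.card S = m} := by
  refine ⟨Nat.card G, ?_⟩
  rintro m ⟨S, hS, rfl⟩
  exact atom_card_le hS

lemma card_le_D [Finite G] {S : Multiset G} (h : IsMinimalProductOne S) :
    S.card ≤ DavenportLarge G := le_csSup bdd_atoms ⟨S, h, rfl⟩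

lemma two_le_D [Finite G] (hG : 3 ≤ Nat.card G) : 2 ≤ DavenportLarge G := by
  have : Nontrivial G := Finite.one_lt_card_iff_nontrivial.1 (by omega)
  obtain ⟨g, hg⟩ := exists_ne (1 : G)
  simpa using card_le_D (atom_pair hg)

lemma exists_atom_D [Finite G] (hG : 3 ≤ Nat.card G) :
    ∃ S : Multiset G, IsMinimalProductOne S ∧ S.card = DavenportLarge G := by
  have : Nontrivial G := Finite.one_lt_card_iff_nontrivial.1 (by omega)
  obtain ⟨g, hg⟩ := exists_ne (1 : G)
  have hne : {m | ∃ S : Multiset G, IsMinimalProductOne S ∧ Multiset.card S = m}.Nonempty :=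
    ⟨_, _, atom_pair hg, rfl⟩
  exact Nat.sSup_mem hne bdd_atoms

open Classical in
lemma atom_weight [Finite G] (hG : 3 ≤ Nat.card G) {S : Multiset G}
    (h : IsMinimalProductOne S) :
    2 ≤ S.card + S.count 1 ∧ S.card + S.count 1 ≤ DavenportLarge G := by
  have hD := two_le_D hG
  by_cases h1 : (1 : G) ∈ S
  · rw [atom_one h h1]; simpa using hD
  · rw [Multiset.count_eq_zero_of_notMem h1]
    refine ⟨?_, by simpa using card_le_D h⟩
    by_contra! hlt
    have := Multiset.card_pos.2 h.1
    obtain ⟨x, rfl⟩ := Multiset.card_eq_one.1 (show S.card = 1 by omega)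
    exact h1 (by rw [isProductOne_single h.2.1]; simp)

open Classical in
lemma length_weight [Finite G] (hG : 3 ≤ Nat.card G) {a : Multiset G} {k : ℕ}
    (h : HasLength a k) :
    2 * k ≤ a.card + a.count 1 ∧ a.card + a.count 1 ≤ k * DavenportLarge G := by
  obtain ⟨f, hf, rfl⟩ := h
  have e : (∑ i, f i).card + (∑ i, f i).count 1 = ∑ i, ((f i).card + (f i).count 1) := by
    rw [Finset.sum_add_distrib, Multiset.count_sum', Multiset.card_sum]
  rw [e]
  constructor
  · calc 2 * k = ∑ _i : Fin k, 2 := by simp [mul_comm]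
      _ ≤ _ := Finset.sum_le_sum fun i _ => (atom_weight hG (hf i)).1
  · calc _ ≤ ∑ _i : Fin k, DavenportLarge G :=
          Finset.sum_le_sum fun i _ => (atom_weight hG (hf i)).2
      _ = _ := by simp

lemma union_le [Finite G] (hG : 3 ≤ Nat.card G) {k m : ℕ} (h : m ∈ UnionLengths G k) :
    2 * m ≤ k * DavenportLarge G := by
  obtain ⟨a, -, h1, h2⟩ := h
  exact (length_weight hG h2).1.trans (length_weight hG h1).2

lemma bdd_union [Finite G] (hG : 3 ≤ Nat.card G) (k : ℕ) : BddAbove (UnionLengths G k) :=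
  ⟨k * DavenportLarge G, fun m hm => by have := union_le hG hm; omega⟩

lemma isProductOne_add {S T : Multiset G} (h : IsProductOne S) (h' : IsProductOne T) :
    IsProductOne (S + T) := by
  obtain ⟨l, rfl, hp⟩ := h
  obtain ⟨l', rfl, hp'⟩ := h'
  exact ⟨l ++ l', by simp, by simp [hp, hp']⟩

lemma isProductOne_nsmul {S : Multiset G} (h : IsProductOne S) (n : ℕ) :
    IsProductOne (n • S) := by
  induction n with
  | zero => exact ⟨[], by simp, by simp⟩
  | succ n ih => rw [succ_nsmul]; exact isProductOne_add ih h

lemma hasLength_zero : HasLength (0 : Multiset G) 0 := ⟨fun _ => 0, fun i => i.elim0, by simp⟩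

lemma hasLength_cons {A a : Multiset G} {k : ℕ} (hA : IsMinimalProductOne A)
    (h : HasLength a k) : HasLength (A + a) (k + 1) := by
  obtain ⟨f, hf, rfl⟩ := h
  refine ⟨Fin.cons A f, ?_, by simp [Fin.sum_univ_succ]⟩
  intro i
  refine Fin.cases ?_ (fun j => ?_) i
  · simpa using hA
  · simpa using hf j

lemma hasLength_add {a b : Multiset G} {k m : ℕ} (h : HasLength a k) (h' : HasLength b m) :
    HasLength (a + b) (k + m) := by
  obtain ⟨f, hf, rfl⟩ := h
  obtain ⟨g, hg, rfl⟩ := h'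
  refine ⟨Fin.append f g, ?_, by simp [Fin.sum_univ_add]⟩
  intro i
  refine Fin.addCases (fun j => ?_) (fun j => ?_) i
  · simpa using hf j
  · simpa using hg j

lemma hasLength_nsmul {a : Multiset G} {k : ℕ} (h : HasLength a k) (n : ℕ) :
    HasLength (n • a) (n * k) := by
  induction n with
  | zero => simpa using hasLength_zero
  | succ n ih => rw [succ_nsmul, Nat.succ_mul]; exact hasLength_add ih h

lemma hasLength_pairs (S : Multiset G) (h : (1 : G) ∉ S) :
    HasLength (S + S.map (fun g => g⁻¹)) S.card := by
  induction S using Multiset.induction_on with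
  | empty => simpa using hasLength_zero
  | cons g S ih =>
    have hg : g ≠ 1 := fun e => h (by simp [e])
    have := hasLength_cons (atom_pair hg) (ih fun e => h (by simp [e]))
    rw [Multiset.card_cons]
    convert this using 1
    rw [Multiset.map_cons, Multiset.insert_eq_cons]
    simp only [← Multiset.singleton_add]
    abel

lemma mem_union [Finite G] (hG : 3 ≤ Nat.card G) (k : ℕ) :
    k * DavenportLarge G ∈ UnionLengths G (2 * k) := by
  obtain ⟨S, hS, hc⟩ := exists_atom_D hG
  have hD := two_le_D hG
  have h1 : (1 : G) ∉ S := fun e => by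
    rw [atom_one hS e] at hc
    simp at hc
    omega
  refine ⟨k • (S + S.map (fun g => g⁻¹)), ?_, ?_, ?_⟩
  · exact isProductOne_nsmul (isProductOne_add hS.2.1 (isProductOne_inv hS.2.1)) k
  · rw [mul_comm]
    have := hasLength_cons hS (hasLength_cons (atom_inv hS) hasLength_zero)
    rw [add_zero] at this
    exact hasLength_nsmul this k
  · rw [← hc]
    exact hasLength_nsmul (hasLength_pairs S h1) k

lemma rho_upper [Finite G] (hG : 3 ≤ Nat.card G) (k : ℕ) :
    2 * rhoK G k ≤ k * DavenportLarge G := by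
  rcases (UnionLengths G k).eq_empty_or_nonempty with h | h
  · simp [rhoK, h]
  · exact union_le hG (Nat.sSup_mem h (bdd_union hG k))

lemma rho_even [Finite G] (hG : 3 ≤ Nat.card G) (k : ℕ) :
    rhoK G (2 * k) = k * DavenportLarge G := by
  apply le_antisymm
  · have := rho_upper hG (2 * k)
    rw [mul_assoc] at this
    omega
  · exact le_csSup (bdd_union hG _) (mem_union hG k)

end Helpers

theorem rho_bounds_and_elasticity (G : Type*) [Group G] [Finite G]
    (hG : 3 ≤ Nat.card G) (k : ℕ) (hk : 1 ≤ k) :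
    2 * rhoK G k ≤ k * DavenportLarge G ∧
    rhoK G (2 * k) = k * DavenportLarge G ∧
    sSup {x : ℝ | ∃ m : ℕ, 1 ≤ m ∧ x = (rhoK G m : ℝ) / m} =
      (DavenportLarge G : ℝ) / 2 := by
  refine ⟨rho_upper hG k, rho_even hG k, ?_⟩
  apply IsGreatest.csSup_eq
  constructor
  · refine ⟨2, by norm_num, ?_⟩
    have := rho_even hG 1
    rw [mul_one, one_mul] at this
    rw [this]
    norm_num
  · rintro x ⟨m, hm, rfl⟩
    have h : (2 : ℝ) * rhoK G m ≤ m * DavenportLarge G := by exact_mod_cast rho_upper hG m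
    have hm' : (0 : ℝ) < m := by exact_mod_cast hm
    rw [div_le_div_iff₀ hm' two_pos]
    linarith
end
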